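/- arXiv:1012.0548 — 4 statements merged into one kernel-verified Lean document; each statement's English description precedes it below -/
import Mathlib

section
/- For any two finite sets A₁ and A₂ of lines in the plane ℝ², there exists a line ℓ such that for each i ∈ {1,2} and each of the two closed halfplanes h bounded by ℓ, there is a subset A' ⊆ A_i that is h-concentrated (all pairwise intersection points of distinct lines of A' lie in h) and satisfies |A'|² ≥ |A_i| (i.e., |A'| is at least the square root of |A_i|). -/
open RealInnerProductSpace

/-- A line in ℝ²: a 1-dimensional affine subspace, i.e. a set of the form
`{p + t • v : t ∈ ℝ}` with `v ≠ 0`. -/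
def IsLine (L : Set (EuclideanSpace ℝ (Fin 2))) : Prop :=
  ∃ p v : EuclideanSpace ℝ (Fin 2), v ≠ 0 ∧ L = {x | ∃ t : ℝ, x = p + t • v}

/-- `h` is a closed halfplane bounded by the line `ℓ`. -/
def IsClosedHalfplaneOf (ℓ h : Set (EuclideanSpace ℝ (Fin 2))) : Prop :=
  ∃ (v : EuclideanSpace ℝ (Fin 2)) (c : ℝ), v ≠ 0 ∧
    h = {x | c ≤ ⟪v, x⟫} ∧ ℓ = {x | ⟪v, x⟫ = c}

/-- A set `A` of lines is `S`-concentrated if all pairwise intersection points of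
distinct lines of `A` lie in `S`. -/
def Concentrated (A : Finset (Set (EuclideanSpace ℝ (Fin 2))))
    (S : Set (EuclideanSpace ℝ (Fin 2))) : Prop :=
  ∀ l₁ ∈ A, ∀ l₂ ∈ A, l₁ ≠ l₂ → l₁ ∩ l₂ ⊆ S

local notation "E" => EuclideanSpace ℝ (Fin 2)

section ErdosSzekeres

variable {α : Type*}

/-- A strict order on a finite set has a rank function whose values are bounded by the sizes of
chains. -/
lemma exists_rank_of_strictOrder (A : Finset α) (r : α → α → Prop)
    (htrans : ∀ a b c, r a b → r b c → r a c) (hirr : ∀ a, ¬ r a a) :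
    ∃ h : α → ℕ, (∀ a ∈ A, ∀ b ∈ A, r a b → h a < h b) ∧
      ∀ a ∈ A, ∃ S ⊆ A, (∀ x ∈ S, ∀ y ∈ S, x ≠ y → r x y ∨ r y x) ∧ h a < S.card := by
  classical
  let F : α → Finset (Finset α) := fun a => A.powerset.filter fun S =>
    (∀ x ∈ S, ∀ y ∈ S, x ≠ y → r x y ∨ r y x) ∧ ∀ x ∈ S, r x a
  have hmem : ∀ a S, S ∈ F a ↔
      S ⊆ A ∧ (∀ x ∈ S, ∀ y ∈ S, x ≠ y → r x y ∨ r y x) ∧ ∀ x ∈ S, r x a := by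
    intro a S
    simp [F]
  have hmax : ∀ a, ∃ S ∈ F a, (F a).sup Finset.card = S.card := fun a =>
    Finset.exists_mem_eq_sup _ ⟨∅, by simp [hmem]⟩ _
  have hinsert : ∀ a ∈ A, ∀ S ∈ F a, insert a S ⊆ A ∧
      (∀ x ∈ insert a S, ∀ y ∈ insert a S, x ≠ y → r x y ∨ r y x) ∧
      (insert a S).card = S.card + 1 := by
    intro a ha S hS
    obtain ⟨hSA, hchain, hbelow⟩ := (hmem a S).1 hS
    refine ⟨Finset.insert_subset ha hSA, ?_, Finset.card_insert_of_notMem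
      fun h => hirr a (hbelow a h)⟩
    intro x hx y hy hxy
    rcases Finset.mem_insert.1 hx with hxa | hxS <;>
      rcases Finset.mem_insert.1 hy with hya | hyS
    · exact absurd (hxa.trans hya.symm) hxy
    · exact Or.inr (hxa ▸ hbelow y hyS)
    · exact Or.inl (hya ▸ hbelow x hxS)
    · exact hchain x hxS y hyS hxy
  refine ⟨fun a => (F a).sup Finset.card, ?_, ?_⟩
  · intro a ha b _ hab
    obtain ⟨S, hS, hcard⟩ := hmax a
    obtain ⟨hsub, hchain, hc⟩ := hinsert a ha S hS
    have hb : insert a S ∈ F b := by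
      refine (hmem b _).2 ⟨hsub, hchain, fun x hx => ?_⟩
      rcases Finset.mem_insert.1 hx with rfl | hx
      · exact hab
      · exact htrans x a b (((hmem a S).1 hS).2.2 x hx) hab
    have := Finset.le_sup (f := Finset.card) hb
    change (F a).sup Finset.card < (F b).sup Finset.card
    omega
  · intro a ha
    obtain ⟨S, hS, hcard⟩ := hmax a
    obtain ⟨hsub, hchain, hc⟩ := hinsert a ha S hS
    refine ⟨insert a S, hsub, hchain, ?_⟩
    change (F a).sup Finset.card < _
    omega

/-- **Erdős–Szekeres** for two strict orders: if any two distinct elements are comparable in one of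
the two orders, then one of the orders has a chain of size at least `√|A|`. -/
lemma exists_chain_of_strictOrders (A : Finset α) (r s : α → α → Prop)
    (hrt : ∀ a b c, r a b → r b c → r a c) (hri : ∀ a, ¬ r a a)
    (hst : ∀ a b c, s a b → s b c → s a c) (hsi : ∀ a, ¬ s a a)
    (hcomp : ∀ a ∈ A, ∀ b ∈ A, a ≠ b → (r a b ∨ r b a) ∨ (s a b ∨ s b a)) :
    ∃ S ⊆ A, A.card ≤ S.card ^ 2 ∧
      ((∀ x ∈ S, ∀ y ∈ S, x ≠ y → r x y ∨ r y x) ∨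
        (∀ x ∈ S, ∀ y ∈ S, x ≠ y → s x y ∨ s y x)) := by
  obtain ⟨f, hf, hf'⟩ := exists_rank_of_strictOrder A r hrt hri
  obtain ⟨g, hg, hg'⟩ := exists_rank_of_strictOrder A s hst hsi
  by_contra! hcon
  have hsmall : ∀ S ⊆ A, ((∀ x ∈ S, ∀ y ∈ S, x ≠ y → r x y ∨ r y x) ∨
      (∀ x ∈ S, ∀ y ∈ S, x ≠ y → s x y ∨ s y x)) → S.card ^ 2 < A.card := by
    intro S hS hch
    by_contra! hle
    obtain ⟨⟨x, hx, y, hy, hxy, h₁, h₂⟩, x', hx', y', hy', hxy', h₁', h₂'⟩ := hcon S hS hle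
    rcases hch with h | h
    · exact (h x hx y hy hxy).elim h₁ h₂
    · exact (h x' hx' y' hy' hxy').elim h₁' h₂'
  have hpos : 0 < A.card := by
    have := hsmall ∅ (by simp) (by simp)
    simpa using this
  have hsqrt : ∀ m : ℕ, m ^ 2 < A.card → m ≤ Nat.sqrt (A.card - 1) := fun m hm =>
    Nat.le_sqrt'.2 (by omega)
  have hle : A.card ≤ (Finset.range (Nat.sqrt (A.card - 1)) ×ˢ
      Finset.range (Nat.sqrt (A.card - 1))).card := by
    refine Finset.card_le_card_of_injOn (fun a => (f a, g a)) ?_ ?_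
    · intro a ha
      obtain ⟨S, hS, hch, hlt⟩ := hf' a ha
      obtain ⟨T, hT, hch', hlt'⟩ := hg' a ha
      have h₁ := hsqrt _ (hsmall S hS (Or.inl hch))
      have h₂ := hsqrt _ (hsmall T hT (Or.inr hch'))
      simp only [Finset.coe_product, Finset.coe_range, Set.mem_prod, Set.mem_Iio]
      omega
    · intro a ha b hb hab
      by_contra hne
      simp only [Prod.mk.injEq] at hab
      rcases hcomp a ha b hb hne with (h | h) | (h | h)
      · exact (hf a ha b hb h).ne hab.1
      · exact (hf b hb a ha h).ne' hab.1
      · exact (hg a ha b hb h).ne hab.2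
      · exact (hg b hb a ha h).ne' hab.2
  rw [Finset.card_product, Finset.card_range] at hle
  have := Nat.sqrt_le (A.card - 1)
  omega

/-- **Erdős–Szekeres** for planar points: among `n` distinct points there are at least `√n` which
form a monotone or an antitone sequence. -/
lemma exists_monotone_or_antitone_subset (A : Finset α) (X K : α → ℝ)
    (hinj : ∀ a ∈ A, ∀ b ∈ A, X a = X b → K a = K b → a = b) :
    ∃ S ⊆ A, A.card ≤ S.card ^ 2 ∧
      ((∀ x ∈ S, ∀ y ∈ S, 0 ≤ (X x - X y) * (K x - K y)) ∨
        (∀ x ∈ S, ∀ y ∈ S, (X x - X y) * (K x - K y) ≤ 0)) := by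
  obtain ⟨S, hS, hcard, h⟩ := exists_chain_of_strictOrders A
    (fun a b => (X a, K a) < (X b, K b)) (fun a b => (X a, -K a) < (X b, -K b))
    (fun _ _ _ => lt_trans) (fun _ => lt_irrefl _) (fun _ _ _ => lt_trans) (fun _ => lt_irrefl _)
    (by
      intro a ha b hb hab
      have hne := hinj a ha b hb
      simp only [Prod.mk_lt_mk, neg_lt_neg_iff, neg_le_neg_iff]
      rcases lt_trichotomy (X a) (X b) with h | h | h <;>
        rcases lt_trichotomy (K a) (K b) with h' | h' | h' <;>
        first
          | exact absurd (hne h h') hab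
          | simp [h, h', h.le, h'.le])
  refine ⟨S, hS, hcard, h.imp (fun h x hx y hy => ?_) fun h x hx y hy => ?_⟩
  · by_cases hxy : x = y
    · simp [hxy]
    · rcases h x hx y hy hxy with h | h
      · exact mul_nonneg_of_nonpos_of_nonpos (sub_nonpos.2 h.le.1) (sub_nonpos.2 h.le.2)
      · exact mul_nonneg (sub_nonneg.2 h.le.1) (sub_nonneg.2 h.le.2)
  · by_cases hxy : x = y
    · simp [hxy]
    · rcases h x hx y hy hxy with h | h
      · exact mul_nonpos_of_nonpos_of_nonneg (sub_nonpos.2 h.le.1)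
          (sub_nonneg.2 (neg_le_neg_iff.1 h.le.2))
      · exact mul_nonpos_of_nonneg_of_nonpos (sub_nonneg.2 h.le.1)
          (sub_nonpos.2 (neg_le_neg_iff.1 h.le.2))

end ErdosSzekeres

lemma inner_eq_coords (x y : E) : ⟪x, y⟫ = x 0 * y 0 + x 1 * y 1 := by
  simp [PiLp.inner_apply, Fin.sum_univ_two, mul_comm]

lemma IsLine.eq_of_mem_of_mem {L M : Set E} (hL : IsLine L) (hM : IsLine M) {x y : E}
    (hxy : x ≠ y) (hxL : x ∈ L) (hyL : y ∈ L) (hxM : x ∈ M) (hyM : y ∈ M) : L = M := by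
  have key : ∀ {N : Set E}, IsLine N → x ∈ N → y ∈ N →
      N = {z | ∃ t : ℝ, z = x + t • (y - x)} := by
    rintro N ⟨p, v, hv, rfl⟩ ⟨a, rfl⟩ ⟨b, rfl⟩
    have hab : b - a ≠ 0 := by
      intro h
      rw [sub_eq_zero.1 h] at hxy
      exact hxy rfl
    ext z
    constructor
    · rintro ⟨t, rfl⟩
      refine ⟨(t - a) / (b - a), ?_⟩
      have : p + b • v - (p + a • v) = (b - a) • v := by module
      rw [this, smul_smul, div_mul_cancel₀ _ hab]
      module
    · rintro ⟨t, rfl⟩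
      exact ⟨a + t * (b - a), by module⟩
  rw [key hL hxL hyL, key hM hxM hyM]

lemma isLine_setOf_inner_eq {u : E} (hu : u ≠ 0) (c : ℝ) : IsLine {x | ⟪u, x⟫ = c} := by
  have hpos : 0 < u 0 ^ 2 + u 1 ^ 2 := by
    have := real_inner_self_pos.2 hu
    rw [inner_eq_coords] at this
    linarith
  refine ⟨(c / (u 0 ^ 2 + u 1 ^ 2)) • u, !₂[-u 1, u 0], ?_, ?_⟩
  · intro h
    apply hu
    have h0 := congrArg (· 0) h
    have h1 := congrArg (· 1) h
    ext i
    fin_cases i <;> simp_all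
  · ext x
    simp only [Set.mem_ofPred_eq, inner_eq_coords]
    constructor
    · intro h
      refine ⟨(-u 1 * x 0 + u 0 * x 1) / (u 0 ^ 2 + u 1 ^ 2), ?_⟩
      ext i
      fin_cases i <;> simp <;> field_simp <;> rw [← h] <;> ring
    · rintro ⟨t, rfl⟩
      simp
      field_simp
      ring

/-- A closed halfplane bounded by `{x | ⟪u, x⟫ = c}` is one of the two obvious ones. -/
lemma IsClosedHalfplaneOf.eq_or_eq {u : E} (hu : u ≠ 0) {c : ℝ} {h : Set E}
    (hh : IsClosedHalfplaneOf {x | ⟪u, x⟫ = c} h) :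
    h = {x | ⟪u, x⟫ ≤ c} ∨ h = {x | c ≤ ⟪u, x⟫} := by
  obtain ⟨v, d, hv, rfl, hℓ⟩ := hh
  obtain ⟨p, w, hw, hline⟩ := isLine_setOf_inner_eq hu c
  have hmem : ∀ t : ℝ, ⟪u, p + t • w⟫ = c ∧ ⟪v, p + t • w⟫ = d := by
    intro t
    have h₁ : p + t • w ∈ {x | ⟪u, x⟫ = c} := by rw [hline]; exact ⟨t, rfl⟩
    exact ⟨h₁, by rw [hℓ] at h₁; exact h₁⟩
  obtain ⟨hc, hd⟩ := hmem 0
  obtain ⟨hc', hd'⟩ := hmem 1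
  simp only [zero_smul, add_zero, one_smul, inner_add_right] at hc hd hc' hd'
  have hpos : 0 < ⟪u, u⟫ := real_inner_self_pos.2 hu
  have huw : u 0 * w 0 + u 1 * w 1 = 0 := by rw [← inner_eq_coords]; linarith
  have hvw : v 0 * w 0 + v 1 * w 1 = 0 := by rw [← inner_eq_coords]; linarith
  have hdet : u 0 * v 1 - u 1 * v 0 = 0 := by
    have h0 : (u 0 * v 1 - u 1 * v 0) * w 0 = 0 := by linear_combination v 1 * huw - u 1 * hvw
    have h1 : (u 0 * v 1 - u 1 * v 0) * w 1 = 0 := by linear_combination u 0 * hvw - v 0 * huw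
    by_contra hne
    apply hw
    ext i
    fin_cases i
    · exact (mul_eq_zero.1 h0).resolve_left hne
    · exact (mul_eq_zero.1 h1).resolve_left hne
  obtain ⟨k, rfl⟩ : ∃ k : ℝ, v = k • u := by
    refine ⟨⟪u, v⟫ / ⟪u, u⟫, ?_⟩
    rw [inner_eq_coords, ← sq, ← sq] at hpos
    rw [inner_eq_coords, inner_eq_coords, ← sq, ← sq]
    ext i
    fin_cases i <;> simp <;> field_simp
    · linear_combination (-u 1) * hdet
    · linear_combination (u 0) * hdet
  have hk : k ≠ 0 := by
    rintro rfl
    simp at hv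
  rw [real_inner_smul_left, hc] at hd
  subst hd
  simp only [real_inner_smul_left]
  rcases hk.lt_or_gt with hk | hk
  · left
    ext x
    exact mul_le_mul_left_of_neg hk
  · right
    ext x
    exact mul_le_mul_iff_right₀ hk

/-- A line not parallel to `{x | ⟪u, x⟫ = c}` is the graph of an affine function of `⟪u, x⟫ - c`. -/
lemma exists_graph_of_line {u p v : E} (huv : ⟪u, v⟫ ≠ 0) (c : ℝ) :
    ∃ X K : ℝ, {x | ∃ t : ℝ, x = p + t • v} =
      {x : E | u 0 * x 1 - u 1 * x 0 = X + K * (⟪u, x⟫ - c)} := by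
  refine ⟨u 0 * p 1 - u 1 * p 0 - (u 0 * v 1 - u 1 * v 0) / ⟪u, v⟫ * (⟪u, p⟫ - c),
    (u 0 * v 1 - u 1 * v 0) / ⟪u, v⟫, ?_⟩
  have hu : u ≠ 0 := by
    rintro rfl
    simp at huv
  have hpos : 0 < ⟪u, u⟫ := real_inner_self_pos.2 hu
  ext x
  simp only [inner_eq_coords] at *
  constructor
  · rintro ⟨t, rfl⟩
    have hK := div_mul_cancel₀ (u 0 * v 1 - u 1 * v 0) huv
    simp only [Set.mem_ofPred_eq, PiLp.add_apply, PiLp.smul_apply, smul_eq_mul]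
    linear_combination (-t) * hK
  · intro h
    simp only [Set.mem_ofPred_eq] at h
    field_simp at h
    refine ⟨(u 0 * (x 0 - p 0) + u 1 * (x 1 - p 1)) / (u 0 * v 0 + u 1 * v 1), ?_⟩
    have hx : (v 1 * (x 0 - p 0) - v 0 * (x 1 - p 1)) = 0 := by
      refine (mul_eq_zero.1 ?_).resolve_left hpos.ne'
      linear_combination -h
    ext i
    fin_cases i <;> simp <;> field_simp
    · linear_combination u 1 * hx
    · linear_combination (-u 0) * hx

/-- If no line of `A` is parallel to `{x | ⟪u, x⟫ = c}`, then at least `√|A|` of the lines are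
concentrated on one side of it. -/
lemma exists_concentrated_of_forall_not_parallel (A : Finset (Set E)) {u : E} (c : ℝ)
    (hA : ∀ L ∈ A, ∃ p v : E, ⟪u, v⟫ ≠ 0 ∧ L = {x | ∃ t : ℝ, x = p + t • v}) :
    ∃ S ⊆ A, A.card ≤ S.card ^ 2 ∧
      (Concentrated S {x | ⟪u, x⟫ ≤ c} ∨ Concentrated S {x | c ≤ ⟪u, x⟫}) := by
  have hgraph : ∀ L ∈ A, ∃ X K : ℝ,
      L = {x : E | u 0 * x 1 - u 1 * x 0 = X + K * (⟪u, x⟫ - c)} := by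
    intro L hL
    obtain ⟨p, v, huv, rfl⟩ := hA L hL
    exact exists_graph_of_line huv c
  choose! X K hXK using hgraph
  obtain ⟨S, hS, hcard, h⟩ := exists_monotone_or_antitone_subset A X K (by
    intro L hL M hM h₁ h₂
    rw [hXK L hL, hXK M hM, h₁, h₂])
  have hmeet : ∀ L ∈ S, ∀ M ∈ S, L ≠ M → ∀ x ∈ L ∩ M,
      X L - X M = -((K L - K M) * (⟪u, x⟫ - c)) ∧ K L ≠ K M := by
    intro L hL M hM hne x hx
    have h₁ := hx.1
    have h₂ := hx.2
    rw [hXK L (hS hL), Set.mem_ofPred_eq] at h₁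
    rw [hXK M (hS hM), Set.mem_ofPred_eq] at h₂
    have heq : X L - X M = -((K L - K M) * (⟪u, x⟫ - c)) := by linarith
    refine ⟨heq, fun hK => hne ?_⟩
    rw [hXK L (hS hL), hXK M (hS hM), hK]
    rw [hK, sub_self, zero_mul, neg_zero, sub_eq_zero] at heq
    rw [heq]
  refine ⟨S, hS, hcard, h.imp (fun h L hL M hM hne x hx => ?_) fun h L hL M hM hne x hx => ?_⟩
  · obtain ⟨h₁, h₂⟩ := hmeet L hL M hM hne x hx
    have := h L hL M hM
    rw [h₁] at this
    have hpos : 0 < (K L - K M) ^ 2 := by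
      have := sub_ne_zero.2 h₂
      positivity
    change ⟪u, x⟫ ≤ c
    by_contra! hlt
    nlinarith [mul_pos hpos (sub_pos.2 hlt)]
  · obtain ⟨h₁, h₂⟩ := hmeet L hL M hM hne x hx
    have := h L hL M hM
    rw [h₁] at this
    have hpos : 0 < (K L - K M) ^ 2 := by
      have := sub_ne_zero.2 h₂
      positivity
    change c ≤ ⟪u, x⟫
    by_contra! hlt
    nlinarith [mul_pos hpos (sub_pos.2 hlt)]

lemma dense_setOf_forall_inner_ne_zero {ι : Type*} (s : Finset ι) (v : ι → E)
    (hv : ∀ i ∈ s, v i ≠ 0) : Dense {u : E | ∀ i ∈ s, ⟪u, v i⟫ ≠ 0} := by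
  have hset : {u : E | ∀ i ∈ s, ⟪u, v i⟫ ≠ 0} = ⋂ i ∈ (s : Set ι), {u : E | ⟪u, v i⟫ ≠ 0} := by
    ext u
    simp
  rw [hset]
  refine dense_biInter_of_isOpen (fun i _ => ?_) s.countable_toSet fun i hi => ?_
  · exact isOpen_ne_fun (by fun_prop) continuous_const
  · have hker : {u : E | ⟪u, v i⟫ ≠ 0} = ((LinearMap.ker (innerₛₗ ℝ (v i)) : Set E))ᶜ := by
      ext u
      simp [real_inner_comm]
    rw [hker, ← interior_eq_empty_iff_dense_compl, ← Set.not_nonempty_iff_eq_empty]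
    intro hne
    have htop := Submodule.eq_top_of_nonempty_interior' _ hne
    have hmem : v i ∈ LinearMap.ker (innerₛₗ ℝ (v i)) := htop ▸ Submodule.mem_top
    exact hv i hi (by simpa using hmem)

/-- A continuous version of the function sending `u` to the least `c` such that some member of `F`
lies in `{x | ⟪u, x⟫ ≤ c}`, cut off below at `-R * ‖u‖` to allow for empty members of `F`. -/
lemma exists_continuous_threshold (F : Finset (Finset E)) (hF : F.Nonempty) (R : ℝ)
    (hR : ∀ S ∈ F, ∀ p ∈ S, ‖p‖ ≤ R) (hR₀ : 0 ≤ R) :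
    ∃ f : E → ℝ, Continuous f ∧ (∀ u, -(R * ‖u‖) ≤ f u) ∧ (∀ u, f u ≤ R * ‖u‖) ∧
      ∀ u c, -(R * ‖u‖) ≤ c → (f u ≤ c ↔ ∃ S ∈ F, ∀ p ∈ S, ⟪u, p⟫ ≤ c) := by
  have hiff : ∀ u c, -(R * ‖u‖) ≤ c →
      (((F.inf' hF fun S => S.sup fun p => (⟪u, p⟫ + R * ‖u‖).toNNReal : NNReal) : ℝ)
        - R * ‖u‖ ≤ c ↔ ∃ S ∈ F, ∀ p ∈ S, ⟪u, p⟫ ≤ c) := by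
    intro u c hc
    have hc' : 0 ≤ c + R * ‖u‖ := by linarith
    rw [sub_le_iff_le_add, ← Real.le_toNNReal_iff_coe_le hc', Finset.inf'_le_iff]
    simp only [Finset.sup_le_iff]
    refine exists_congr fun S => and_congr_right fun _ => forall₂_congr fun p _ => ?_
    rw [Real.toNNReal_le_toNNReal_iff hc', add_le_add_iff_right]
  refine ⟨_, ?_, fun u => ?_, fun u => ?_, hiff⟩
  · refine Continuous.sub (NNReal.continuous_coe.comp ?_) (by fun_prop)
    refine Continuous.finset_inf'_apply hF fun S _ => Continuous.finset_sup_apply fun p _ => ?_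
    fun_prop
  · have := NNReal.coe_nonneg (F.inf' hF fun S => S.sup fun p => (⟪u, p⟫ + R * ‖u‖).toNNReal)
    linarith
  · have hnn : 0 ≤ R * ‖u‖ := by positivity
    obtain ⟨S, hS⟩ := hF
    refine (hiff u _ (by linarith)).2 ⟨S, hS, fun p hp => ?_⟩
    calc ⟪u, p⟫ ≤ ‖u‖ * ‖p‖ := real_inner_le_norm u p
      _ ≤ R * ‖u‖ := by nlinarith [hR S hS p hp, norm_nonneg u]

/-- The threshold function of an arrangement: `c ≥ f u` suffices for `{x | ⟪u, x⟫ ≤ c}` to be good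
for `A`, and `f u + f (-u) ≤ 0` says that every direction has a cut which is good for both sides. -/
lemma exists_continuous_threshold_of_lines (A : Finset (Set E)) (hA : ∀ L ∈ A, IsLine L) :
    ∃ f : E → ℝ, Continuous f ∧ (∀ u, f u + f (-u) ≤ 0) ∧
      ∀ u c, f u ≤ c → ∃ S ⊆ A, Concentrated S {x | ⟪u, x⟫ ≤ c} ∧ A.card ≤ S.card ^ 2 := by
  classical
  have hfin : {x : E | ∃ L ∈ A, ∃ M ∈ A, L ≠ M ∧ x ∈ L ∩ M}.Finite := by
    have : {x : E | ∃ L ∈ A, ∃ M ∈ A, L ≠ M ∧ x ∈ L ∩ M} ⊆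
        ⋃ q ∈ ((A ×ˢ A).filter fun q => q.1 ≠ q.2 : Finset (Set E × Set E)), q.1 ∩ q.2 := by
      rintro x ⟨L, hL, M, hM, hne, hx⟩
      simp only [Set.mem_iUnion]
      exact ⟨(L, M), by simp [hL, hM, hne], hx⟩
    refine Set.Finite.subset (Set.Finite.biUnion (Finset.finite_toSet _) ?_) this
    intro q hq
    simp only [Finset.coe_filter, Finset.mem_product, Set.mem_ofPred_eq] at hq
    refine Set.Subsingleton.finite fun x hx y hy => ?_
    by_contra hxy
    exact hq.2 ((hA _ hq.1.1).eq_of_mem_of_mem (hA _ hq.1.2) hxy hx.1 hy.1 hx.2 hy.2)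
  let pts : Finset (Set E) → Finset E := fun S =>
    hfin.toFinset.filter fun x => ∃ L ∈ S, ∃ M ∈ S, L ≠ M ∧ x ∈ L ∩ M
  have hpts : ∀ S ⊆ A, ∀ H : Set E, Concentrated S H ↔ ∀ p ∈ pts S, p ∈ H := by
    intro S hS H
    constructor
    · intro h p hp
      obtain ⟨L, hL, M, hM, hne, hx⟩ := (Finset.mem_filter.1 hp).2
      exact h L hL M hM hne hx
    · intro h L hL M hM hne x hx
      refine h x (Finset.mem_filter.2 ⟨?_, L, hL, M, hM, hne, hx⟩)
      exact hfin.mem_toFinset.2 ⟨L, hS hL, M, hS hM, hne, hx⟩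
  let F : Finset (Finset E) := (A.powerset.filter fun S => A.card ≤ S.card ^ 2).image pts
  have hF : F.Nonempty := by
    refine ⟨pts A, Finset.mem_image_of_mem _ (Finset.mem_filter.2 ⟨by simp, ?_⟩)⟩
    exact Nat.le_self_pow two_ne_zero _
  have hexists : ∀ u c, (∃ T ∈ F, ∀ p ∈ T, ⟪u, p⟫ ≤ c) ↔
      ∃ S ⊆ A, Concentrated S {x | ⟪u, x⟫ ≤ c} ∧ A.card ≤ S.card ^ 2 := by
    intro u c
    constructor
    · rintro ⟨T, hT, h⟩
      obtain ⟨S, hS, rfl⟩ := Finset.mem_image.1 hT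
      obtain ⟨hSA, hcard⟩ := Finset.mem_filter.1 hS
      rw [Finset.mem_powerset] at hSA
      exact ⟨S, hSA, (hpts S hSA _).2 h, hcard⟩
    · rintro ⟨S, hSA, h, hcard⟩
      exact ⟨pts S, Finset.mem_image_of_mem _
        (Finset.mem_filter.2 ⟨Finset.mem_powerset.2 hSA, hcard⟩), (hpts S hSA _).1 h⟩
  obtain ⟨R, hR₀, hR⟩ : ∃ R : ℝ, 0 ≤ R ∧ ∀ T ∈ F, ∀ p ∈ T, ‖p‖ ≤ R := by
    obtain ⟨R, hR₀, hR⟩ := hfin.isBounded.exists_pos_norm_le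
    refine ⟨R, hR₀.le, fun T hT p hp => ?_⟩
    obtain ⟨S, -, rfl⟩ := Finset.mem_image.1 hT
    exact hR p (hfin.mem_toFinset.1 (Finset.mem_filter.1 hp).1)
  obtain ⟨f, hcont, hlow, hupp, hf⟩ := exists_continuous_threshold F hF R hR hR₀
  refine ⟨f, hcont, ?_, fun u c hc => (hexists u c).1 ((hf u c ((hlow u).trans hc)).1 hc)⟩
  choose! p v hv hL using hA
  have hdense := dense_setOf_forall_inner_ne_zero A v hv
  have hclosed : IsClosed {u : E | f u + f (-u) ≤ 0} :=
    isClosed_le (by fun_prop) continuous_const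
  intro u
  refine hclosed.closure_subset_iff.2 (fun u hu => ?_) (hdense u)
  by_contra hpos
  rw [Set.mem_ofPred_eq, not_le] at hpos
  have h₁ := hupp u
  have h₂ := hupp (-u)
  rw [norm_neg] at h₂
  obtain ⟨S, hSA, hcard, h | h⟩ := exists_concentrated_of_forall_not_parallel A
    (u := u) ((f u - f (-u)) / 2) fun L hLA => ⟨p L, v L, hu L hLA, hL L hLA⟩
  · have := (hf u _ (by linarith [hlow u])).2 ((hexists _ _).2 ⟨S, hSA, h, hcard⟩)
    linarith
  · have := (hf (-u) (-((f u - f (-u)) / 2)) (by rw [norm_neg]; linarith [hlow (-u)])).2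
      ((hexists _ _).2 ⟨S, hSA, by simpa [inner_neg_left] using h, hcard⟩)
    linarith

/-- An odd continuous function on the plane vanishes at some nonzero vector. -/
lemma exists_ne_zero_of_odd {g : E → ℝ} (hg : Continuous g) (hodd : ∀ u, g (-u) = -g u) :
    ∃ u, u ≠ 0 ∧ g u = 0 := by
  let γ : ℝ → E := fun t => !₂[t, 1 - t ^ 2]
  have hγ : Continuous γ := by
    fun_prop
  have hneg : γ (-1) = -γ 1 := by
    ext i
    fin_cases i <;> simp [γ]
  have hne : ∀ t, γ t ≠ 0 := by
    intro t h
    have h0 : t = 0 := by simpa [γ] using congrArg (· 0) h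
    have h1 : 1 - t ^ 2 = 0 := by simpa [γ] using congrArg (· 1) h
    rw [h0] at h1
    norm_num at h1
  obtain ⟨t, ht⟩ : ∃ t, g (γ t) = 0 := by
    have h : g (γ (-1)) = -g (γ 1) := by rw [hneg, hodd]
    rcases le_total 0 (g (γ 1)) with h' | h'
    · exact mem_range_of_exists_le_of_exists_ge (hg.comp hγ)
        ⟨-1, by simpa [h] using h'⟩ ⟨1, h'⟩
    · exact mem_range_of_exists_le_of_exists_ge (hg.comp hγ)
        ⟨1, h'⟩ ⟨-1, by simpa [h] using h'⟩
  exact ⟨γ t, hne t, ht⟩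

/-- Ham-sandwich cut theorem for two line arrangements: there is a line `ℓ` such that
for each of the two sets and each closed halfplane bounded by `ℓ`, there is
an `h`-concentrated subset of size at least the square root of the set's size. -/
theorem ham_sandwich_lines (A₁ A₂ : Finset (Set (EuclideanSpace ℝ (Fin 2))))
    (h₁ : ∀ L ∈ A₁, IsLine L) (h₂ : ∀ L ∈ A₂, IsLine L) :
    ∃ ℓ : Set (EuclideanSpace ℝ (Fin 2)), IsLine ℓ ∧
      ∀ h : Set (EuclideanSpace ℝ (Fin 2)), IsClosedHalfplaneOf ℓ h →
        (∃ A' ⊆ A₁, Concentrated A' h ∧ A₁.card ≤ A'.card ^ 2) ∧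
        (∃ A' ⊆ A₂, Concentrated A' h ∧ A₂.card ≤ A'.card ^ 2) := by
  obtain ⟨f, hfc, hf, hfA⟩ := exists_continuous_threshold_of_lines A₁ h₁
  obtain ⟨g, hgc, hg, hgA⟩ := exists_continuous_threshold_of_lines A₂ h₂
  obtain ⟨u, hu, hzero⟩ := exists_ne_zero_of_odd
    (g := fun u => f u - f (-u) - (g u - g (-u))) (by fun_prop) (fun u => by
      simp only [neg_neg]
      ring)
  have hfu := hf u
  have hgu := hg u
  have hneg : ∀ c : ℝ, {x : E | ⟪-u, x⟫ ≤ -c} = {x | c ≤ ⟪u, x⟫} := fun c => by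
    ext x
    simp [inner_neg_left]
  refine ⟨{x | ⟪u, x⟫ = (f u - f (-u)) / 2}, isLine_setOf_inner_eq hu _, fun h hh => ?_⟩
  rcases hh.eq_or_eq hu with rfl | rfl
  · exact ⟨hfA u _ (by linarith), hgA u _ (by linarith)⟩
  · rw [← hneg]
    exact ⟨hfA (-u) _ (by linarith), hgA (-u) _ (by linarith)⟩
end

section
/- For any finite set A of lines in the plane ℝ², there exists a point q ∈ ℝ² such that for every open halfplane h containing q, there is a subset A' ⊆ A that is h-concentrated (all pairwise intersection points of distinct lines of A' lie in h) and satisfies 3|A'|² ≥ |A| (i.e., |A'| is at least the square root of |A|/3). -/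
open RealInnerProductSpace

/-- An open halfplane in ℝ². -/
def IsOpenHalfplane (h : Set (EuclideanSpace ℝ (Fin 2))) : Prop :=
  ∃ (v : EuclideanSpace ℝ (Fin 2)) (c : ℝ), v ≠ 0 ∧ h = {x | c < ⟪v, x⟫}

/-- A finite set carrying a transitive irreflexive relation contains, if it has more than `a * b`
elements, a chain with more than `a` or an antichain with more than `b` elements. -/
theorem exists_chain_or_antichain_of_mul_lt_card {α : Type*} (r : α → α → Prop)
    (htrans : ∀ x y z, r x y → r y z → r x z) (hirr : ∀ x, ¬ r x x) (a b : ℕ) (B : Finset α)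
    (hB : a * b < B.card) :
    (∃ C ⊆ B, a < C.card ∧ ∀ x ∈ C, ∀ y ∈ C, x ≠ y → r x y ∨ r y x) ∨
      ∃ C ⊆ B, b < C.card ∧ ∀ x ∈ C, ∀ y ∈ C, ¬ r x y := by
  classical
  by_contra! hcon
  obtain ⟨hchain, hanti⟩ := hcon
  have hrank : ∀ x ∈ B, ∃ k ∈ Finset.range a,
      (∃ C ⊆ B, C.card = k + 1 ∧ x ∈ C ∧ (∀ y ∈ C, y ≠ x → r y x) ∧
        ∀ y ∈ C, ∀ z ∈ C, y ≠ z → r y z ∨ r z y) ∧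
      ¬ ∃ C ⊆ B, C.card = k + 2 ∧ x ∈ C ∧ (∀ y ∈ C, y ≠ x → r y x) ∧
        ∀ y ∈ C, ∀ z ∈ C, y ≠ z → r y z ∨ r z y := by
    intro x hx
    by_contra! hno
    have hall : ∀ k, ∃ C ⊆ B, C.card = k + 1 ∧ x ∈ C ∧ (∀ y ∈ C, y ≠ x → r y x) ∧
        ∀ y ∈ C, ∀ z ∈ C, y ≠ z → r y z ∨ r z y := by
      intro k
      induction k with
      | zero => exact ⟨{x}, by simpa using hx, by simp, by simp, by simp, by simp⟩
      | succ k ih =>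
        obtain ⟨C, hC, hcard, hxC, hmax, hcomp⟩ := ih
        have hka : k < a := by
          by_contra! hak
          obtain ⟨y, hy, z, hz, hne, h1, h2⟩ := hchain C hC (by omega)
          rcases hcomp y hy z hz hne with h | h <;> tauto
        exact hno k (Finset.mem_range.2 hka) ⟨C, hC, hcard, hxC, hmax, hcomp⟩
    obtain ⟨C, hC, hcard, -, -, hcomp⟩ := hall a
    obtain ⟨y, hy, z, hz, hne, h1, h2⟩ := hchain C hC (by omega)
    rcases hcomp y hy z hz hne with h | h <;> tauto
  choose! f hf hfC hfN using hrank
  obtain ⟨k, -, hk⟩ := Finset.exists_lt_card_fiber_of_mul_lt_card_of_maps_to (n := b) hf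
    (by simpa using hB)
  obtain ⟨x, hx, y, hy, hxy⟩ := hanti _ (Finset.filter_subset _ _) hk
  rw [Finset.mem_filter] at hx hy
  obtain ⟨C, hC, hcard, hxC, hmax, hcomp⟩ := hfC x hx.1
  have hCy : ∀ z ∈ C, r z y := fun z hz ↦ by
    by_cases hzx : z = x
    · exact hzx ▸ hxy
    · exact htrans _ _ _ (hmax z hz hzx) hxy
  have hyC : y ∉ C := fun h ↦ hirr y (hCy y h)
  refine hfN y hy.1 ⟨insert y C, Finset.insert_subset hy.1 hC, ?_, by simp, ?_, ?_⟩
  · rw [Finset.card_insert_of_notMem hyC, hcard, hx.2, hy.2]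
  · intro z hz hzy
    exact hCy z (Finset.mem_of_mem_insert_of_ne hz hzy)
  · intro z hz w hw hzw
    rcases Finset.mem_insert.1 hz with hz' | hz' <;> rcases Finset.mem_insert.1 hw with hw' | hw'
    · exact absurd (hz'.trans hw'.symm) hzw
    · exact Or.inr (hz' ▸ hCy w hw')
    · exact Or.inl (hw' ▸ hCy z hz')
    · exact hcomp z hz' w hw' hzw

/-- A finite set with a transitive irreflexive relation contains a chain or an antichain of
size at least the square root of its cardinality. -/
theorem exists_chain_or_antichain_card_le_sq {α : Type*} (r : α → α → Prop)
    (htrans : ∀ x y z, r x y → r y z → r x z) (hirr : ∀ x, ¬ r x x) (B : Finset α) :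
    ∃ C ⊆ B, B.card ≤ C.card ^ 2 ∧
      ((∀ x ∈ C, ∀ y ∈ C, x ≠ y → r x y ∨ r y x) ∨ ∀ x ∈ C, ∀ y ∈ C, ¬ r x y) := by
  by_contra! hcon
  have hB0 : 0 < B.card := by
    by_contra! h0
    exact absurd (hcon ∅ (by simp) (by simpa using h0)).1 (by simp)
  obtain ⟨m, hm⟩ : ∃ m, m = Nat.sqrt (B.card - 1) := ⟨_, rfl⟩
  have h1 : m * m < B.card := by
    have := Nat.sqrt_le (B.card - 1)
    rw [← hm] at this
    omega
  have h2 : ∀ n, m < n → B.card ≤ n ^ 2 := fun n hn ↦ by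
    have := Nat.sqrt_lt.1 (hm ▸ hn)
    rw [pow_two]
    omega
  rcases exists_chain_or_antichain_of_mul_lt_card r htrans hirr m m B h1 with
    ⟨C, hC, hcard, h⟩ | ⟨C, hC, hcard, h⟩
  · obtain ⟨⟨x, hx, y, hy, hne, h1, h2⟩, -⟩ := hcon C hC (h2 _ hcard)
    rcases h x hx y hy hne with h | h <;> tauto
  · obtain ⟨-, x, hx, y, hy, hxy⟩ := hcon C hC (h2 _ hcard)
    exact h x hx y hy hxy

/-- In coordinates adapted to a direction `v` and a level `c`, a line is either a graph over the
`v`-axis or a level set of `⟪v, ·⟫`. -/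
theorem IsLine.graph_or_level {L : Set (EuclideanSpace ℝ (Fin 2))} (hL : IsLine L)
    {v : EuclideanSpace ℝ (Fin 2)} (hv : v ≠ 0) (c : ℝ) :
    (∃ a s : ℝ, ∀ x, x ∈ L ↔ v 0 * x 1 - v 1 * x 0 = a + s * (⟪v, x⟫ - c)) ∨
      ∃ d : ℝ, ∀ x, x ∈ L ↔ ⟪v, x⟫ = d := by
  obtain ⟨p, w, hw, rfl⟩ := hL
  have hN : v 0 * v 0 + v 1 * v 1 ≠ 0 := by
    intro h
    apply hv
    ext i
    have h0 := mul_self_nonneg (v 0)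
    have h1 := mul_self_nonneg (v 1)
    fin_cases i
    · exact (mul_self_eq_zero.1 (by linarith) : v 0 = 0)
    · exact (mul_self_eq_zero.1 (by linarith) : v 1 = 0)
  have hin : ∀ x : EuclideanSpace ℝ (Fin 2), ⟪v, x⟫ = v 0 * x 0 + v 1 * x 1 := fun x ↦ by
    simp [PiLp.inner_apply, Fin.sum_univ_two, mul_comm]
  have hw' : ¬ (w 0 = 0 ∧ w 1 = 0) := fun h ↦ hw (by ext i; fin_cases i <;> simp [h.1, h.2])
  have hmem : ∀ x : EuclideanSpace ℝ (Fin 2), x ∈ {x | ∃ t : ℝ, x = p + t • w} ↔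
      w 0 * (x 1 - p 1) = w 1 * (x 0 - p 0) := by
    intro x
    constructor
    · rintro ⟨t, rfl⟩
      simp; ring
    · intro h
      by_cases h0 : w 0 = 0
      · have h1 : w 1 ≠ 0 := fun h1 ↦ hw' ⟨h0, h1⟩
        refine ⟨(x 1 - p 1) / w 1, ?_⟩
        have : x 0 - p 0 = 0 := by simpa [h0, h1] using h
        ext i
        fin_cases i
        · simp [h0]; linarith
        · simp [h1]
      · refine ⟨(x 0 - p 0) / w 0, ?_⟩
        ext i
        fin_cases i
        · simp [h0]
        · simp; field_simp; linarith
  simp only [hmem, hin]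
  obtain ⟨e, he⟩ : ∃ e, e = v 0 * w 0 + v 1 * w 1 := ⟨_, rfl⟩
  obtain ⟨g, hg⟩ : ∃ g, g = v 0 * w 1 - v 1 * w 0 := ⟨_, rfl⟩
  have hw0 : (v 0 * v 0 + v 1 * v 1) * w 0 = v 0 * e - v 1 * g := by rw [he, hg]; ring
  have hw1 : (v 0 * v 0 + v 1 * v 1) * w 1 = v 1 * e + v 0 * g := by rw [he, hg]; ring
  have key : ∀ x : EuclideanSpace ℝ (Fin 2), w 0 * (x 1 - p 1) = w 1 * (x 0 - p 0) ↔
      e * ((v 0 * x 1 - v 1 * x 0) - (v 0 * p 1 - v 1 * p 0)) =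
        g * ((v 0 * x 0 + v 1 * x 1) - (v 0 * p 0 + v 1 * p 1)) := by
    intro x
    rw [← mul_right_inj' hN]
    constructor <;> intro h <;> rw [he, hg] at * <;> linear_combination h
  simp only [key]
  by_cases h0 : e = 0
  · right
    have hg0 : g ≠ 0 := by
      rintro rfl
      rw [h0] at hw0 hw1
      exact hw' ⟨by simpa [hN] using hw0, by simpa [hN] using hw1⟩
    refine ⟨v 0 * p 0 + v 1 * p 1, fun x ↦ ?_⟩
    rw [h0, zero_mul, eq_comm, mul_eq_zero, or_iff_right hg0, sub_eq_zero]
  · left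
    refine ⟨v 0 * p 1 - v 1 * p 0 + g / e * (c - (v 0 * p 0 + v 1 * p 1)), g / e, fun x ↦ ?_⟩
    rw [← mul_right_inj' h0 (b := v 0 * x 1 - v 1 * x 0)]
    have : e * (g / e) = g := by field_simp
    constructor <;> intro h
    · linear_combination h - (v 0 * x 0 + v 1 * x 1 - (v 0 * p 0 + v 1 * p 1)) * this
    · linear_combination h + (v 0 * x 0 + v 1 * x 1 - (v 0 * p 0 + v 1 * p 1)) * this

/-- Lines can be ordered by height and slope so that two distinct lines cross in a given open
halfplane exactly if they are comparable. -/
theorem IsOpenHalfplane.exists_height_slope {h : Set (EuclideanSpace ℝ (Fin 2))}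
    (hh : IsOpenHalfplane h) :
    ∃ α σ : Set (EuclideanSpace ℝ (Fin 2)) → EReal, ∀ L M, IsLine L → IsLine M → L ≠ M →
      ∀ x ∈ L ∩ M, (x ∈ h ↔ (α M < α L ∧ σ L < σ M) ∨ (α L < α M ∧ σ M < σ L)) := by
  classical
  obtain ⟨v, c, hv, rfl⟩ := hh
  have hex : ∀ L : Set (EuclideanSpace ℝ (Fin 2)), IsLine L → ∃ α σ : EReal,
      (∃ a s : ℝ, α = a ∧ σ = s ∧
        ∀ x, x ∈ L ↔ v 0 * x 1 - v 1 * x 0 = a + s * (⟪v, x⟫ - c)) ∨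
      ∃ d : ℝ, α = (if c < d then ⊤ else ⊥) ∧ σ = ⊥ ∧ ∀ x, x ∈ L ↔ ⟪v, x⟫ = d := by
    intro L hL
    rcases hL.graph_or_level hv c with ⟨a, s, H⟩ | ⟨d, H⟩
    · exact ⟨a, s, Or.inl ⟨a, s, rfl, rfl, H⟩⟩
    · exact ⟨_, _, Or.inr ⟨d, rfl, rfl, H⟩⟩
  choose! α σ hασ using hex
  refine ⟨α, σ, fun L M hL hM hne x hx ↦ ?_⟩
  change c < ⟪v, x⟫ ↔ _
  rcases hασ L hL with ⟨a, s, ha, hs, H⟩ | ⟨d, ha, hs, H⟩ <;>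
    rcases hασ M hM with ⟨a', s', ha', hs', H'⟩ | ⟨d', ha', hs', H'⟩ <;>
    rw [ha, hs, ha', hs']
  · simp only [EReal.coe_lt_coe_iff]
    have e := (H x).1 hx.1
    have e' := (H' x).1 hx.2
    have hne' : ¬ (a = a' ∧ s = s') := fun h ↦ hne (by ext y; rw [H, H', h.1, h.2])
    have hE : a - a' = (s' - s) * (⟪v, x⟫ - c) := by linarith
    constructor
    · intro hc
      have hc' : 0 < ⟪v, x⟫ - c := sub_pos.2 hc
      rcases lt_trichotomy s s' with hss | hss | hss
      · left; exact ⟨by nlinarith [mul_pos (sub_pos.2 hss) hc'], hss⟩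
      · exact absurd ⟨by rw [hss] at hE; linarith, hss⟩ hne'
      · right; exact ⟨by nlinarith [mul_pos (sub_pos.2 hss) hc'], hss⟩
    · rintro (⟨h1, h2⟩ | ⟨h1, h2⟩)
      · exact sub_pos.1 (pos_of_mul_pos_right (by linarith) (sub_pos.2 h2).le)
      · have : 0 < (s - s') * (⟪v, x⟫ - c) := by linarith
        exact sub_pos.1 (pos_of_mul_pos_right this (sub_pos.2 h2).le)
  · rw [(H' x).1 hx.2]
    split_ifs with h <;> simp [h, EReal.coe_lt_top, EReal.bot_lt_coe]
  · rw [(H x).1 hx.1]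
    split_ifs with h <;> simp [h, EReal.coe_lt_top, EReal.bot_lt_coe]
  · exact absurd (by ext y; rw [H, H', ← (H x).1 hx.1, (H' x).1 hx.2]) hne

/-- If all crossings of `B` lie in the union of two open halfplanes, then one of them contains
all crossings of some subset of `B` of size at least `√|B|`. -/
theorem exists_concentrated_of_concentrated_union
    {B : Finset (Set (EuclideanSpace ℝ (Fin 2)))} (hB : ∀ L ∈ B, IsLine L)
    {g h : Set (EuclideanSpace ℝ (Fin 2))} (hg : IsOpenHalfplane g)
    (hgh : Concentrated B (g ∪ h)) :
    ∃ C ⊆ B, B.card ≤ C.card ^ 2 ∧ (Concentrated C g ∨ Concentrated C h) := by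
  obtain ⟨α, σ, H⟩ := hg.exists_height_slope
  obtain ⟨C, hC, hcard, hCr⟩ := exists_chain_or_antichain_card_le_sq
    (fun L M ↦ α M < α L ∧ σ L < σ M)
    (fun _ _ _ h1 h2 ↦ ⟨h2.1.trans h1.1, h1.2.trans h2.2⟩) (fun _ h1 ↦ lt_irrefl _ h1.1) B
  refine ⟨C, hC, hcard, hCr.imp ?_ ?_⟩
  · intro hr L hL M hM hne x hx
    exact (H L M (hB L (hC hL)) (hB M (hC hM)) hne x hx).2 (hr L hL M hM hne)
  · intro hr L hL M hM hne x hx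
    refine (hgh L (hC hL) M (hC hM) hne hx).resolve_left fun hxg ↦ ?_
    exact ((H L M (hB L (hC hL)) (hB M (hC hM)) hne x hx).1 hxg).elim
      (hr L hL M hM) (hr M hM L hL)

theorem IsLine.collinear {L : Set (EuclideanSpace ℝ (Fin 2))} (hL : IsLine L) :
    Collinear ℝ L := by
  obtain ⟨p, v, -, rfl⟩ := hL
  rw [collinear_iff_exists_forall_eq_smul_vadd]
  refine ⟨p, v, ?_⟩
  rintro _ ⟨t, rfl⟩
  exact ⟨t, by rw [vadd_eq_add, add_comm]⟩

/-- A line is determined by any two of its points. -/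
theorem IsLine.inter_subsingleton {L M : Set (EuclideanSpace ℝ (Fin 2))} (hL : IsLine L)
    (hM : IsLine M) (hne : L ≠ M) : (L ∩ M).Subsingleton := by
  have key : ∀ {N : Set (EuclideanSpace ℝ (Fin 2))}, IsLine N → ∀ x ∈ N, ∀ y ∈ N, x ≠ y →
      N = {z | ∃ t : ℝ, z = x + t • (y - x)} := by
    rintro _ ⟨p, v, -, rfl⟩ _ ⟨t, rfl⟩ _ ⟨s, rfl⟩ hxy
    have hst : s - t ≠ 0 := fun h ↦ hxy (by rw [sub_eq_zero.1 h])
    ext z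
    constructor
    · rintro ⟨r, rfl⟩
      refine ⟨(r - t) / (s - t), ?_⟩
      rw [add_sub_add_left_eq_sub, ← sub_smul, smul_smul, div_mul_cancel₀ _ hst]
      module
    · rintro ⟨r, rfl⟩
      exact ⟨t + r * (s - t), by module⟩
  intro x hx y hy
  by_contra hxy
  exact hne ((key hL x hx.1 y hy.1 hxy).trans (key hM x hx.2 y hy.2 hxy).symm)

theorem IsOpenHalfplane.convex_compl {h : Set (EuclideanSpace ℝ (Fin 2))}
    (hh : IsOpenHalfplane h) : Convex ℝ hᶜ := by
  obtain ⟨v, c, -, rfl⟩ := hh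
  have : {x : EuclideanSpace ℝ (Fin 2) | c < ⟪v, x⟫}ᶜ = {x | ⟪v, x⟫ ≤ c} := by
    ext; simp
  rw [this]
  exact convex_halfSpace_le (innerₛₗ ℝ v).isLinear c

/-- A line meeting each pairwise intersection of three sets in points of `P` forces the convex
hulls of the traces of these sets on `P` to have a common point. -/
theorem Collinear.exists_mem_convexHull_inter {E : Type*} [AddCommGroup E] [Module ℝ E]
    {L P K₁ K₂ K₃ : Set E} (hL : Collinear ℝ L) (h₁ : (L ∩ P ∩ K₂ ∩ K₃).Nonempty)
    (h₂ : (L ∩ P ∩ K₁ ∩ K₃).Nonempty) (h₃ : (L ∩ P ∩ K₁ ∩ K₂).Nonempty) :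
    (convexHull ℝ (P ∩ K₁) ∩ convexHull ℝ (P ∩ K₂) ∩ convexHull ℝ (P ∩ K₃)).Nonempty := by
  obtain ⟨x, ⟨⟨hxL, hxP⟩, hx2⟩, hx3⟩ := h₁
  obtain ⟨y, ⟨⟨hyL, hyP⟩, hy1⟩, hy3⟩ := h₂
  obtain ⟨z, ⟨⟨hzL, hzP⟩, hz1⟩, hz2⟩ := h₃
  have hmid : ∀ {K : Set E} {a b c : E}, a ∈ P ∩ K → c ∈ P ∩ K → Wbtw ℝ a b c →
      b ∈ convexHull ℝ (P ∩ K) := fun ha hc hw ↦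
    segment_subset_convexHull ha hc (mem_segment_iff_wbtw.2 hw)
  have hsub := fun K : Set E ↦ subset_convexHull ℝ (P ∩ K)
  have hcol : Collinear ℝ {x, y, z} := hL.subset (by
    rintro w (rfl | rfl | rfl) <;> assumption)
  rcases hcol.wbtw_or_wbtw_or_wbtw with hw | hw | hw
  · exact ⟨y, ⟨hsub _ ⟨hyP, hy1⟩, hmid ⟨hxP, hx2⟩ ⟨hzP, hz2⟩ hw⟩, hsub _ ⟨hyP, hy3⟩⟩
  · exact ⟨z, ⟨hsub _ ⟨hzP, hz1⟩, hsub _ ⟨hzP, hz2⟩⟩, hmid ⟨hyP, hy3⟩ ⟨hxP, hx3⟩ hw⟩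
  · exact ⟨x, ⟨hmid ⟨hzP, hz1⟩ ⟨hyP, hy1⟩ hw, hsub _ ⟨hxP, hx2⟩⟩, hsub _ ⟨hxP, hx3⟩⟩

/-- The set of crossing points of a family of lines. -/
def crossings (A : Finset (Set (EuclideanSpace ℝ (Fin 2)))) : Set (EuclideanSpace ℝ (Fin 2)) :=
  ⋃ L ∈ A, ⋃ M ∈ A, ⋃ (_ : L ≠ M), L ∩ M

theorem finite_crossings {A : Finset (Set (EuclideanSpace ℝ (Fin 2)))}
    (hA : ∀ L ∈ A, IsLine L) : (crossings A).Finite :=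
  A.finite_toSet.biUnion fun L hL ↦ A.finite_toSet.biUnion fun M hM ↦
    Set.finite_iUnion fun hne ↦ ((hA L hL).inter_subsingleton (hA M hM) hne).finite

/-- If three open halfplanes contain no large concentrated subsets of `A`, then the convex hulls
of the crossings outside of them have a common point. -/
theorem nonempty_inter_convexHull_crossings {A : Finset (Set (EuclideanSpace ℝ (Fin 2)))}
    (hA : ∀ L ∈ A, IsLine L) {h₁ h₂ h₃ : Set (EuclideanSpace ℝ (Fin 2))}
    (H₁ : IsOpenHalfplane h₁) (H₂ : IsOpenHalfplane h₂)
    (N₁ : ∀ C ⊆ A, Concentrated C h₁ → 3 * C.card ^ 2 < A.card)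
    (N₂ : ∀ C ⊆ A, Concentrated C h₂ → 3 * C.card ^ 2 < A.card)
    (N₃ : ∀ C ⊆ A, Concentrated C h₃ → 3 * C.card ^ 2 < A.card) :
    (convexHull ℝ (crossings A ∩ h₁ᶜ) ∩ convexHull ℝ (crossings A ∩ h₂ᶜ) ∩
      convexHull ℝ (crossings A ∩ h₃ᶜ)).Nonempty := by
  classical
  by_contra hempty
  have hsmall : ∀ {g h : Set (EuclideanSpace ℝ (Fin 2))}, IsOpenHalfplane g →
      (∀ C ⊆ A, Concentrated C g → 3 * C.card ^ 2 < A.card) →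
      (∀ C ⊆ A, Concentrated C h → 3 * C.card ^ 2 < A.card) →
      3 * (A.filter fun L ↦ ¬ (L ∩ crossings A ∩ gᶜ ∩ hᶜ).Nonempty).card < A.card := by
    intro g h Hg Ng Nh
    have hsub := A.filter_subset fun L ↦ ¬ (L ∩ crossings A ∩ gᶜ ∩ hᶜ).Nonempty
    obtain ⟨C, hC, hcard, hconc⟩ := exists_concentrated_of_concentrated_union
      (B := A.filter fun L ↦ ¬ (L ∩ crossings A ∩ gᶜ ∩ hᶜ).Nonempty) (h := h)
      (fun L hL ↦ hA L (hsub hL)) Hg (by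
        intro L hL M hM hne x hx
        by_contra hxgh
        rw [Set.mem_union, not_or] at hxgh
        refine (Finset.mem_filter.1 hL).2 ⟨x, ⟨⟨hx.1, ?_⟩, hxgh.1⟩, hxgh.2⟩
        simp only [crossings, Set.mem_iUnion]
        exact ⟨L, hsub hL, M, hsub hM, hne, hx⟩)
    have := hconc.elim (Ng C (hC.trans hsub)) (Nh C (hC.trans hsub))
    omega
  have hcover : A ⊆ (A.filter fun L ↦ ¬ (L ∩ crossings A ∩ h₂ᶜ ∩ h₃ᶜ).Nonempty) ∪
      (A.filter fun L ↦ ¬ (L ∩ crossings A ∩ h₁ᶜ ∩ h₃ᶜ).Nonempty) ∪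
      (A.filter fun L ↦ ¬ (L ∩ crossings A ∩ h₁ᶜ ∩ h₂ᶜ).Nonempty) := by
    intro L hL
    by_contra hnot
    simp only [Finset.mem_union, Finset.mem_filter, hL, true_and, not_or, not_not] at hnot
    exact hempty ((hA L hL).collinear.exists_mem_convexHull_inter hnot.1.1 hnot.1.2 hnot.2)
  have hle := (Finset.card_le_card hcover).trans
    ((Finset.card_union_le _ _).trans (Nat.add_le_add_right (Finset.card_union_le _ _) _))
  have := hsmall H₂ N₂ N₃
  have := hsmall H₁ N₁ N₃
  have := hsmall H₁ N₁ N₂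
  omega

/-- Centerpoint theorem for line arrangements: there is a point `q` such that every
open halfplane containing `q` contains an `h`-concentrated subset of `A` of size
at least `√(|A|/3)`. -/
theorem centerpoint_lines (A : Finset (Set (EuclideanSpace ℝ (Fin 2))))
    (hA : ∀ L ∈ A, IsLine L) :
    ∃ q : EuclideanSpace ℝ (Fin 2),
      ∀ h : Set (EuclideanSpace ℝ (Fin 2)), IsOpenHalfplane h → q ∈ h →
        ∃ A' ⊆ A, Concentrated A' h ∧ A.card ≤ 3 * A'.card ^ 2 := by
  classical
  let ι := {h : Set (EuclideanSpace ℝ (Fin 2)) // IsOpenHalfplane h ∧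
    ∀ C ⊆ A, Concentrated C h → 3 * C.card ^ 2 < A.card}
  let F : ι → Set (EuclideanSpace ℝ (Fin 2)) := fun h ↦ convexHull ℝ (crossings A ∩ h.1ᶜ)
  have htriple : ∀ h₁ h₂ h₃ : ι, (F h₁ ∩ F h₂ ∩ F h₃).Nonempty := fun h₁ h₂ h₃ ↦
    nonempty_inter_convexHull_crossings hA h₁.2.1 h₂.2.1 h₁.2.2 h₂.2.2 h₃.2.2
  obtain ⟨q, hq⟩ : (⋂ i, F i).Nonempty := by
    refine Convex.helly_theorem_compact' (𝕜 := ℝ) (F := F)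
      (fun _ ↦ convex_convexHull ℝ _)
      (fun _ ↦ ((finite_crossings hA).subset Set.inter_subset_left).isCompact_convexHull ℝ) ?_
    intro I hI
    rw [finrank_euclideanSpace_fin] at hI
    rcases I.eq_empty_or_nonempty with rfl | ⟨i, hi⟩
    · simp
    obtain ⟨j, k, hjk⟩ : ∃ j k, I ⊆ {i, j, k} := by
      have : Nonempty ι := ⟨i⟩
      have hcard := Finset.card_erase_of_mem hi
      rcases (I.erase i).eq_empty_or_nonempty with h0 | ⟨j, hj⟩
      · exact ⟨i, i, Finset.subset_insert_iff.2 (by simp [h0])⟩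
      · obtain ⟨k, hk⟩ := Finset.card_le_one_iff_subset_singleton.1
          (show ((I.erase i).erase j).card ≤ 1 by rw [Finset.card_erase_of_mem hj]; omega)
        exact ⟨j, k, Finset.subset_insert_iff.2 (Finset.subset_insert_iff.2 hk)⟩
    obtain ⟨q, ⟨hqi, hqj⟩, hqk⟩ := htriple i j k
    refine ⟨q, Set.mem_iInter₂.2 fun m hm ↦ ?_⟩
    have := hjk hm
    simp only [Finset.mem_insert, Finset.mem_singleton] at this
    rcases this with rfl | rfl | rfl <;> assumption
  refine ⟨q, fun h hh hqh ↦ ?_⟩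
  by_contra! hbad
  exact convexHull_min Set.inter_subset_right hh.convex_compl
    (Set.mem_iInter.1 hq ⟨h, hh, hbad⟩) hqh
end

section
/- Let d ≥ 1 and 1 ≤ k ≤ d. Let M be a linearly ordered set, ⊕ : M → M → M a binary operation monotone in each argument (a ≤ b implies a ⊕ c ≤ b ⊕ c and c ⊕ a ≤ c ⊕ b for all c), and e ∈ M a two-sided neutral element for ⊕ (x ⊕ e = x = e ⊕ x). For i = 1,…,k let μ_i be a function from subsets of ℝ^d to M that is: monotone (X ⊆ Y implies μ_i(X) ≤ μ_i(Y)); H-subadditive (for every nonempty finite list h₁,…,h_m of open halfspaces of ℝ^d, μ_i(h₁ ∪ ⋯ ∪ h_m) ≤ μ_i(h₁) ⊕ (μ_i(h₂) ⊕ (⋯ ⊕ μ_i(h_m)))); and concentrated on a bounded set (there is a bounded set B_i ⊆ ℝ^d such that μ_i(h) = e for every open halfspace h with h ∩ B_i = ∅). Then there exists an affine subspace π of ℝ^d of dimension k−1 such that for every open halfspace h containing π and every i ∈ {1,…,k}, the (d−k+2)-fold ⊕-multiple of μ_i(h), defined by 1·x = x and (c+1)·x = x ⊕ (c·x), is at least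 μ_i(ℝ^d). -/
open RealInnerProductSpace

/-- An open halfspace in ℝ^d. -/
def IsOpenHalfspace {d : ℕ} (h : Set (EuclideanSpace ℝ (Fin d))) : Prop :=
  ∃ (v : EuclideanSpace ℝ (Fin d)) (c : ℝ), v ≠ 0 ∧ h = {x | c < ⟪v, x⟫}

/-- Right-nested combination `x ⊕ (y₁ ⊕ (y₂ ⊕ ⋯ ⊕ yₘ))` of a head element `x`
and a list `[y₁, …, yₘ]` under a binary operation `op`. -/
def opFold {M : Type*} (op : M → M → M) : M → List M → M
  | x, [] => x
  | x, y :: ys => op x (opFold op y ys)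

/-- The `(c+1)`-fold multiple of `x` under `op`:
`opMul op x 0 = x` (the 1-fold multiple) and
`opMul op x (c+1) = op x (opMul op x c)`. -/
def opMul {M : Type*} (op : M → M → M) (x : M) : ℕ → M
  | 0 => x
  | c + 1 => op x (opMul op x c)

/-! ### Twisted translations of a lattice and the mod 2 cycle of lattice cubes -/

/-- The `r`-th generator of a Bott tower group: translate the `r`-th coordinate by `L` and apply
`x ↦ b - x` to those later coordinates `q` for which `ε r q` holds. -/
def twist {R : Type*} [AddCommGroup R] {N : ℕ} (ε : Fin N → Fin N → Bool) (b L : R) (r : Fin N)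
    (t : Fin N → R) : Fin N → R :=
  fun q => if q = r then t q + L else if r < q ∧ ε r q = true then b - t q else t q

/-- The reflection `x ↦ b - x` in the coordinates marked by `ρ`. -/
def reflect {R : Type*} [AddCommGroup R] {N : ℕ} (b : R) (ρ : Fin N → Bool)
    (t : Fin N → R) : Fin N → R :=
  fun q => if ρ q = true then b - t q else t q

/-- The twisting data of the tower obtained by dropping the first coordinate. -/
def tailTwist {N : ℕ} (ε : Fin (N + 1) → Fin (N + 1) → Bool) : Fin N → Fin N → Bool :=
  fun r q => ε r.succ q.succ

lemma twist_zero_cons {R : Type*} [AddCommGroup R] {N : ℕ} (ε : Fin (N + 1) → Fin (N + 1) → Bool)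
    (b L a : R) (t : Fin N → R) :
    twist ε b L 0 (Fin.cons a t : Fin (N + 1) → R) =
      Fin.cons (a + L) (reflect b (fun q => ε 0 q.succ) t) := by
  funext q
  refine Fin.cases ?_ (fun q => ?_) q
  · simp [twist]
  · simp [twist, reflect]

lemma twist_succ_cons {R : Type*} [AddCommGroup R] {N : ℕ} (ε : Fin (N + 1) → Fin (N + 1) → Bool)
    (b L a : R) (r : Fin N) (t : Fin N → R) :
    twist ε b L r.succ (Fin.cons a t : Fin (N + 1) → R) =
      Fin.cons a (twist (tailTwist ε) b L r t) := by
  funext q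
  refine Fin.cases ?_ (fun q => ?_) q
  · simp [twist, Fin.ext_iff]
  · simp only [twist, tailTwist, Fin.cons_succ, Fin.succ_inj, Fin.succ_lt_succ_iff]
    congr

lemma reflect_reflect {R : Type*} [AddCommGroup R] {N : ℕ} (b : R) (ρ : Fin N → Bool)
    (t : Fin N → R) : reflect b ρ (reflect b ρ t) = t := by
  funext q
  by_cases h : ρ q = true <;> simp [reflect, h]

/-- Sum over all lattice points of the box `[0, L)^N`. -/
def boxSum (L : ℕ) : (N : ℕ) → ((Fin N → ℤ) → ZMod 2) → ZMod 2
  | 0, h => h Fin.elim0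
  | N + 1, h => ∑ a ∈ Finset.range L, boxSum L N fun u => h (Fin.cons (a : ℤ) u)

lemma boxSum_eq_zero (L : ℕ) : ∀ {N : ℕ} {h : (Fin N → ℤ) → ZMod 2},
    (∀ u, (∀ i, 0 ≤ u i ∧ u i < (L : ℤ)) → h u = 0) → boxSum L N h = 0
  | 0, h, H => H _ fun i => i.elim0
  | N + 1, h, H => by
    refine Finset.sum_eq_zero fun a ha => boxSum_eq_zero L fun u hu => H _ fun i => ?_
    refine Fin.cases ?_ (fun i => ?_) i
    · simpa using ha
    · simpa using hu i

lemma boxSum_add (L : ℕ) : ∀ {N : ℕ} (h h' : (Fin N → ℤ) → ZMod 2),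
    boxSum L N (fun u => h u + h' u) = boxSum L N h + boxSum L N h'
  | 0, h, h' => rfl
  | N + 1, h, h' => by
    simp only [boxSum]
    rw [← Finset.sum_add_distrib]
    exact Finset.sum_congr rfl fun a _ => boxSum_add L _ _

lemma boxSum_finsetSum (L : ℕ) {N : ℕ} {α : Type*} (s : Finset α)
    (h : α → (Fin N → ℤ) → ZMod 2) :
    boxSum L N (fun u => ∑ a ∈ s, h a u) = ∑ a ∈ s, boxSum L N (h a) := by
  classical
  induction s using Finset.induction_on with
  | empty => simpa using boxSum_eq_zero L (fun _ _ => rfl)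
  | insert a s ha ih =>
    simp only [Finset.sum_insert ha]
    rw [boxSum_add, ih]

/-- A function on lattice cubes (indexed by their lowest corner) that is invariant under the
generators of the tower group. -/
def CubeInvariant {N : ℕ} (ε : Fin N → Fin N → Bool) (L : ℕ) (h : (Fin N → ℤ) → ZMod 2) : Prop :=
  ∀ r u, h (twist ε (-1) (L : ℤ) r u) = h u

lemma CubeInvariant.tail {N : ℕ} {ε : Fin (N + 1) → Fin (N + 1) → Bool} {L : ℕ}
    {h : (Fin (N + 1) → ℤ) → ZMod 2} (H : CubeInvariant ε L h) (a : ℤ) :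
    CubeInvariant (tailTwist ε) L fun u => h (Fin.cons a u) := by
  intro r u
  simpa [twist_succ_cons] using H r.succ (Fin.cons a u)

lemma sum_range_reflect_of_periodic {L : ℕ} {H : ℤ → ZMod 2} (hH : ∀ a, H (a + L) = H a) :
    ∑ a ∈ Finset.range L, H (-1 - a) = ∑ a ∈ Finset.range L, H a := by
  rw [← Finset.sum_range_reflect (fun a : ℕ => H a)]
  refine Finset.sum_congr rfl fun a ha => ?_
  rw [Finset.mem_range] at ha
  rw [← hH (-1 - a)]
  congr 1
  omega

lemma boxSum_reflect {L : ℕ} : ∀ {N : ℕ} {ε : Fin N → Fin N → Bool} {h : (Fin N → ℤ) → ZMod 2},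
    CubeInvariant ε L h → ∀ ρ : Fin N → Bool,
      boxSum L N (fun u => h (reflect (-1) ρ u)) = boxSum L N h
  | 0, _, h, _, ρ => congrArg h (Subsingleton.elim _ _)
  | N + 1, ε, h, H, ρ => by
    have key : ∀ a : ℤ, boxSum L N (fun u => h (Fin.cons (a + L) u)) =
        boxSum L N (fun u => h (Fin.cons a u)) := by
      intro a
      rw [← boxSum_reflect (H.tail (a + L)) (fun q => ε 0 q.succ)]
      congr 1
      funext u
      rw [← twist_zero_cons]
      exact H 0 _
    have hcons : ∀ (a : ℤ) (u : Fin N → ℤ), reflect (-1) ρ (Fin.cons a u : Fin (N + 1) → ℤ) =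
        Fin.cons (if ρ 0 = true then -1 - a else a) (reflect (-1) (fun q => ρ q.succ) u) := by
      intro a u
      funext q
      refine Fin.cases ?_ (fun q => ?_) q <;> simp [reflect]
    have hstep : ∀ a : ℤ, boxSum L N (fun u => h (reflect (-1) ρ (Fin.cons a u))) =
        boxSum L N (fun u => h (Fin.cons (if ρ 0 = true then -1 - a else a) u)) := by
      intro a
      simp only [hcons]
      exact boxSum_reflect (H.tail _) _
    simp only [boxSum, hstep]
    by_cases h0 : ρ 0 = true
    · simp only [h0, if_true]
      exact sum_range_reflect_of_periodic
        (H := fun a => boxSum L N (fun u => h (Fin.cons a u))) key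
    · simp only [h0]
      rfl

lemma CubeInvariant.boxSum_periodic {N L : ℕ} {ε : Fin (N + 1) → Fin (N + 1) → Bool}
    {h : (Fin (N + 1) → ℤ) → ZMod 2} (H : CubeInvariant ε L h) (a : ℤ) :
    boxSum L N (fun u => h (Fin.cons (a + L) u)) = boxSum L N (fun u => h (Fin.cons a u)) := by
  rw [← boxSum_reflect (H.tail (a + L)) (fun q => ε 0 q.succ)]
  congr 1
  funext u
  rw [← twist_zero_cons]
  exact H 0 _

/-- The even one of `u` and `u + 1`. -/
def evenEnd (u : ℤ) : ℤ := 2 * ((u + 1) / 2)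

/-- The odd one of `u` and `u + 1`. -/
def oddEnd (u : ℤ) : ℤ := 2 * (u / 2) + 1

lemma sum_range_of_oddEnd {H : ℤ → ZMod 2} (hH : ∀ a b, oddEnd a = oddEnd b → H a = H b) (K : ℕ) :
    ∑ a ∈ Finset.range (2 * K), H a = 0 := by
  induction K with
  | zero => simp
  | succ K ih =>
    rw [show 2 * (K + 1) = 2 * K + 1 + 1 by ring, Finset.sum_range_succ, Finset.sum_range_succ, ih,
      hH ((2 * K : ℕ) : ℤ) ((2 * K + 1 : ℕ) : ℤ) (by unfold oddEnd; omega), zero_add]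
    exact CharTwo.add_self_eq_zero _

lemma sum_range_of_evenEnd {H : ℤ → ZMod 2} (hH : ∀ a b, evenEnd a = evenEnd b → H a = H b)
    (K : ℕ) (hper : ∀ a, H (a + (2 * K : ℕ)) = H a) :
    ∑ a ∈ Finset.range (2 * K), H a = 0 := by
  have h1 : ∑ a ∈ Finset.range (2 * K), H a = ∑ a ∈ Finset.range (2 * K), H (a + 1) := by
    have h2 := Finset.sum_range_succ (fun a : ℕ => H a) (2 * K)
    rw [Finset.sum_range_succ'] at h2
    have h3 := hper 0
    rw [zero_add] at h3
    rw [h3] at h2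
    push_cast at h2
    exact (add_right_cancel h2).symm
  rw [h1]
  refine sum_range_of_oddEnd (H := fun a => H (a + 1)) (fun a b hab => hH _ _ ?_) K
  unfold oddEnd at hab
  unfold evenEnd
  omega

lemma boxSum_of_oddEnd {K : ℕ} : ∀ {N : ℕ} {h : (Fin N → ℤ) → ZMod 2} (i : Fin N),
    (∀ u v : Fin N → ℤ, (∀ j, j ≠ i → u j = v j) → oddEnd (u i) = oddEnd (v i) → h u = h v) →
      boxSum (2 * K) N h = 0
  | 0, _, i, _ => i.elim0
  | N + 1, h, i, H => by
    revert H
    refine Fin.cases (fun H => ?_) (fun i H => ?_) i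
    · refine sum_range_of_oddEnd (H := fun a => boxSum (2 * K) N fun u => h (Fin.cons a u))
        (fun a b hab => ?_) K
      congr 1
      funext u
      refine H _ _ (fun j hj => ?_) (by simpa using hab)
      obtain ⟨j, rfl⟩ := Fin.exists_succ_eq.2 hj
      simp
    · refine Finset.sum_eq_zero fun a _ => boxSum_of_oddEnd i fun u v huv hi => H _ _ ?_ (by simpa)
      intro j hj
      revert hj
      refine Fin.cases (fun _ => by simp) (fun j hj => ?_) j
      simpa using huv j fun hh => hj (by rw [hh])

lemma boxSum_of_evenEnd {K : ℕ} : ∀ {N : ℕ} {ε : Fin N → Fin N → Bool}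
    {h : (Fin N → ℤ) → ZMod 2} (_ : CubeInvariant ε (2 * K) h) (i : Fin N),
    (∀ u v : Fin N → ℤ, (∀ j, j ≠ i → u j = v j) → evenEnd (u i) = evenEnd (v i) → h u = h v) →
      boxSum (2 * K) N h = 0
  | 0, _, _, _, i, _ => i.elim0
  | N + 1, ε, h, hinv, i, H => by
    revert H
    refine Fin.cases (fun H => ?_) (fun i H => ?_) i
    · refine sum_range_of_evenEnd (H := fun a => boxSum (2 * K) N fun u => h (Fin.cons a u))
        (fun a b hab => ?_) K hinv.boxSum_periodic
      congr 1
      funext u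
      refine H _ _ (fun j hj => ?_) (by simpa using hab)
      obtain ⟨j, rfl⟩ := Fin.exists_succ_eq.2 hj
      simp
    · refine Finset.sum_eq_zero fun a _ =>
        boxSum_of_evenEnd (hinv.tail a) i fun u v huv hi => H _ _ ?_ (by simpa)
      intro j hj
      revert hj
      refine Fin.cases (fun _ => by simp) (fun j hj => ?_) j
      simpa using huv j fun hh => hj (by rw [hh])

/-! ### Cup products of coboundaries -/

section Cup

variable {P : Type*}

/-- The mod 2 cup product of the coboundaries of the functions in a list, evaluated on the
simplex with vertices `w 0, w 1, …`. -/
def cup : List (P → ZMod 2) → (ℕ → P) → ZMod 2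
  | [], _ => 1
  | l :: ls, w => (l (w 0) + l (w 1)) * cup ls fun j => w (j + 1)

/-- The face of a simplex obtained by omitting its `k`-th vertex. -/
def omitVertex (k : ℕ) (w : ℕ → P) : ℕ → P := fun j => w (if j < k then j else j + 1)

/-- The mod 2 coboundary of a `q`-cochain. -/
def coboundary (q : ℕ) (F : (ℕ → P) → ZMod 2) (w : ℕ → P) : ZMod 2 :=
  ∑ k ∈ Finset.range (q + 2), F (omitVertex k w)

lemma coboundary_cons (q : ℕ) (l : P → ZMod 2) (G : (ℕ → P) → ZMod 2) (w : ℕ → P) :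
    coboundary (q + 1) (fun w => (l (w 0) + l (w 1)) * G fun j => w (j + 1)) w =
      (l (w 0) + l (w 1)) * coboundary q G fun j => w (j + 1) := by
  have hface : ∀ k, (fun j => omitVertex (k + 1) w (j + 1)) =
      omitVertex k fun j => w (j + 1) := by
    intro k
    funext j
    simp only [omitVertex, Nat.add_lt_add_iff_right]
    split_ifs <;> rfl
  have h1 : (fun j => omitVertex 0 w (j + 1)) = omitVertex 0 (fun j => w (j + 1)) := by
    funext j
    simp [omitVertex]
  simp only [coboundary]
  rw [Finset.sum_range_succ', Finset.sum_range_succ', Finset.sum_range_succ' _ (q + 1)]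
  simp only [hface, h1]
  simp only [omitVertex, zero_add, Nat.zero_lt_succ, if_true, lt_irrefl, if_false,
    Nat.lt_add_left_iff_pos]
  simp only [mul_add, Finset.mul_sum]
  have h3 := CharTwo.add_self_eq_zero
    (l (w (1 + 1)) * G (omitVertex 0 fun j => w (j + 1)))
  simp only [Nat.not_lt_zero, if_false]
  linear_combination h3

lemma coboundary_cup : ∀ (ls : List (P → ZMod 2)) (w : ℕ → P),
    coboundary ls.length (cup ls) w = 0
  | [], w => by
    simp only [coboundary, cup, List.length_nil]
    decide
  | l :: ls, w => by
    have h := coboundary_cons ls.length l (cup ls) w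
    rw [coboundary_cup ls, mul_zero] at h
    exact h

lemma coboundary_mul_cup (m : P → ZMod 2) (ls : List (P → ZMod 2)) (w : ℕ → P) :
    coboundary ls.length (fun w => m (w 0) * cup ls w) w = cup (m :: ls) w := by
  have h := coboundary_cup ls w
  have h0 : omitVertex 0 w = fun j => w (j + 1) := by
    funext j
    simp [omitVertex]
  simp only [coboundary] at h ⊢
  rw [Finset.sum_range_succ'] at h ⊢
  simp only [h0] at h ⊢
  have h1 : ∀ k, omitVertex (k + 1) w 0 = w 0 := fun k => by simp [omitVertex]
  simp only [h1, ← Finset.mul_sum, cup, zero_add]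
  have h2 := CharTwo.add_self_eq_zero (m (w 0) * cup ls fun j => w (j + 1))
  linear_combination m (w 0) * h - h2

lemma cup_congr : ∀ (ls : List (P → ZMod 2)) (w w' : ℕ → P),
    (∀ j ≤ ls.length, w j = w' j) → cup ls w = cup ls w'
  | [], _, _, _ => rfl
  | l :: ls, w, w', h => by
    simp only [cup]
    rw [h 0 (by simp), h 1 (by simp), cup_congr ls _ (fun j => w' (j + 1)) fun j hj =>
      h (j + 1) (by simpa using hj)]

/-- `g` preserves the coboundary of `l`. -/
def PreservesCoboundary (g : P → P) (l : P → ZMod 2) : Prop :=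
  ∀ p q, l (g p) + l (g q) = l p + l q

lemma cup_preserved {g : P → P} : ∀ {ls : List (P → ZMod 2)},
    (∀ l ∈ ls, PreservesCoboundary g l) → ∀ w : ℕ → P, cup ls (fun j => g (w j)) = cup ls w
  | [], _, _ => rfl
  | l :: ls, h, w => by
    simp only [cup]
    rw [h l (by simp), cup_preserved fun l' hl' => h l' (by simp [hl'])]

lemma cup_map {Q : Type*} (g : Q → P) : ∀ (ls : List (P → ZMod 2)) (w : ℕ → Q),
    cup (ls.map fun l => l ∘ g) w = cup ls fun j => g (w j)
  | [], _ => rfl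
  | l :: ls, w => by simp [cup, cup_map g ls]

/-- A cup product containing the coboundary of a function `m` is a coboundary, in a way that is
invariant under all symmetries that preserve `m` and the other factors. -/
lemma exists_primitive_cup (m : P → ZMod 2) (B : List (P → ZMod 2)) :
    ∀ A : List (P → ZMod 2), ∃ F : (ℕ → P) → ZMod 2,
      (∀ w, coboundary (A.length + B.length) F w = cup (A ++ m :: B) w) ∧
      (∀ w w' : ℕ → P, (∀ j ≤ A.length + B.length, w j = w' j) → F w = F w') ∧
      ∀ g : P → P, (∀ l ∈ A ++ B, PreservesCoboundary g l) → (∀ p, m (g p) = m p) →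
        ∀ w : ℕ → P, F (fun j => g (w j)) = F w
  | [] => by
    refine ⟨fun w => m (w 0) * cup B w, fun w => ?_, fun w w' h => ?_, fun g hg hm w => ?_⟩
    · simpa using coboundary_mul_cup m B w
    · simp only [List.length_nil, zero_add] at h
      simp only
      rw [h 0 (Nat.zero_le _), cup_congr B w w' h]
    · simp only
      rw [hm, cup_preserved (by simpa using hg)]
  | a :: A => by
    obtain ⟨G, hG, hloc, hinv⟩ := exists_primitive_cup m B A
    refine ⟨fun w => (a (w 0) + a (w 1)) * G fun j => w (j + 1), fun w => ?_, fun w w' h => ?_,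
      fun g hg hm w => ?_⟩
    · rw [List.length_cons, add_right_comm, coboundary_cons, hG]
      rfl
    · simp only [List.length_cons] at h
      simp only
      rw [h 0 (Nat.zero_le _), h 1 (by omega), hloc _ (fun j => w' (j + 1)) fun j hj =>
        h (j + 1) (by omega)]
    · simp only
      rw [hg a (by simp), hinv g (fun l hl => hg l (by simp_all)) hm (fun j => w (j + 1))]

lemma cup_add (A B : List (P → ZMod 2)) (l l' : P → ZMod 2) (w : ℕ → P) :
    cup (A ++ (l + l') :: B) w = cup (A ++ l :: B) w + cup (A ++ l' :: B) w := by
  induction A generalizing w with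
  | nil => simp only [List.nil_append, cup, Pi.add_apply]; ring
  | cons a A ih => simp only [List.cons_append, cup, ih]; ring

lemma cup_eq_zero (A B : List (P → ZMod 2)) (l : P → ZMod 2) (w : ℕ → P)
    (h : ∀ j, l (w j) = l (w 0)) : cup (A ++ l :: B) w = 0 := by
  induction A generalizing w with
  | nil => simp [cup, h 1, CharTwo.add_self_eq_zero]
  | cons a A ih =>
    simp only [List.cons_append, cup]
    rw [ih _ fun j => by rw [h (j + 1), h (0 + 1)], mul_zero]

end Cup

/-! ### The mod 2 index of a list of functions on the lattice -/

/-- The vertices of the simplex, in the standard subdivision of the lattice cube with lowest corner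
`u`, that goes from the even corner to the odd corner in the order given by `τ`. -/
def cubeVertex {N : ℕ} (u : Fin N → ℤ) (τ : Equiv.Perm (Fin N)) (k : ℕ) : Fin N → ℤ :=
  fun i => if (τ i : ℕ) < k then oddEnd (u i) else evenEnd (u i)

/-- The evaluation of a cup product on the fundamental cycle of the tower. -/
def towerIndex (K N : ℕ) (ls : List ((Fin N → ℤ) → ZMod 2)) : ZMod 2 :=
  boxSum (2 * K) N fun u => ∑ τ : Equiv.Perm (Fin N), cup ls (cubeVertex u τ)

/-- `l` changes by the constant `c r` under the `r`-th generator of the tower group. -/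
def IsTwisted {N : ℕ} (ε : Fin N → Fin N → Bool) (K : ℕ) (c : Fin N → ZMod 2)
    (l : (Fin N → ℤ) → ZMod 2) : Prop :=
  ∀ r t, l (twist ε 0 (2 * K : ℤ) r t) = l t + c r

lemma IsTwisted.preservesCoboundary {N : ℕ} {ε : Fin N → Fin N → Bool} {K : ℕ}
    {c : Fin N → ZMod 2} {l : (Fin N → ℤ) → ZMod 2} (h : IsTwisted ε K c l) (r : Fin N) :
    PreservesCoboundary (twist ε 0 (2 * K : ℤ) r) l := by
  intro p q
  rw [h, h]
  linear_combination CharTwo.add_self_eq_zero (c r)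

lemma IsTwisted.add {N : ℕ} {ε : Fin N → Fin N → Bool} {K : ℕ}
    {c c' : Fin N → ZMod 2} {l l' : (Fin N → ℤ) → ZMod 2} (h : IsTwisted ε K c l)
    (h' : IsTwisted ε K c' l') : IsTwisted ε K (c + c') (l + l') := by
  intro r t
  simp only [Pi.add_apply, h r t, h' r t]
  ring

lemma cubeVertex_twist {N : ℕ} (ε : Fin N → Fin N → Bool) (K : ℕ) (r : Fin N) (u : Fin N → ℤ)
    (τ : Equiv.Perm (Fin N)) (k : ℕ) :
    cubeVertex (twist ε (-1) ((2 * K : ℕ) : ℤ) r u) τ k =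
      twist ε 0 (2 * K : ℤ) r (cubeVertex u τ k) := by
  funext i
  simp only [cubeVertex, twist, evenEnd, oddEnd]
  push_cast
  split_ifs <;> omega

lemma cubeVertex_swap {N : ℕ} (u : Fin N → ℤ) (τ : Equiv.Perm (Fin N)) {k : ℕ} (hk : k + 1 < N)
    {j : ℕ} (hj : j ≠ k + 1) :
    cubeVertex u (τ.trans (Equiv.swap ⟨k, by omega⟩ ⟨k + 1, hk⟩)) j = cubeVertex u τ j := by
  funext i
  have : ((Equiv.swap (⟨k, by omega⟩ : Fin N) ⟨k + 1, hk⟩ (τ i) : Fin N) : ℕ) < j ↔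
      (τ i : ℕ) < j := by
    rw [Equiv.swap_apply_def]
    split_ifs with h1 h2
    · simp only [h1]; omega
    · simp only [h2]; omega
    · rfl
  simp only [cubeVertex, Equiv.trans_apply, this]

theorem towerIndex_eq_zero_of_invariant {N K : ℕ} {ε : Fin N → Fin N → Bool}
    {A B : List ((Fin N → ℤ) → ZMod 2)} {m : (Fin N → ℤ) → ZMod 2}
    (hlen : A.length + B.length + 1 = N)
    (hAB : ∀ l ∈ A ++ B, ∃ c, IsTwisted ε K c l) (hm : IsTwisted ε K 0 m) :
    towerIndex K N (A ++ m :: B) = 0 := by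
  obtain ⟨F, hF, hloc, hinv⟩ := exists_primitive_cup m B A
  have hFinv : ∀ r (w : ℕ → Fin N → ℤ), F (fun j => twist ε 0 (2 * K : ℤ) r (w j)) = F w :=
    fun r => hinv _ (fun l hl => (hAB l hl).choose_spec.preservesCoboundary r)
      fun p => by simpa using hm r p
  unfold towerIndex
  simp only [← hF, coboundary]
  rw [show A.length + B.length + 2 = N + 1 by omega]
  simp only [Finset.sum_comm (s := Finset.univ)]
  rw [boxSum_finsetSum]
  refine Finset.sum_eq_zero fun k hk => ?_
  rw [Finset.mem_range] at hk
  rcases Nat.eq_zero_or_pos k with rfl | hk0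
  · rw [boxSum_finsetSum]
    refine Finset.sum_eq_zero fun τ _ => ?_
    refine boxSum_of_oddEnd (τ.symm ⟨0, by omega⟩) fun u v huv hi => ?_
    congr 1
    funext j i
    by_cases hij : i = τ.symm ⟨0, by omega⟩
    · subst hij
      simp [omitVertex, cubeVertex, hi]
    · simp [omitVertex, cubeVertex, huv i hij]
  · rcases Nat.lt_or_ge k N with hkN | hkN
    · refine boxSum_eq_zero _ fun u _ => ?_
      obtain ⟨k, rfl⟩ := Nat.exists_eq_succ_of_ne_zero hk0.ne'
      refine Finset.sum_involution
        (fun τ _ => τ.trans (Equiv.swap ⟨k, by omega⟩ ⟨k + 1, hkN⟩)) (fun τ _ => ?_)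
        (fun τ _ _ h => ?_) (fun _ _ => Finset.mem_univ _) (fun τ _ => ?_)
      · have : omitVertex (k + 1)
            (cubeVertex u (τ.trans (Equiv.swap ⟨k, by omega⟩ ⟨k + 1, hkN⟩))) =
            omitVertex (k + 1) (cubeVertex u τ) := by
          funext j
          exact cubeVertex_swap u τ hkN (by split_ifs <;> omega)
        rw [this]
        exact CharTwo.add_self_eq_zero _
      · have h2 := congrArg (fun σ : Equiv.Perm (Fin N) => σ (τ.symm ⟨k, by omega⟩)) h
        simp [Fin.ext_iff] at h2
      · ext i
        simp
    · obtain rfl : k = N := by omega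
      rw [boxSum_finsetSum]
      refine Finset.sum_eq_zero fun τ _ => ?_
      refine boxSum_of_evenEnd (ε := ε) (fun r u => ?_) (τ.symm ⟨k - 1, by omega⟩)
        fun u v huv hi => ?_
      · rw [← hFinv r (omitVertex k (cubeVertex u τ))]
        congr 1
        funext j
        exact cubeVertex_twist ε K r u τ _
      · refine hloc _ _ fun j hj => ?_
        funext i
        have hjk : j < k := by omega
        by_cases hij : i = τ.symm ⟨k - 1, by omega⟩
        · subst hij
          have : ¬ k - 1 < j := by omega
          simp [omitVertex, cubeVertex, hi, hjk, this]
        · simp [omitVertex, cubeVertex, huv i hij]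

lemma towerIndex_add {N K : ℕ} (A B : List ((Fin N → ℤ) → ZMod 2)) (l l' : (Fin N → ℤ) → ZMod 2) :
    towerIndex K N (A ++ (l + l') :: B) =
      towerIndex K N (A ++ l :: B) + towerIndex K N (A ++ l' :: B) := by
  unfold towerIndex
  simp only [cup_add, Finset.sum_add_distrib]
  exact boxSum_add _ _ _

/-- The index depends only on the characters of the functions. -/
theorem towerIndex_congr {N K : ℕ} {ε : Fin N → Fin N → Bool}
    {A B : List ((Fin N → ℤ) → ZMod 2)} {l l' : (Fin N → ℤ) → ZMod 2} {c : Fin N → ZMod 2}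
    (hlen : A.length + B.length + 1 = N)
    (hAB : ∀ l ∈ A ++ B, ∃ c, IsTwisted ε K c l)
    (hl : IsTwisted ε K c l) (hl' : IsTwisted ε K c l') :
    towerIndex K N (A ++ l :: B) = towerIndex K N (A ++ l' :: B) := by
  have h : IsTwisted ε K 0 (l + l') := by
    have := hl.add hl'
    rwa [show c + c = 0 from funext fun r => CharTwo.add_self_eq_zero _] at this
  have h2 := towerIndex_eq_zero_of_invariant hlen hAB h
  rw [towerIndex_add] at h2
  exact CharTwo.add_eq_zero.1 h2

lemma IsTwisted.reflect {N : ℕ} {ε : Fin N → Fin N → Bool} {K : ℕ} {c : Fin N → ZMod 2}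
    {l : (Fin N → ℤ) → ZMod 2} (h : IsTwisted ε K c l) (ρ : Fin N → Bool) :
    IsTwisted ε K c fun t => l (reflect 0 ρ t) := by
  intro r t
  by_cases hr : ρ r = true
  · have h1 : twist ε 0 (2 * K : ℤ) r (_root_.reflect 0 ρ (twist ε 0 (2 * K : ℤ) r t)) =
        _root_.reflect 0 ρ t := by
      funext q
      simp only [twist, _root_.reflect]
      split_ifs with h1 h2 <;> first | omega | (subst h1; simp_all)
    have h2 := h r (_root_.reflect 0 ρ (twist ε 0 (2 * K : ℤ) r t))
    rw [h1] at h2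
    simp only [h2]
    linear_combination -CharTwo.add_self_eq_zero (c r)
  · have h1 : _root_.reflect 0 ρ (twist ε 0 (2 * K : ℤ) r t) =
        twist ε 0 (2 * K : ℤ) r (_root_.reflect 0 ρ t) := by
      funext q
      simp only [twist, _root_.reflect]
      split_ifs with h1 h2 h3 h4 <;> first | omega | simp_all
    simp only [h1]
    exact h r _

lemma add_ediv_self_period {a L : ℤ} (hL : L ≠ 0) : (a + L) / L = a / L + 1 := by
  simpa using Int.add_mul_ediv_right a 1 hL

lemma neg_ediv_of_emod_ne_zero {a L : ℤ} (hL : 0 < L) (ha : a % L ≠ 0) :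
    -a / L = -(a / L) - 1 := by
  have h1 := Int.mul_ediv_add_emod a L
  have h2 := Int.emod_nonneg a hL.ne'
  have h3 := Int.emod_lt_of_pos a hL
  have : -a = (L - a % L) + (-(a / L) - 1) * L := by linarith [mul_comm L (a / L)]
  rw [this, Int.add_mul_ediv_right _ _ hL.ne', Int.ediv_eq_zero_of_lt (by omega) (by omega),
    zero_add]

lemma add_one_ediv_of_emod_ne_zero {a L : ℤ} (hL : 0 < L) (ha : (a + 1) % L ≠ 0) :
    (a + 1) / L = a / L := by
  have h1 := Int.mul_ediv_add_emod (a + 1) L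
  have h2 := Int.emod_nonneg (a + 1) hL.ne'
  have h3 := Int.emod_lt_of_pos (a + 1) hL
  generalize (a + 1) % L = m at *
  generalize (a + 1) / L = q at *
  obtain rfl : a = (m - 1) + q * L := by linarith [mul_comm L q]
  rw [Int.add_mul_ediv_right _ _ hL.ne', Int.ediv_eq_zero_of_lt (by omega) (by omega), zero_add]

lemma exists_isTwisted {K : ℕ} (hK : 0 < K) : ∀ {N : ℕ} (ε : Fin N → Fin N → Bool)
    (c : Fin N → ZMod 2), ∃ l, IsTwisted ε K c l
  | 0, _, _ => ⟨0, fun r => r.elim0⟩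
  | N + 1, ε, c => by
    obtain ⟨l, hl⟩ := exists_isTwisted hK (tailTwist ε) (fun r => c r.succ)
    let ρ : ℤ → Fin N → Bool := fun n q => if n % 2 = 1 then ε 0 q.succ else false
    refine ⟨fun t => c 0 * ((t 0 / (2 * K) : ℤ) : ZMod 2) +
      l (reflect 0 (ρ (t 0 / (2 * K))) (Fin.tail t)), fun r t => ?_⟩
    obtain ⟨a, t, rfl⟩ : ∃ a t', t = Fin.cons a t' :=
      ⟨t 0, Fin.tail t, (Fin.cons_self_tail t).symm⟩
    have hK' : (2 * K : ℤ) ≠ 0 := by positivity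
    refine Fin.cases ?_ (fun r => ?_) r
    · rw [twist_zero_cons]
      simp only [Fin.cons_zero, Fin.tail_cons]
      have h1 : (a + 2 * K) / (2 * K : ℤ) = a / (2 * K) + 1 := add_ediv_self_period hK'
      have h2 : reflect 0 (ρ (a / (2 * K) + 1)) (reflect 0 (fun q => ε 0 q.succ) t) =
          reflect 0 (ρ (a / (2 * K))) t := by
        funext q
        simp only [reflect, ρ]
        rcases Int.emod_two_eq_zero_or_one (a / (2 * K : ℤ)) with h | h
        · have h' : (a / (2 * K : ℤ) + 1) % 2 = 1 := by omega
          by_cases h3 : ε 0 q.succ = true <;> simp [h, h', h3]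
        · have h' : (a / (2 * K : ℤ) + 1) % 2 = 0 := by omega
          simp [h, h']
      rw [h1, h2]
      push_cast
      ring
    · rw [twist_succ_cons]
      simp only [Fin.cons_zero, Fin.tail_cons]
      have h1 := (hl.reflect (ρ (a / (2 * K)))) r t
      simp only at h1
      rw [h1]
      ring

/-- The characters in `cs` have cup product equal to the top class of the tower. -/
def HasIndexOne {N : ℕ} (ε : Fin N → Fin N → Bool) (cs : List (Fin N → ZMod 2)) : Prop :=
  cs.length = N ∧ ∀ K : ℕ, 2 ≤ K → ∀ ls, List.Forall₂ (IsTwisted ε K) cs ls →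
    towerIndex K N ls = 1

lemma hasIndexOne_nil (ε : Fin 0 → Fin 0 → Bool) : HasIndexOne ε [] := by
  refine ⟨rfl, fun K _ ls h => ?_⟩
  rw [List.forall₂_nil_left_iff.1 h]
  simp [towerIndex, boxSum, cup]

lemma IsTwisted.restrict {N : ℕ} {ε : Fin (N + 1) → Fin (N + 1) → Bool} {K : ℕ}
    {c : Fin (N + 1) → ZMod 2} {l : (Fin (N + 1) → ℤ) → ZMod 2} (h : IsTwisted ε K c l) (a : ℤ) :
    IsTwisted (tailTwist ε) K (Fin.tail c) (l ∘ fun t => (Fin.cons a t : Fin (N + 1) → ℤ)) := by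
  intro r t
  have := h r.succ (Fin.cons a t)
  rw [twist_succ_cons] at this
  exact this

lemma cubeVertex_cons {N : ℕ} (a : ℤ) (u : Fin N → ℤ) (σ : Equiv.Perm (Fin N)) (k : ℕ) :
    cubeVertex (Fin.cons a u : Fin (N + 1) → ℤ) (Equiv.Perm.decomposeFin.symm (0, σ)) (k + 1) =
      Fin.cons (oddEnd a) (cubeVertex u σ k) := by
  funext i
  refine Fin.cases ?_ (fun i => ?_) i
  · simp [cubeVertex]
  · simp [cubeVertex, Equiv.Perm.decomposeFin_symm_apply_succ]

/-- Integration of a cup product against the class of the first circle of the tower. -/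
lemma towerIndex_cons_floor {N K : ℕ} (hK : 0 < K) (ls : List ((Fin (N + 1) → ℤ) → ZMod 2)) :
    towerIndex K (N + 1) ((fun t => ((t 0 / (2 * K) : ℤ) : ZMod 2)) :: ls) =
      towerIndex K N (ls.map fun l => l ∘ fun t => Fin.cons (2 * K - 1 : ℤ) t) := by
  have hsum : ∀ (a : ℕ) (u : Fin N → ℤ), a < 2 * K →
      ∑ τ : Equiv.Perm (Fin (N + 1)), cup ((fun t => ((t 0 / (2 * K) : ℤ) : ZMod 2)) :: ls)
          (cubeVertex (Fin.cons (a : ℤ) u) τ) =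
        if a = 2 * K - 1 then ∑ σ : Equiv.Perm (Fin N),
          cup (ls.map fun l => l ∘ fun t => Fin.cons (2 * K - 1 : ℤ) t)
            (cubeVertex u σ) else 0 := by
    intro a u ha
    rw [← (Equiv.Perm.decomposeFin (n := N)).symm.sum_comp, Fintype.sum_prod_type,
      Fin.sum_univ_succ]
    have hrest : ∑ p : Fin N, ∑ σ : Equiv.Perm (Fin N),
        cup ((fun t : Fin (N + 1) → ℤ => ((t 0 / (2 * K) : ℤ) : ZMod 2)) :: ls)
          (cubeVertex (Fin.cons (a : ℤ) u) (Equiv.Perm.decomposeFin.symm (p.succ, σ))) = 0 := by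
      refine Finset.sum_eq_zero fun p _ => Finset.sum_eq_zero fun σ _ => ?_
      simp [cup, cubeVertex, CharTwo.add_self_eq_zero]
    rw [hrest, add_zero]
    have hodd : oddEnd a / (2 * K : ℤ) = 0 := by
      apply Int.ediv_eq_zero_of_lt <;> unfold oddEnd <;> omega
    have hfirst : ∀ σ : Equiv.Perm (Fin N),
        cup ((fun t : Fin (N + 1) → ℤ => ((t 0 / (2 * K) : ℤ) : ZMod 2)) :: ls)
          (cubeVertex (Fin.cons (a : ℤ) u) (Equiv.Perm.decomposeFin.symm (0, σ))) =
        ((evenEnd a / (2 * K) : ℤ) : ZMod 2) *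
          cup ls fun j => Fin.cons (oddEnd a) (cubeVertex u σ j) := by
      intro σ
      simp only [cup, cubeVertex_cons]
      simp [cubeVertex, hodd]
    simp only [hfirst]
    split_ifs with h
    · subst h
      have h1 : evenEnd ((2 * K - 1 : ℕ) : ℤ) = 2 * K := by unfold evenEnd; omega
      have h2 : oddEnd ((2 * K - 1 : ℕ) : ℤ) = 2 * K - 1 := by unfold oddEnd; omega
      simp only [h1, h2, cup_map]
      rw [Int.ediv_self (by positivity)]
      simp
    · have h1 : evenEnd (a : ℤ) / (2 * K) = 0 := by
        apply Int.ediv_eq_zero_of_lt <;> unfold evenEnd <;> omega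
      simp [h1]
  unfold towerIndex
  simp only [boxSum]
  rw [Finset.sum_eq_single_of_mem (2 * K - 1) (Finset.mem_range.2 (by omega))]
  · simp only [hsum _ _ (show 2 * K - 1 < 2 * K by omega), if_true]
  · intro a ha hne
    simp only [hsum _ _ (Finset.mem_range.1 ha), hne, if_false]
    exact boxSum_eq_zero _ fun _ _ => rfl

lemma isTwisted_floor {N K : ℕ} (hK : 0 < K) (ε : Fin (N + 1) → Fin (N + 1) → Bool) :
    IsTwisted ε K (Pi.single 0 1) fun t => ((t 0 / (2 * K) : ℤ) : ZMod 2) := by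
  intro r t
  refine Fin.cases ?_ (fun r => ?_) r
  · simp only [twist, if_true, Pi.single_eq_same]
    rw [add_ediv_self_period (by positivity)]
    push_cast
    rfl
  · simp [twist, Fin.ext_iff]

lemma List.Forall₂.exists_isTwisted {N K : ℕ} {ε : Fin N → Fin N → Bool}
    {cs : List (Fin N → ZMod 2)} {ls} (h : List.Forall₂ (IsTwisted ε K) cs ls) :
    ∀ l ∈ ls, ∃ c, IsTwisted ε K c l := by
  induction h with
  | nil => simp
  | cons h _ ih =>
    intro l hl
    rcases List.mem_cons.1 hl with rfl | hl
    · exact ⟨_, h⟩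
    · exact ih l hl

/-- Peeling off the first circle of the tower. -/
lemma HasIndexOne.cons_single {N : ℕ} {ε : Fin (N + 1) → Fin (N + 1) → Bool}
    {cs : List (Fin (N + 1) → ZMod 2)} (h : HasIndexOne (tailTwist ε) (cs.map Fin.tail)) :
    HasIndexOne ε (Pi.single 0 1 :: cs) := by
  refine ⟨by simpa using h.1, fun K hK ls hls => ?_⟩
  obtain ⟨l, ls, hl, hls', rfl⟩ := List.forall₂_cons_left_iff.1 hls
  have hlen : ls.length = N := by rw [← hls'.length_eq]; simpa using h.1
  have h1 := towerIndex_congr (A := []) (B := ls) (by simpa using hlen) hls'.exists_isTwisted hl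
    (isTwisted_floor (by omega) ε)
  simp only [List.nil_append] at h1
  rw [h1, towerIndex_cons_floor (by omega)]
  refine h.2 K hK _ ?_
  rw [List.forall₂_map_left_iff, List.forall₂_map_right_iff]
  exact hls'.imp fun _ _ h => h.restrict _

lemma forall₂_append_left {α β : Type*} {R : α → β → Prop} : ∀ {A B : List α} {ls : List β},
    List.Forall₂ R (A ++ B) ls →
      ∃ A' B', List.Forall₂ R A A' ∧ List.Forall₂ R B B' ∧ ls = A' ++ B'
  | [], _, ls, h => ⟨[], ls, .nil, h, rfl⟩
  | _ :: _, _, _, .cons h hs => by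
    obtain ⟨A', B', hA, hB, rfl⟩ := forall₂_append_left hs
    exact ⟨_ :: A', B', .cons h hA, hB, rfl⟩

lemma forall₂_append {α β : Type*} {R : α → β → Prop} {B : List α} {B' : List β}
    (hB : List.Forall₂ R B B') : ∀ {A : List α} {A' : List β}, List.Forall₂ R A A' →
      List.Forall₂ R (A ++ B) (A' ++ B')
  | _, _, .nil => hB
  | _, _, .cons h hs => .cons h (forall₂_append hB hs)

/-- If the circle `r` is only twisted by the circle `r'`, the characters `δ_r` and `δ_r + δ_r'`
multiply to zero. -/
lemma HasIndexOne.replace {N : ℕ} {ε : Fin N → Fin N → Bool} {A D : List (Fin N → ZMod 2)}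
    {r r' : Fin N} (hr : r' < r) (hε : ∀ q < r, ε q r = true ↔ q = r')
    (h : HasIndexOne ε (A ++ Pi.single r' 1 :: Pi.single r 1 :: D)) :
    HasIndexOne ε (A ++ Pi.single r 1 :: Pi.single r 1 :: D) := by
  refine ⟨by simpa using h.1, fun K hK ls hls => ?_⟩
  have hlen := hls.length_eq
  have hN : A.length + D.length + 2 = N := by have := h.1; simp at this; omega
  obtain ⟨A', B', hA, hB, rfl⟩ := forall₂_append_left hls
  obtain ⟨l₁, B'', hl₁, hB'', rfl⟩ := List.forall₂_cons_left_iff.1 hB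
  obtain ⟨l₂, D', hl₂, hD, rfl⟩ := List.forall₂_cons_left_iff.1 hB''
  have hAl := hA.length_eq
  have hDl := hD.length_eq
  obtain ⟨l₀, hl₀⟩ := exists_isTwisted (K := K) (by omega) ε (Pi.single r' 1)
  have hK' : (0 : ℤ) < 2 * K := by positivity
  have hmem : ∀ l ∈ A' ++ D', ∃ c, IsTwisted ε K c l := (forall₂_append hD hA).exists_isTwisted
  have hl₁₀ := hl₁.add hl₀
  let s : (Fin N → ℤ) → ZMod 2 := fun t =>
    if t r % (2 * K) = 0 then (l₁ + l₀) t else ((t r / (2 * K) : ℤ) : ZMod 2)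
  let z : (Fin N → ℤ) → ZMod 2 := fun t =>
    if (t r + K) % (2 * K) = 0 then l₂ t else (((t r + K) / (2 * K) : ℤ) : ZMod 2)
  have hcoord : ∀ q t, twist ε 0 (2 * K : ℤ) q t r =
      if q = r then t r + 2 * K else if q = r' then - t r else t r := by
    intro q t
    have h1 : q < r → (ε q r = true ↔ q = r') := hε q
    simp only [twist]
    rcases lt_trichotomy q r with h | h | h
    · simp [h, h.ne, h.ne', h1 h]
    · simp [h]
    · have : q ≠ r' := (hr.trans h).ne'
      simp [h.ne, h.ne', this, h.not_gt]
  have hneg : ∀ a : ℤ, -a % (2 * K) = 0 ↔ a % (2 * K) = 0 := fun a => by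
    rw [← Int.dvd_iff_emod_eq_zero, ← Int.dvd_iff_emod_eq_zero, dvd_neg]
  have htwo : (2 : ZMod 2) = 0 := rfl
  have hs : IsTwisted ε K (Pi.single r 1 + Pi.single r' 1) s := by
    intro q t
    by_cases h0 : t r % (2 * K) = 0
    · have h1 : twist ε 0 (2 * K : ℤ) q t r % (2 * K) = 0 := by
        rw [hcoord]
        split_ifs
        · simpa using h0
        · exact (hneg _).2 h0
        · exact h0
      simp only [s, h0, h1, if_true]
      exact hl₁₀ q t
    · have h1 : twist ε 0 (2 * K : ℤ) q t r % (2 * K) ≠ 0 := by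
        rw [hcoord]
        split_ifs
        · simpa using h0
        · exact (hneg _).not.2 h0
        · exact h0
      simp only [s, h0, h1, if_false]
      rw [hcoord]
      split_ifs with h2 h3
      · subst h2
        rw [add_ediv_self_period hK'.ne']
        simp [hr.ne']
      · subst h3
        rw [neg_ediv_of_emod_ne_zero hK' h0]
        simp [hr.ne]
        linear_combination -htwo
      · simp [h2, h3]
  have hz : IsTwisted ε K (Pi.single r 1) z := by
    have hneg' : ∀ a : ℤ, (-a + K) % (2 * K) = 0 ↔ (a + K) % (2 * K) = 0 := fun a => by
      rw [← hneg (a + K), show -a + (K : ℤ) = -(a + K) + 2 * K by ring, Int.add_emod_right]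
    intro q t
    by_cases h0 : (t r + K) % (2 * K) = 0
    · have h1 : (twist ε 0 (2 * K : ℤ) q t r + K) % (2 * K) = 0 := by
        rw [hcoord]
        split_ifs
        · rw [add_right_comm]
          simpa using h0
        · exact (hneg' _).2 h0
        · exact h0
      simp only [z, h0, h1, if_true]
      exact hl₂ q t
    · have h1 : (twist ε 0 (2 * K : ℤ) q t r + K) % (2 * K) ≠ 0 := by
        rw [hcoord]
        split_ifs
        · rw [add_right_comm]
          simpa using h0
        · exact (hneg' _).not.2 h0
        · exact h0
      simp only [z, h0, h1, if_false]
      rw [hcoord]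
      split_ifs with h2 h3
      · subst h2
        rw [add_right_comm, add_ediv_self_period hK'.ne']
        simp
      · subst h3
        rw [show -t r + (K : ℤ) = -(t r + K) + 2 * K by ring, add_ediv_self_period hK'.ne',
          neg_ediv_of_emod_ne_zero hK' h0]
        simp [hr.ne]
      · simp [h2]
  have hzero : towerIndex K N (A' ++ s :: z :: D') = 0 := by
    refine boxSum_eq_zero _ fun u _ => Finset.sum_eq_zero fun τ _ => ?_
    have hv : ∀ j, cubeVertex u τ j r = u r ∨ cubeVertex u τ j r = u r + 1 := by
      intro j
      simp only [cubeVertex, evenEnd, oddEnd]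
      split_ifs <;> omega
    by_cases h0 : u r % (2 * K) = 0 ∨ (u r + 1) % (2 * K) = 0
    · have h2 : (u r + K) % (2 * K) ≠ 0 ∧ (u r + K + 1) % (2 * K) ≠ 0 := by
        have key : ∀ a : ℤ, (2 * K : ℤ) ∣ a → |a| < 2 * K → a = 0 := fun a h1 h2 =>
          Int.eq_zero_of_abs_lt_dvd h1 h2
        simp only [← Int.dvd_iff_emod_eq_zero, ne_eq] at h0 ⊢
        constructor <;> intro h1 <;> rcases h0 with h0 | h0 <;>
          have h3 := key _ (dvd_sub h1 h0) (by rw [abs_lt]; constructor <;> omega) <;> omega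
      have h3 : ∀ j, z (cubeVertex u τ j) = (((u r + K) / (2 * K) : ℤ) : ZMod 2) := by
        intro j
        rcases hv j with h | h
        · simp only [z, h, h2.1, if_false]
        · have h4 : u r + 1 + K = u r + K + 1 := by ring
          simp only [z, h, h4, h2.2, if_false]
          rw [add_one_ediv_of_emod_ne_zero hK' h2.2]
      have := cup_eq_zero (A' ++ [s]) D' z (cubeVertex u τ) fun j => by rw [h3, h3]
      simpa using this
    · push Not at h0
      have h3 : ∀ j, s (cubeVertex u τ j) = ((u r / (2 * K) : ℤ) : ZMod 2) := by
        intro j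
        rcases hv j with h | h
        · simp only [s, h, h0.1, if_false]
        · simp only [s, h, h0.2, if_false]
          rw [add_one_ediv_of_emod_ne_zero hK' h0.2]
      exact cup_eq_zero A' (z :: D') s (cubeVertex u τ) fun j => by rw [h3, h3]
  have hadd : towerIndex K N (A' ++ (l₁ + l₀) :: l₂ :: D') = 0 := by
    rw [← hzero]
    have e1 := towerIndex_congr (A := A') (B := l₂ :: D') (by simp; omega)
      (fun l hl => by
        simp only [List.mem_append, List.mem_cons] at hl
        rcases hl with hl | rfl | hl
        · exact hmem l (by simp [hl])
        · exact ⟨_, hl₂⟩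
        · exact hmem l (by simp [hl])) hl₁₀ hs
    rw [e1]
    have e2 := towerIndex_congr (A := A' ++ [s]) (B := D') (by simp; omega)
      (fun l hl => by
        simp only [List.mem_append, List.mem_singleton, or_assoc] at hl
        rcases hl with hl | rfl | hl
        · exact hmem l (by simp [hl])
        · exact ⟨_, hs⟩
        · exact hmem l (by simp [hl])) hl₂ hz
    simpa using e2
  rw [towerIndex_add] at hadd
  rw [CharTwo.add_eq_zero.1 hadd]
  exact h.2 K hK _ (forall₂_append (.cons hl₀ (.cons hl₂ hD)) hA)

/-! ### Towers of rotations -/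

/-- The indicator of position `p`, as a character of the tower group. -/
def posChar (N p : ℕ) : Fin N → ZMod 2 := fun q => if (q : ℕ) = p then 1 else 0

lemma posChar_eq_single {N p : ℕ} (hp : p < N) : posChar N p = Pi.single ⟨p, hp⟩ 1 := by
  funext q
  simp [posChar, Pi.single_apply, Fin.ext_iff]

lemma HasIndexOne.replace_replicate {N p : ℕ} {ε : Fin N → Fin N → Bool} (hp : p + 1 < N)
    (hε : ∀ q r : Fin N, (r : ℕ) = p + 1 → q < r → (ε q r = true ↔ (q : ℕ) = p)) (c : ℕ) :
    ∀ A D : List (Fin N → ZMod 2),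
      HasIndexOne ε (A ++ (List.replicate c (posChar N p) ++ posChar N (p + 1) :: D)) →
      HasIndexOne ε (A ++ (List.replicate (c + 1) (posChar N (p + 1)) ++ D)) := by
  induction c with
  | zero => intro A D h; simpa using h
  | succ c ih =>
    intro A D h
    have h1 := ih (A ++ [posChar N p]) D (by simpa [List.replicate_succ] using h)
    have h2 : HasIndexOne ε (A ++ Pi.single (⟨p, by omega⟩ : Fin N) 1 ::
        Pi.single (⟨p + 1, hp⟩ : Fin N) 1 ::
          (List.replicate c (posChar N (p + 1)) ++ D)) := by
      rw [← posChar_eq_single, ← posChar_eq_single]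
      simpa [List.replicate_succ] using h1
    have h3 := h2.replace (by simp [Fin.lt_def]) fun q hq => by
      rw [hε q _ rfl hq, Fin.ext_iff]
    rw [← posChar_eq_single] at h3
    simpa [List.replicate_succ] using h3

lemma HasIndexOne.replicate_of_range {N j : ℕ} {ε : Fin N → Fin N → Bool} (hj : j + 1 ≤ N)
    (hε : ∀ q r : Fin N, (r : ℕ) ≤ j → q < r → (ε q r = true ↔ (q : ℕ) + 1 = r)) :
    ∀ D : List (Fin N → ZMod 2),
      HasIndexOne ε ((List.range (j + 1)).map (posChar N) ++ D) →
      HasIndexOne ε (List.replicate (j + 1) (posChar N j) ++ D) := by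
  induction j with
  | zero => intro D h; simpa using h
  | succ j ih =>
    intro D h
    rw [List.range_succ, List.map_append, List.append_assoc] at h
    have h1 := ih (by omega) (fun q r hr => hε q r (by omega)) _ h
    refine HasIndexOne.replace_replicate (by omega) (fun q r hr hq => ?_) (j + 1) [] D
      (by simpa using h1)
    rw [hε q r (by omega) hq]
    omega

/-- Two generators of the tower of rotations interact when their coordinate planes share exactly
one axis. -/
def wordTwist (W : List ℕ) (r q : Fin W.length) : Bool :=
  decide (W.get r + 1 = W.get q ∨ W.get q + 1 = W.get r)

/-- The sign character of the `i`-th coordinate axis. -/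
def wordChar (W : List ℕ) (i : ℕ) (r : Fin W.length) : ZMod 2 :=
  if W.get r = i ∨ W.get r + 1 = i then 1 else 0

lemma hasIndexOne_append {R is : List ℕ} (h : HasIndexOne (wordTwist R) (is.map (wordChar R))) :
    ∀ P : List ℕ, HasIndexOne (wordTwist (P ++ R))
      ((List.range P.length).map (posChar (P ++ R).length) ++ is.map (wordChar (P ++ R)))
  | [] => h
  | a :: P => by
    have ih := hasIndexOne_append h P
    rw [List.length_cons, List.range_succ_eq_map, List.map_cons, List.cons_append]
    have h0 : posChar (a :: (P ++ R)).length 0 =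
        Pi.single (M := fun _ : Fin ((P ++ R).length + 1) => ZMod 2) 0 1 :=
      posChar_eq_single (by simp)
    rw [h0]
    refine HasIndexOne.cons_single (N := (P ++ R).length) ?_
    have h1 : (((List.range P.length).map Nat.succ).map (posChar (a :: (P ++ R)).length)).map
        (Fin.tail (α := fun _ : Fin ((P ++ R).length + 1) => ZMod 2)) =
        (List.range P.length).map (posChar (P ++ R).length) := by
      rw [List.map_map, List.map_map]
      refine List.map_congr_left fun p _ => ?_
      funext q
      simp [Function.comp, Fin.tail, posChar]
    have h2 : (is.map (wordChar (a :: (P ++ R)))).map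
        (Fin.tail (α := fun _ : Fin ((P ++ R).length + 1) => ZMod 2)) =
        is.map (wordChar (P ++ R)) := by
      rw [List.map_map]
      rfl
    rw [← h1, ← h2, ← List.map_append] at ih
    exact ih

lemma hasIndexOne_block {R is : List ℕ} {i : ℕ} (hR : ∀ a ∈ R, i < a)
    (h : HasIndexOne (wordTwist R) (is.map (wordChar R))) (m : ℕ) :
    HasIndexOne (wordTwist ((List.range m).reverse.map (i + ·) ++ R))
      ((List.replicate m i ++ is).map (wordChar ((List.range m).reverse.map (i + ·) ++ R))) := by
  have h1 := hasIndexOne_append h ((List.range m).reverse.map (i + ·))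
  simp only [List.length_map, List.length_reverse, List.length_range] at h1
  rw [List.map_append, List.map_replicate]
  rcases m with _ | j
  · simpa using h1
  set W := (List.range (j + 1)).reverse.map (i + ·) ++ R with hW
  have hlen : W.length = j + 1 + R.length := by simp [hW]
  have hget : ∀ q : Fin W.length, (q : ℕ) ≤ j → W.get q = i + (j - q) := by
    intro q hq
    have h2 : (q : ℕ) < ((List.range (j + 1)).reverse.map (i + ·)).length := by simp; omega
    simp only [hW, List.get_eq_getElem]
    rw [List.getElem_append_left h2]
    simp
  have hget' : ∀ q : Fin W.length, j < (q : ℕ) → i < W.get q := by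
    intro q hq
    apply hR
    simp only [hW, List.get_eq_getElem]
    rw [List.getElem_append_right (by simp; omega)]
    exact List.getElem_mem _
  have hchar : wordChar W i = posChar W.length j := by
    funext q
    simp only [wordChar, posChar]
    congr 1
    rcases Nat.lt_or_ge j q with hq | hq
    · have := hget' q hq
      simp only [eq_iff_iff]
      omega
    · rw [hget q hq]
      simp only [eq_iff_iff]
      omega
  rw [hchar]
  refine HasIndexOne.replicate_of_range (by omega) (fun q r hr hq => ?_) _ h1
  have hq' : (q : ℕ) < r := hq
  simp only [wordTwist, hget q (by omega), hget r hr, decide_eq_true_eq]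
  omega

/-- The word of rotation planes whose tower carries frames with nonzero obstruction. -/
def rotationWord (m n i : ℕ) : List ℕ :=
  (List.range' i n).flatMap fun a => (List.range m).reverse.map (a + ·)

theorem hasIndexOne_rotationWord (m : ℕ) : ∀ n i : ℕ, HasIndexOne (wordTwist (rotationWord m n i))
    (((List.range' i n).flatMap fun a => List.replicate m a).map (wordChar (rotationWord m n i)))
  | 0, _ => hasIndexOne_nil _
  | n + 1, i => by
    have hw : rotationWord m (n + 1) i =
        (List.range m).reverse.map (i + ·) ++ rotationWord m n (i + 1) := by
      simp [rotationWord, List.range'_succ]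
    have h := hasIndexOne_block (i := i) (fun a ha => ?_) (hasIndexOne_rotationWord m n (i + 1)) m
    · rw [hw, List.range'_succ, List.flatMap_cons]
      exact h
    · simp only [rotationWord, List.mem_flatMap, List.mem_range'_1, List.mem_map] at ha
      obtain ⟨b, hb, c, -, rfl⟩ := ha
      omega

/-! ### Common zeros of equivariant functions on a tower -/

/-- `f` is multiplied by `1` or `-1`, as prescribed by `c`, under the generators of the
tower group. -/
def IsSignTwisted {N : ℕ} (ε : Fin N → Fin N → Bool) (L : ℝ) (c : Fin N → ZMod 2)
    (f : (Fin N → ℝ) → ℝ) : Prop :=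
  ∀ r θ, f (twist ε 0 L r θ) = if c r = 0 then f θ else -f θ

lemma exists_sign_cochain {N : ℕ} {ε : Fin N → Fin N → Bool} {K : ℕ} (hK : 0 < K) {δ : ℝ}
    {c : Fin N → ZMod 2} {f : (Fin N → ℝ) → ℝ} (hf : IsSignTwisted ε (2 * K * δ) c f) :
    ∃ l : (Fin N → ℤ) → ZMod 2, IsTwisted ε K c l ∧
      (∀ t : Fin N → ℤ, f (fun i => δ * t i) < 0 → l t = 1) ∧
      ∀ t : Fin N → ℤ, 0 < f (fun i => δ * t i) → l t = 0 := by
  obtain ⟨l₀, hl₀⟩ := exists_isTwisted hK ε c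
  have htwist : ∀ r (t : Fin N → ℤ), (fun i => δ * ((twist ε 0 (2 * K : ℤ) r t i : ℤ) : ℝ)) =
      twist ε 0 (2 * K * δ) r fun i => δ * t i := by
    intro r t
    funext i
    simp only [twist]
    split_ifs <;> push_cast <;> ring
  refine ⟨fun t => if f (fun i => δ * t i) < 0 then 1 else
    if 0 < f (fun i => δ * t i) then 0 else l₀ t, fun r t => ?_, fun t ht => by simp [ht],
    fun t ht => by simp [ht, ht.le]⟩
  simp only [htwist, hf r]
  have hc : c r = 0 ∨ c r = 1 := by
    generalize c r = x
    revert x; decide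
  have h11 : (1 : ZMod 2) + 1 = 0 := rfl
  rcases hc with hc | hc
  · simp only [hc, if_true, add_zero, hl₀ r t]
  · simp only [hc, one_ne_zero, if_false, hl₀ r t]
    rcases lt_trichotomy (f fun i => δ * t i) 0 with h | h | h
    · simp [h, h.le, h11]
    · simp [h]
    · simp [h, h.le]

theorem exists_common_zero {N : ℕ} {ε : Fin N → Fin N → Bool} {cs : List (Fin N → ZMod 2)}
    (h : HasIndexOne ε cs) {L : ℝ} (hL : 0 < L) {fs : List ((Fin N → ℝ) → ℝ)}
    (hfs : List.Forall₂ (IsSignTwisted ε L) cs fs) (hcont : ∀ f ∈ fs, Continuous f) :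
    ∃ θ ∈ Set.Icc (0 : Fin N → ℝ) (fun _ => L), ∀ f ∈ fs, f θ = 0 := by
  by_contra! hne
  obtain ⟨δ, hδ, hball⟩ := lebesgue_number_lemma_of_metric
    (s := Set.Icc (0 : Fin N → ℝ) (fun _ => L)) (isCompact_Icc)
    (c := fun p : {f // f ∈ fs} × Bool =>
      if p.2 then {θ | 0 < p.1.1 θ} else {θ | p.1.1 θ < 0})
    (fun p => by
      split_ifs
      · exact isOpen_lt continuous_const (hcont _ p.1.2)
      · exact isOpen_lt (hcont _ p.1.2) continuous_const)
    (fun θ hθ => by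
      obtain ⟨f, hf, hne⟩ := hne θ hθ
      rw [Set.mem_iUnion]
      rcases lt_or_gt_of_ne hne with h | h
      · exact ⟨(⟨f, hf⟩, false), by simpa using h⟩
      · exact ⟨(⟨f, hf⟩, true), by simpa using h⟩)
  obtain ⟨K, hK⟩ := exists_nat_gt (max 2 (L / δ))
  have hK2 : 2 < K := by exact_mod_cast (le_max_left _ _).trans_lt hK
  have hK0 : (0 : ℝ) < K := by positivity
  set γ : ℝ := L / (2 * K) with hγ
  have hγ0 : 0 < γ := by positivity
  have hγL : 2 * K * γ = L := by rw [hγ]; field_simp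
  have hγδ : γ < δ := by
    have h1 := (le_max_right _ _).trans_lt hK
    rw [div_lt_iff₀ hδ] at h1
    rw [hγ, div_lt_iff₀ (by positivity)]
    nlinarith
  have hex : ∃ ls, List.Forall₂ (IsTwisted ε K) cs ls ∧ List.Forall₂ (fun f l =>
      (∀ t : Fin N → ℤ, f (fun i => γ * t i) < 0 → l t = 1) ∧
      ∀ t : Fin N → ℤ, 0 < f (fun i => γ * t i) → l t = 0) fs ls := by
    clear hball hne hcont h
    induction hfs with
    | nil => exact ⟨[], .nil, .nil⟩
    | cons hf _ ih =>
      obtain ⟨ls, h1, h2⟩ := ih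
      obtain ⟨l, h3, h4⟩ := exists_sign_cochain (K := K) (by omega) (hγL ▸ hf)
      exact ⟨l :: ls, .cons h3 h1, .cons h4 h2⟩
  obtain ⟨ls, hls, hsign⟩ := hex
  have hmem : ∀ f ∈ fs, ∃ l ∈ ls, (∀ t : Fin N → ℤ, f (fun i => γ * t i) < 0 → l t = 1) ∧
      ∀ t : Fin N → ℤ, 0 < f (fun i => γ * t i) → l t = 0 := by
    clear hball hne hcont hfs hls
    induction hsign with
    | nil => simp
    | cons hl _ ih =>
      intro f hf
      rcases List.mem_cons.1 hf with rfl | hf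
      · exact ⟨_, by simp, hl⟩
      · obtain ⟨l, h1, h2⟩ := ih f hf
        exact ⟨l, by simp [h1], h2⟩
  have h1 := h.2 K hK2.le ls hls
  refine zero_ne_one (α := ZMod 2) (h1 ▸ ?_)
  refine (boxSum_eq_zero _ fun u hu => Finset.sum_eq_zero fun τ _ => ?_).symm
  obtain ⟨⟨⟨f, hf⟩, b⟩, hb⟩ := hball (fun i => γ * u i) (by
    refine ⟨fun i => ?_, fun i => ?_⟩
    · have : (0 : ℝ) ≤ u i := by exact_mod_cast (hu i).1
      simp only [Pi.zero_apply]
      positivity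
    · have : (u i : ℝ) ≤ 2 * K := by exact_mod_cast (hu i).2.le
      simp only
      nlinarith)
  have hvert : ∀ j, (fun i => γ * (cubeVertex u τ j i : ℝ)) ∈
      Metric.ball (fun i => γ * (u i : ℝ)) δ := by
    intro j
    rw [Metric.mem_ball]
    refine lt_of_le_of_lt ((dist_pi_le_iff hγ0.le).2 fun i => ?_) hγδ
    rw [Real.dist_eq, ← mul_sub, abs_mul, abs_of_pos hγ0]
    have h2 : cubeVertex u τ j i = u i ∨ cubeVertex u τ j i = u i + 1 := by
      simp only [cubeVertex, evenEnd, oddEnd]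
      split_ifs <;> omega
    rcases h2 with h2 | h2
    · simp [h2, hγ0.le]
    · simp [h2]
  obtain ⟨l, hl, hneg, hpos⟩ := hmem f hf
  obtain ⟨A, B, rfl⟩ := List.append_of_mem hl
  refine cup_eq_zero A B l _ fun j => ?_
  cases b
  · rw [hneg _ (by simpa using hb (hvert j)), hneg _ (by simpa using hb (hvert 0))]
  · rw [hpos _ (by simpa using hb (hvert j)), hpos _ (by simpa using hb (hvert 0))]

/-! ### Frames produced by a tower of rotations -/

/-- Rotation by the angle `t` in the plane of the axes `k` and `k + 1`. -/
noncomputable def planeRotation (k : ℕ) (t : ℝ) (x : ℕ → ℝ) : ℕ → ℝ := fun j =>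
  if j = k then Real.cos t * x k - Real.sin t * x (k + 1)
  else if j = k + 1 then Real.sin t * x k + Real.cos t * x (k + 1) else x j

/-- The half turn in the plane of the axes `k` and `k + 1`. -/
def planeFlip (k : ℕ) (x : ℕ → ℝ) : ℕ → ℝ := fun j => if j = k ∨ j = k + 1 then -x j else x j

/-- The product of the rotations in the planes listed in a word. -/
noncomputable def wordRotation : (W : List ℕ) → (Fin W.length → ℝ) → (ℕ → ℝ) → ℕ → ℝ
  | [], _, x => x
  | k :: W, θ, x => planeRotation k (θ 0) (wordRotation W (fun q => θ q.succ) x)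

lemma planeRotation_add_pi (k : ℕ) (t : ℝ) (x : ℕ → ℝ) :
    planeRotation k (t + Real.pi) x = planeRotation k t (planeFlip k x) := by
  funext j
  simp only [planeRotation, planeFlip, Real.cos_add_pi, Real.sin_add_pi]
  split_ifs <;> first | omega | (exfalso; tauto) | ring1

lemma planeFlip_planeRotation (k l : ℕ) (t : ℝ) (x : ℕ → ℝ) :
    planeFlip k (planeRotation l t x) =
      planeRotation l (if k + 1 = l ∨ l + 1 = k then 0 - t else t) (planeFlip k x) := by
  funext j
  simp only [planeRotation, planeFlip, zero_sub]
  split_ifs <;> first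
    | omega
    | (simp only [Real.cos_neg, Real.sin_neg]; ring1)
    | (simp_all; done)
    | (simp_all; ring1)

lemma planeFlip_wordRotation (k : ℕ) : ∀ (W : List ℕ) (θ : Fin W.length → ℝ) (x : ℕ → ℝ),
    planeFlip k (wordRotation W θ x) = wordRotation W
      (reflect 0 (fun q => decide (k + 1 = W.get q ∨ W.get q + 1 = k)) θ) (planeFlip k x)
  | [], _, _ => rfl
  | l :: W, θ, x => by
    simp only [wordRotation]
    rw [planeFlip_planeRotation, planeFlip_wordRotation k W]
    unfold reflect
    simp only [decide_eq_true_eq]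
    rfl

lemma wordRotation_twist : ∀ (W : List ℕ) (r : Fin W.length) (θ : Fin W.length → ℝ) (x : ℕ → ℝ),
    wordRotation W (twist (wordTwist W) 0 Real.pi r θ) x =
      wordRotation W θ (planeFlip (W.get r) x)
  | [], r, _, _ => r.elim0
  | k :: W, r, θ, x => by
    obtain ⟨a, θ, rfl⟩ : ∃ a θ', θ = (Fin.cons a θ' : Fin (W.length + 1) → ℝ) :=
      ⟨θ 0, Fin.tail θ, (Fin.cons_self_tail θ).symm⟩
    refine Fin.cases ?_ (fun r => ?_) r
    · have h := twist_zero_cons (N := W.length) (wordTwist (k :: W)) 0 Real.pi a θ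
      simp only [wordRotation, List.length_cons] at h ⊢
      rw [h]
      simp only [Fin.cons_zero, Fin.cons_succ]
      rw [planeRotation_add_pi, planeFlip_wordRotation]
      congr 2
      exact reflect_reflect _ _ _
    · have h := twist_succ_cons (N := W.length) (wordTwist (k :: W)) 0 Real.pi a r θ
      simp only [wordRotation, List.length_cons] at h ⊢
      rw [h]
      simp only [Fin.cons_zero, Fin.cons_succ]
      congr 1
      exact wordRotation_twist W r θ x

lemma wordRotation_neg : ∀ (W : List ℕ) (θ : Fin W.length → ℝ) (x : ℕ → ℝ),
    wordRotation W θ (-x) = -wordRotation W θ x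
  | [], _, _ => rfl
  | k :: W, θ, x => by
    simp only [wordRotation, wordRotation_neg W]
    funext j
    simp only [planeRotation, Pi.neg_apply]
    split_ifs <;> ring

lemma planeFlip_single (W : List ℕ) (i : ℕ) (r : Fin W.length) :
    planeFlip (W.get r) (Pi.single i 1) =
      if wordChar W i r = 0 then Pi.single i 1 else -Pi.single i 1 := by
  funext j
  simp only [planeFlip, wordChar, Pi.single_apply]
  split_ifs <;> simp_all <;> omega

lemma sum_planeRotation_mul {d k : ℕ} (hk : k + 1 < d) (t : ℝ) (x y : ℕ → ℝ) :
    ∑ j ∈ Finset.range d, planeRotation k t x j * planeRotation k t y j =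
      ∑ j ∈ Finset.range d, x j * y j := by
  rw [← sub_eq_zero, ← Finset.sum_sub_distrib]
  rw [← Finset.sum_subset (s₁ := {k, k + 1})]
  · rw [Finset.sum_pair (by omega)]
    simp only [planeRotation, if_true, Nat.succ_ne_self, if_false]
    linear_combination (x k * y k + x (k + 1) * y (k + 1)) * Real.cos_sq_add_sin_sq t
  · intro j
    simp only [Finset.mem_insert, Finset.mem_singleton, Finset.mem_range]
    omega
  · intro j _ hj
    simp only [Finset.mem_insert, Finset.mem_singleton, not_or] at hj
    simp [planeRotation, hj]

lemma sum_wordRotation_mul {d : ℕ} : ∀ (W : List ℕ), (∀ k ∈ W, k + 1 < d) →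
    ∀ (θ : Fin W.length → ℝ) (x y : ℕ → ℝ),
    ∑ j ∈ Finset.range d, wordRotation W θ x j * wordRotation W θ y j =
      ∑ j ∈ Finset.range d, x j * y j
  | [], _, _, _, _ => rfl
  | k :: W, h, θ, x, y => by
    simp only [wordRotation]
    rw [sum_planeRotation_mul (h k (by simp)),
      sum_wordRotation_mul W fun l hl => h l (by simp [hl])]

lemma continuous_wordRotation (x : ℕ → ℝ) : ∀ (W : List ℕ),
    Continuous fun θ : Fin W.length → ℝ => wordRotation W θ x
  | [] => continuous_const
  | k :: W => by
    have ih := continuous_wordRotation x W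
    have h1 : Continuous fun θ : Fin (W.length + 1) → ℝ =>
        wordRotation W (fun q => θ q.succ) x := ih.comp (by fun_prop)
    have h2 : ∀ j, Continuous fun θ : Fin (W.length + 1) → ℝ =>
        wordRotation W (fun q => θ q.succ) x j := fun j => (continuous_apply j).comp h1
    refine continuous_pi fun j => ?_
    simp only [wordRotation, planeRotation]
    have h3 : Continuous fun θ : Fin (W.length + 1) → ℝ => Real.cos (θ 0) := by fun_prop
    have h4 : Continuous fun θ : Fin (W.length + 1) → ℝ => Real.sin (θ 0) := by fun_prop
    split_ifs
    · exact (h3.mul (h2 _)).sub (h4.mul (h2 _))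
    · exact (h4.mul (h2 _)).add (h3.mul (h2 _))
    · exact h2 j

/-- **Borsuk–Ulam theorem for orthonormal frames**: `m` sign-equivariant maps from the orthonormal
`n`-frames of `ℝ^d` to `ℝ^n` have a common zero as soon as `n + m ≤ d`. -/
theorem exists_orthonormal_common_zero {d n m : ℕ} (hd : n + m ≤ d)
    (F : Fin m → (Fin n → EuclideanSpace ℝ (Fin d)) → Fin n → ℝ)
    (hF : ∀ j, ContinuousOn (F j) {v | Orthonormal ℝ v})
    (hsign : ∀ j v (s : Fin n → ℝ), Orthonormal ℝ v → (∀ i, s i = 1 ∨ s i = -1) →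
      ∀ i, F j (fun i => s i • v i) i = s i * F j v i) :
    ∃ v, Orthonormal ℝ v ∧ ∀ j i, F j v i = 0 := by
  set W := rotationWord m n 0 with hW
  have hletter : ∀ k ∈ W, k + 1 < d := by
    intro k hk
    simp only [hW, rotationWord, List.mem_flatMap, List.mem_range'_1, List.mem_map,
      List.mem_reverse, List.mem_range] at hk
    obtain ⟨a, ha, b, hb, rfl⟩ := hk
    omega
  let V : (Fin W.length → ℝ) → Fin n → EuclideanSpace ℝ (Fin d) := fun θ i =>
    WithLp.toLp 2 fun j : Fin d => wordRotation W θ (Pi.single (i : ℕ) 1) j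
  have hV : ∀ θ, Orthonormal ℝ (V θ) := by
    intro θ
    rw [orthonormal_iff_ite]
    intro i j
    have h := sum_wordRotation_mul W hletter θ (Pi.single (j : ℕ) 1) (Pi.single (i : ℕ) 1)
    simp only [Pi.single_apply, mul_ite, mul_one, mul_zero] at h
    rw [Finset.sum_ite_eq' (Finset.range d) (i : ℕ), if_pos (by simp; omega),
      ← Fin.sum_univ_eq_sum_range (fun a => wordRotation W θ (Pi.single (j : ℕ) 1) a *
        wordRotation W θ (Pi.single (i : ℕ) 1) a)] at h
    simp only [V, PiLp.inner_apply, RCLike.inner_apply, conj_trivial]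
    rw [h]
    simp [Fin.ext_iff]
  have hVcont : Continuous V := by
    refine continuous_pi fun i => (PiLp.continuous_toLp 2 _).comp (continuous_pi fun j => ?_)
    exact (continuous_apply _).comp (continuous_wordRotation _ W)
  have hVtwist : ∀ r θ, V (twist (wordTwist W) 0 Real.pi r θ) =
      fun i : Fin n => (if wordChar W (i : Fin n) r = 0 then (1 : ℝ) else -1) • V θ i := by
    intro r θ
    funext i
    simp only [V, wordRotation_twist, planeFlip_single]
    split_ifs
    · simp
    · rw [wordRotation_neg]
      ext j
      simp
  let f : ℕ × ℕ → (Fin W.length → ℝ) → ℝ := fun p θ =>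
    if h : p.1 < n ∧ p.2 < m then F ⟨p.2, h.2⟩ (V θ) ⟨p.1, h.1⟩ else 0
  let pairs : List (ℕ × ℕ) := (List.range' 0 n).flatMap fun a => (List.range m).map fun b => (a, b)
  have hpairs : ∀ p, p ∈ pairs ↔ p.1 < n ∧ p.2 < m := by
    rintro ⟨a, b⟩
    simp [pairs]
  have hidx : ((List.range' 0 n).flatMap fun a => List.replicate m a) = pairs.map Prod.fst := by
    simp [pairs, List.map_flatMap, List.map_map, Function.comp_def]
  have hindex := hasIndexOne_rotationWord m n 0
  rw [hidx, List.map_map] at hindex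
  obtain ⟨θ, -, hθ⟩ := exists_common_zero (fs := pairs.map f) hindex Real.pi_pos (by
    rw [List.forall₂_map_left_iff, List.forall₂_map_right_iff, List.forall₂_same]
    intro p hp r θ
    have h := (hpairs p).1 hp
    simp only [f, h, and_self, dif_pos]
    rw [hVtwist, hsign _ _ _ (hV θ) fun i => by split_ifs <;> simp]
    simp only [Function.comp]
    split_ifs <;> simp) (by
    intro g hg
    obtain ⟨p, hp, rfl⟩ := List.mem_map.1 hg
    have h := (hpairs p).1 hp
    simp only [f, h, and_self, dif_pos]
    exact (continuous_apply _).comp ((hF _).comp_continuous hVcont hV))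
  refine ⟨V θ, hV θ, fun j i => ?_⟩
  have h := hθ (f (i, j)) (List.mem_map.2 ⟨_, (hpairs _).2 ⟨i.2, j.2⟩, rfl⟩)
  simpa [f] using h

/-! ### Equivariant selection of points bounded by a function on the sphere -/

section Selection

open MeasureTheory

variable {E : Type*} [NormedAddCommGroup E] [InnerProductSpace ℝ E] {n : ℕ}

/-- The linear map sending the standard basis to `v`. -/
noncomputable def frameMap (v : Fin n → E) (y : EuclideanSpace ℝ (Fin n)) : E := ∑ a, y a • v a

lemma continuous_frameMap :
    Continuous fun p : (Fin n → E) × EuclideanSpace ℝ (Fin n) => frameMap p.1 p.2 := by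
  unfold frameMap
  fun_prop

lemma Orthonormal.norm_frameMap {v : Fin n → E} (hv : Orthonormal ℝ v)
    (y : EuclideanSpace ℝ (Fin n)) : ‖frameMap v y‖ = ‖y‖ := by
  have h := hv.inner_sum y y Finset.univ
  have h1 : ‖frameMap v y‖ ^ 2 = ‖y‖ ^ 2 := by
    rw [← real_inner_self_eq_norm_sq, EuclideanSpace.norm_sq_eq]
    unfold frameMap
    rw [h]
    refine Finset.sum_congr rfl fun a _ => ?_
    simp [sq]
  rwa [sq_eq_sq₀ (norm_nonneg _) (norm_nonneg _)] at h1

lemma inner_frameMap (v : Fin n → E) (y : EuclideanSpace ℝ (Fin n)) (p : E) :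
    ⟪frameMap v y, p⟫ = ⟪y, WithLp.toLp 2 fun a => ⟪v a, p⟫⟫ := by
  simp [frameMap, sum_inner, inner_smul_left, PiLp.inner_apply, mul_comm]

/-- The least `C` such that `⟪y, x⟫ ≤ g y + C` for all unit vectors `y` of the span of the
frame `v`, with `y` and `x` in the coordinates given by `v`. -/
noncomputable def excess (g : E → ℝ) (v : Fin n → E) (x : EuclideanSpace ℝ (Fin n)) : ℝ :=
  sSup ((fun y => ⟪y, x⟫ - g (frameMap v y)) '' Metric.sphere 0 1)

lemma continuous_excess {g : E → ℝ} (hg : Continuous g) :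
    Continuous fun p : (Fin n → E) × EuclideanSpace ℝ (Fin n) => excess g p.1 p.2 := by
  refine IsCompact.continuous_sSup (f := fun (p : (Fin n → E) × EuclideanSpace ℝ (Fin n)) y =>
    ⟪y, p.2⟫ - g (frameMap p.1 y)) (isCompact_sphere 0 1) ?_
  have h : Continuous fun q : ((Fin n → E) × EuclideanSpace ℝ (Fin n)) × EuclideanSpace ℝ (Fin n) =>
      frameMap q.1.1 q.2 :=
    continuous_frameMap.comp (by fun_prop : Continuous fun q : ((Fin n → E) ×
      EuclideanSpace ℝ (Fin n)) × EuclideanSpace ℝ (Fin n) => (q.1.1, q.2))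
  exact (by fun_prop : Continuous fun q : ((Fin n → E) × EuclideanSpace ℝ (Fin n)) ×
    EuclideanSpace ℝ (Fin n) => ⟪q.2, q.1.2⟫).sub (hg.comp h)

lemma le_excess {g : E → ℝ} (hg : Continuous g) (v : Fin n → E) (x : EuclideanSpace ℝ (Fin n))
    {y : EuclideanSpace ℝ (Fin n)} (hy : ‖y‖ = 1) :
    ⟪y, x⟫ ≤ g (frameMap v y) + excess g v x := by
  have h : Continuous fun y => ⟪y, x⟫ - g (frameMap v y) :=
    (by fun_prop : Continuous fun y : EuclideanSpace ℝ (Fin n) => ⟪y, x⟫).sub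
      (hg.comp (continuous_frameMap.comp (by fun_prop : Continuous fun y :
        EuclideanSpace ℝ (Fin n) => (v, y))))
  have h1 := le_csSup (((isCompact_sphere (0 : EuclideanSpace ℝ (Fin n)) 1).image h).bddAbove)
    (Set.mem_image_of_mem _ (by simpa using hy : y ∈ Metric.sphere _ 1))
  simp only [excess]
  linarith

lemma excess_le [NeZero n] {g : E → ℝ} {v : Fin n → E} {x : EuclideanSpace ℝ (Fin n)} {C : ℝ}
    (h : ∀ y : EuclideanSpace ℝ (Fin n), ‖y‖ = 1 → ⟪y, x⟫ ≤ g (frameMap v y) + C) :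
    excess g v x ≤ C := by
  refine csSup_le (((NormedSpace.sphere_nonempty).2 zero_le_one).image _) ?_
  rintro _ ⟨y, hy, rfl⟩
  have := h y (by simpa using hy)
  simp only
  linarith

lemma norm_le_of_excess_le {g : E → ℝ} (hg : Continuous g) {R : ℝ} (hR : 0 ≤ R)
    (hgR : ∀ w, ‖w‖ = 1 → |g w| ≤ R) {v : Fin n → E} (hv : Orthonormal ℝ v)
    {x : EuclideanSpace ℝ (Fin n)} {C : ℝ} (hC : 0 ≤ C) (h : excess g v x ≤ C) :
    ‖x‖ ≤ R + C := by
  rcases eq_or_ne x 0 with rfl | hx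
  · simpa using add_nonneg hR hC
  · have hx' : 0 < ‖x‖ := norm_pos_iff.2 hx
    have hy : ‖(‖x‖⁻¹ • x)‖ = 1 := by rw [norm_smul]; simp [hx'.ne']
    have h1 := le_excess hg v x hy
    have h2 := (abs_le.1 (hgR _ ((hv.norm_frameMap _).trans hy))).2
    rw [inner_smul_left, real_inner_self_eq_norm_sq] at h1
    have h3 : ‖x‖⁻¹ * ‖x‖ ^ 2 = ‖x‖ := by field_simp
    simp only [conj_trivial, h3] at h1
    linarith

lemma exists_excess_le [NeZero n] {g : E → ℝ} {R : ℝ} (hgR : ∀ w, ‖w‖ = 1 → |g w| ≤ R)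
    (hhelly : ∀ I : Finset E, (∀ w ∈ I, ‖w‖ = 1) → I.card ≤ n + 1 → ∀ η > 0,
      ∃ p, ∀ w ∈ I, ⟪w, p⟫ ≤ g w + η)
    {v : Fin n → E} (hv : Orthonormal ℝ v) {η : ℝ} (hη : 0 < η) : ∃ x, excess g v x ≤ η := by
  classical
  let T : Metric.sphere (0 : EuclideanSpace ℝ (Fin n)) 1 → Set (EuclideanSpace ℝ (Fin n)) :=
    fun y => {x | ⟪(y : EuclideanSpace ℝ (Fin n)), x⟫ ≤ g (frameMap v y) + η}
  have hfin : ∀ u : Finset (Metric.sphere (0 : EuclideanSpace ℝ (Fin n)) 1),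
      (⋂ y ∈ u, T y).Nonempty := by
    intro u
    refine Convex.helly_theorem' (𝕜 := ℝ) (s := u) (F := T) (fun y _ => ?_) fun I _ hI => ?_
    · exact convex_halfSpace_le (innerₛₗ ℝ (y : EuclideanSpace ℝ (Fin n))).isLinear _
    · obtain ⟨p, hp⟩ := hhelly (I.image fun y : Metric.sphere (0 : EuclideanSpace ℝ (Fin n)) 1 =>
        frameMap v y) (by
        intro w hw
        obtain ⟨y, -, rfl⟩ := Finset.mem_image.1 hw
        rw [hv.norm_frameMap]
        simp) (Finset.card_image_le.trans (by simpa using hI)) η hη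
      refine ⟨WithLp.toLp 2 fun a => ⟪v a, p⟫, Set.mem_iInter₂.2 fun y hy => ?_⟩
      simp only [T, Set.mem_ofPred_eq]
      rw [← inner_frameMap]
      exact hp _ (Finset.mem_image.2 ⟨y, hy, rfl⟩)
  let b : Fin n × Bool → Metric.sphere (0 : EuclideanSpace ℝ (Fin n)) 1 := fun q =>
    ⟨(if q.2 then (1 : ℝ) else -1) • EuclideanSpace.single q.1 1, by
      rcases q.2 <;> simp⟩
  obtain ⟨x, -, hx⟩ := IsCompact.inter_iInter_nonempty
    (isCompact_closedBall (0 : EuclideanSpace ℝ (Fin n)) (√(∑ _a : Fin n, (R + η) ^ 2))) T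
    (fun y => isClosed_le (by fun_prop) continuous_const) (fun u => by
      obtain ⟨x, hx⟩ := hfin (u ∪ Finset.univ.image b)
      rw [Set.mem_iInter₂] at hx
      refine ⟨x, ?_, Set.mem_iInter₂.2 fun y hy => hx y (Finset.mem_union_left _ hy)⟩
      rw [mem_closedBall_zero_iff, EuclideanSpace.norm_eq]
      refine Real.sqrt_le_sqrt (Finset.sum_le_sum fun a _ => ?_)
      refine pow_le_pow_left₀ (norm_nonneg _) ?_ 2
      have h1 := fun s => hx (b (a, s)) (Finset.mem_union_right _
        (Finset.mem_image_of_mem _ (Finset.mem_univ _)))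
      have h2 := fun s => (abs_le.1 (hgR (frameMap v (b (a, s)))
        ((hv.norm_frameMap _).trans (by simp)))).2
      have h3 := h1 true
      have h4 := h1 false
      have h5 := h2 true
      have h6 := h2 false
      simp only [T, Set.mem_ofPred_eq] at h3 h4
      have h7 : ⟪(b (a, true) : EuclideanSpace ℝ (Fin n)), x⟫ = x a := by
        simp [b, EuclideanSpace.inner_single_left]
      have h8 : ⟪(b (a, false) : EuclideanSpace ℝ (Fin n)), x⟫ = -x a := by
        simp [b, EuclideanSpace.inner_single_left]
      rw [h7] at h3
      rw [h8] at h4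
      rw [Real.norm_eq_abs, abs_le]
      constructor <;> linarith)
  refine ⟨x, excess_le fun y hy => ?_⟩
  exact Set.mem_iInter.1 hx ⟨y, by simpa using hy⟩

/-- Reflection of the coordinates with negative sign. -/
noncomputable def signIsometry (s : Fin n → ℝ) :
    EuclideanSpace ℝ (Fin n) ≃ₗᵢ[ℝ] EuclideanSpace ℝ (Fin n) :=
  LinearIsometryEquiv.piLpCongrRight 2 fun a =>
    if s a = 1 then LinearIsometryEquiv.refl ℝ ℝ else LinearIsometryEquiv.neg ℝ

lemma signIsometry_apply {s : Fin n → ℝ} (hs : ∀ a, s a = 1 ∨ s a = -1)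
    (x : EuclideanSpace ℝ (Fin n)) (a : Fin n) : signIsometry s x a = s a * x a := by
  rcases hs a with h | h
  · simp [signIsometry, h]
  · have : (-1 : ℝ) ≠ 1 := by norm_num
    simp [signIsometry, h, this]

lemma frameMap_sign {s : Fin n → ℝ} (hs : ∀ a, s a = 1 ∨ s a = -1) (v : Fin n → E)
    (y : EuclideanSpace ℝ (Fin n)) :
    frameMap (fun a => s a • v a) y = frameMap v (signIsometry s y) := by
  simp [frameMap, signIsometry_apply hs, smul_smul, mul_comm]

lemma signIsometry_signIsometry {s : Fin n → ℝ} (hs : ∀ a, s a = 1 ∨ s a = -1)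
    (x : EuclideanSpace ℝ (Fin n)) : signIsometry s (signIsometry s x) = x := by
  ext a
  rw [signIsometry_apply hs, signIsometry_apply hs]
  rcases hs a with h | h <;> simp [h]

lemma excess_sign {s : Fin n → ℝ} (hs : ∀ a, s a = 1 ∨ s a = -1) (g : E → ℝ) (v : Fin n → E)
    (x : EuclideanSpace ℝ (Fin n)) :
    excess g (fun a => s a • v a) x = excess g v (signIsometry s x) := by
  unfold excess
  congr 1
  ext c
  simp only [Set.mem_image, frameMap_sign hs]
  constructor
  · rintro ⟨y, hy, rfl⟩
    exact ⟨signIsometry s y, by simpa using hy, by rw [LinearIsometryEquiv.inner_map_map]⟩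
  · rintro ⟨y, hy, rfl⟩
    refine ⟨signIsometry s y, by simpa using hy, ?_⟩
    rw [signIsometry_signIsometry hs]
    congr 1
    rw [← LinearIsometryEquiv.inner_map_map (signIsometry s), signIsometry_signIsometry hs]

/-- The density used to average the points of nearly minimal excess. -/
noncomputable def excessWeight (g : E → ℝ) (ε : ℝ) (v : Fin n → E)
    (x : EuclideanSpace ℝ (Fin n)) : ℝ := max 0 (ε - excess g v x)

lemma continuous_excessWeight {g : E → ℝ} (hg : Continuous g) (ε : ℝ) :
    Continuous fun p : (Fin n → E) × EuclideanSpace ℝ (Fin n) => excessWeight g ε p.1 p.2 :=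
  continuous_const.max (continuous_const.sub (continuous_excess hg))

lemma continuous_excessWeight_left {g : E → ℝ} (hg : Continuous g) (ε : ℝ) (v : Fin n → E) :
    Continuous (excessWeight g ε v) := by
  have h := continuous_excessWeight (n := n) hg ε
  exact h.uncurry_left v

lemma excessWeight_nonneg (g : E → ℝ) (ε : ℝ) (v : Fin n → E) (x : EuclideanSpace ℝ (Fin n)) :
    0 ≤ excessWeight g ε v x := le_max_left _ _

lemma excess_le_of_excessWeight_ne_zero {g : E → ℝ} {ε : ℝ} {v : Fin n → E}
    {x : EuclideanSpace ℝ (Fin n)} (h : excessWeight g ε v x ≠ 0) : excess g v x ≤ ε := by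
  by_contra! hlt
  exact h (max_eq_left (by linarith))

lemma excessWeight_eq_zero {g : E → ℝ} (hg : Continuous g) {R : ℝ} (hR : 0 ≤ R)
    (hgR : ∀ w, ‖w‖ = 1 → |g w| ≤ R) {v : Fin n → E} (hv : Orthonormal ℝ v) {ε : ℝ} (hε : 0 < ε)
    {x : EuclideanSpace ℝ (Fin n)} (hx : x ∉ Metric.closedBall 0 (R + ε)) :
    excessWeight g ε v x = 0 := by
  by_contra h
  exact hx (mem_closedBall_zero_iff.2
    (norm_le_of_excess_le hg hR hgR hv hε.le (excess_le_of_excessWeight_ne_zero h)))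

/-- The weighted mean of the points of excess at most `ε`. -/
noncomputable def barycenter (g : E → ℝ) (ε : ℝ) (v : Fin n → E) : EuclideanSpace ℝ (Fin n) :=
  (∫ x, excessWeight g ε v x)⁻¹ • ∫ x, excessWeight g ε v x • x

lemma integral_excessWeight_pos [NeZero n] {g : E → ℝ} (hg : Continuous g) {R : ℝ} (hR : 0 ≤ R)
    (hgR : ∀ w, ‖w‖ = 1 → |g w| ≤ R)
    (hhelly : ∀ I : Finset E, (∀ w ∈ I, ‖w‖ = 1) → I.card ≤ n + 1 → ∀ η > 0,
      ∃ p, ∀ w ∈ I, ⟪w, p⟫ ≤ g w + η)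
    {v : Fin n → E} (hv : Orthonormal ℝ v) {ε : ℝ} (hε : 0 < ε) :
    0 < ∫ x, excessWeight g ε v x := by
  obtain ⟨x, hx⟩ := exists_excess_le hgR hhelly hv (half_pos hε)
  have hcont := continuous_excessWeight_left hg ε v
  have hsupp : HasCompactSupport (excessWeight g ε v) :=
    HasCompactSupport.intro (isCompact_closedBall 0 (R + ε))
      fun x hx => excessWeight_eq_zero hg hR hgR hv hε hx
  have hne : excessWeight g ε v x ≠ 0 := by
    unfold excessWeight
    exact (lt_max_of_lt_right (by linarith)).ne'
  exact hcont.integral_pos_of_hasCompactSupport_nonneg_nonzero hsupp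
    (excessWeight_nonneg g ε v) hne

lemma excess_barycenter_le [NeZero n] {g : E → ℝ} (hg : Continuous g) {R : ℝ} (hR : 0 ≤ R)
    (hgR : ∀ w, ‖w‖ = 1 → |g w| ≤ R)
    (hhelly : ∀ I : Finset E, (∀ w ∈ I, ‖w‖ = 1) → I.card ≤ n + 1 → ∀ η > 0,
      ∃ p, ∀ w ∈ I, ⟪w, p⟫ ≤ g w + η)
    {v : Fin n → E} (hv : Orthonormal ℝ v) {ε : ℝ} (hε : 0 < ε) :
    excess g v (barycenter g ε v) ≤ ε := by
  have hpos := integral_excessWeight_pos hg hR hgR hhelly hv hε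
  have hcont := continuous_excessWeight_left hg ε v
  have hsupp : HasCompactSupport (excessWeight g ε v) :=
    HasCompactSupport.intro (isCompact_closedBall 0 (R + ε))
      fun x hx => excessWeight_eq_zero hg hR hgR hv hε hx
  have hint := hcont.integrable_of_hasCompactSupport (μ := volume) hsupp
  have hint2 : Integrable fun x => excessWeight g ε v x • x :=
    (hcont.smul continuous_id).integrable_of_hasCompactSupport (hsupp.smul_right (f' := id))
  refine excess_le fun y hy => ?_
  rw [barycenter, inner_smul_right, ← integral_inner hint2, inv_mul_le_iff₀ hpos,
    ← integral_mul_const]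
  refine integral_mono (hint2.const_inner y) (hint.mul_const _) fun x => ?_
  simp only [inner_smul_right]
  by_cases h0 : excessWeight g ε v x = 0
  · simp [h0]
  · refine mul_le_mul_of_nonneg_left ?_ (excessWeight_nonneg g ε v x)
    have := le_excess hg v x hy
    have := excess_le_of_excessWeight_ne_zero h0
    linarith

lemma continuousOn_barycenter [NeZero n] {g : E → ℝ} (hg : Continuous g) {R : ℝ} (hR : 0 ≤ R)
    (hgR : ∀ w, ‖w‖ = 1 → |g w| ≤ R)
    (hhelly : ∀ I : Finset E, (∀ w ∈ I, ‖w‖ = 1) → I.card ≤ n + 1 → ∀ η > 0,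
      ∃ p, ∀ w ∈ I, ⟪w, p⟫ ≤ g w + η) {ε : ℝ} (hε : 0 < ε) :
    ContinuousOn (barycenter (n := n) g ε) {v | Orthonormal ℝ v} := by
  refine ContinuousOn.smul (ContinuousOn.inv₀ ?_ fun v hv =>
    (integral_excessWeight_pos hg hR hgR hhelly hv hε).ne') ?_
  · exact continuousOn_integral_of_compact_support (isCompact_closedBall 0 (R + ε))
      (continuous_excessWeight hg ε).continuousOn
      fun v x hv hx => excessWeight_eq_zero hg hR hgR hv hε hx
  · refine continuousOn_integral_of_compact_support (isCompact_closedBall 0 (R + ε))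
      ((continuous_excessWeight hg ε).smul continuous_snd).continuousOn fun v x hv hx => ?_
    rw [excessWeight_eq_zero hg hR hgR hv hε hx, zero_smul]

lemma barycenter_sign {s : Fin n → ℝ} (hs : ∀ a, s a = 1 ∨ s a = -1) (g : E → ℝ) (ε : ℝ)
    (v : Fin n → E) :
    barycenter g ε (fun a => s a • v a) = signIsometry s (barycenter g ε v) := by
  have hw : ∀ x, excessWeight g ε (fun a => s a • v a) x = excessWeight g ε v (signIsometry s x) :=
    fun x => by rw [excessWeight, excess_sign hs, excessWeight]
  have hemb := (signIsometry s).toHomeomorph.measurableEmbedding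
  have hmp := (signIsometry s).measurePreserving
  have h1 := hmp.integral_comp hemb (excessWeight g ε v)
  have h2 := hmp.integral_comp hemb fun x => excessWeight g ε v x • signIsometry s x
  simp only [signIsometry_signIsometry hs] at h2
  have h3 := (signIsometry s).toLinearIsometry.integral_comp_comm (μ := volume)
    fun x => excessWeight g ε v x • x
  simp only [barycenter, hw, map_smul, h1, h2]
  congr 1
  rw [← LinearIsometryEquiv.coe_toLinearIsometry, ← h3]
  simp

end Selection

/-- Any `m + 1` functions on the sphere that are support-like in every `n`-dimensional subspace
bound a common point in the coordinates of some orthonormal `n`-frame. -/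
theorem exists_orthonormal_common_bound {d n m : ℕ} [NeZero n] (hd : n + m ≤ d)
    (g : Fin (m + 1) → EuclideanSpace ℝ (Fin d) → ℝ) (hg : ∀ i, Continuous (g i)) {R : ℝ}
    (hR : 0 ≤ R) (hgR : ∀ i w, ‖w‖ = 1 → |g i w| ≤ R)
    (hhelly : ∀ i, ∀ I : Finset (EuclideanSpace ℝ (Fin d)), (∀ w ∈ I, ‖w‖ = 1) → I.card ≤ n + 1 →
      ∀ η > 0, ∃ p, ∀ w ∈ I, ⟪w, p⟫ ≤ g i w + η) :
    ∃ (v : Fin n → EuclideanSpace ℝ (Fin d)) (x : EuclideanSpace ℝ (Fin n)), Orthonormal ℝ v ∧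
      ∀ i y, ‖y‖ = 1 → ⟪y, x⟫ ≤ g i (frameMap v y) := by
  have key : ∀ l : ℕ, ∃ q : (Fin n → EuclideanSpace ℝ (Fin d)) × EuclideanSpace ℝ (Fin n),
      q ∈ {v | Orthonormal ℝ v} ×ˢ Metric.closedBall 0 (R + 1) ∧
        ∀ i, excess (g i) q.1 q.2 ≤ 1 / (l + 1 : ℝ) := by
    intro l
    have hε : (0 : ℝ) < 1 / (l + 1 : ℝ) := by positivity
    have hε1 : 1 / (l + 1 : ℝ) ≤ 1 := by
      rw [div_le_one (by positivity)]
      linarith [(Nat.cast_nonneg l : (0 : ℝ) ≤ l)]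
    have hcont := fun i => continuousOn_barycenter (hg i) hR (hgR i) (hhelly i) hε
    obtain ⟨v, hv, hzero⟩ := exists_orthonormal_common_zero hd
      (fun j v a => barycenter (g j.succ) (1 / (l + 1 : ℝ)) v a -
        barycenter (g 0) (1 / (l + 1 : ℝ)) v a)
      (fun j => continuousOn_pi.2 fun a =>
        ((EuclideanSpace.proj a).continuous.comp_continuousOn (hcont j.succ)).sub
          ((EuclideanSpace.proj a).continuous.comp_continuousOn (hcont 0)))
      (fun j v s _ hs a => by
        simp only [barycenter_sign hs, signIsometry_apply hs]
        ring)
    have heq : ∀ i, barycenter (g i) (1 / (l + 1 : ℝ)) v = barycenter (g 0) (1 / (l + 1 : ℝ)) v :=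
      Fin.cases rfl fun j => by
        ext a
        exact sub_eq_zero.1 (hzero j a)
    have hle : ∀ i, excess (g i) v (barycenter (g 0) (1 / (l + 1 : ℝ)) v) ≤ 1 / (l + 1 : ℝ) :=
      fun i => heq i ▸ excess_barycenter_le (hg i) hR (hgR i) (hhelly i) hv hε
    refine ⟨(v, _), ⟨hv, mem_closedBall_zero_iff.2 ?_⟩, hle⟩
    exact norm_le_of_excess_le (hg 0) hR (hgR 0) hv zero_le_one ((hle 0).trans hε1)
  choose q hq hexc using key
  have hcomp : IsCompact {v : Fin n → EuclideanSpace ℝ (Fin d) | Orthonormal ℝ v} := by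
    refine (isCompact_closedBall (0 : Fin n → EuclideanSpace ℝ (Fin d)) 1).of_isClosed_subset ?_ ?_
    · simp only [orthonormal_iff_ite, Set.ofPred_forall]
      exact isClosed_iInter fun a => isClosed_iInter fun b =>
        isClosed_eq (by fun_prop) continuous_const
    · intro v hv
      rw [mem_closedBall_zero_iff, pi_norm_le_iff_of_nonneg zero_le_one]
      exact fun a => (hv.norm_eq_one a).le
  obtain ⟨p, hp, φ, hφ, hlim⟩ := (hcomp.prod (isCompact_closedBall 0 (R + 1))).tendsto_subseq hq
  refine ⟨p.1, p.2, hp.1, fun i y hy => ?_⟩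
  have hle : excess (g i) p.1 p.2 ≤ 0 :=
    le_of_tendsto_of_tendsto' (((continuous_excess (hg i)).tendsto p).comp hlim)
      (tendsto_one_div_add_atTop_nhds_zero_nat.comp hφ.tendsto_atTop) fun l => hexc (φ l) i
  have := le_excess (hg i) p.1 p.2 hy
  linarith

/-! ### The critical levels of a set function -/

section SetFunction

variable {M : Type*} {op : M → M → M} {e : M} {d : ℕ} {μ : Set (EuclideanSpace ℝ (Fin d)) → M}

lemma isOpenHalfspace_setOf {v : EuclideanSpace ℝ (Fin d)} (hv : v ≠ 0) (c : ℝ) :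
    IsOpenHalfspace {x | c < ⟪v, x⟫} := ⟨v, c, hv, rfl⟩

lemma ne_zero_of_norm_eq_one {v : EuclideanSpace ℝ (Fin d)} (hv : ‖v‖ = 1) : v ≠ 0 := by
  rintro rfl
  simp at hv

lemma eq_neutral_of_mul_norm_le {R : ℝ}
    (hconc : ∀ h, IsOpenHalfspace h → h ∩ Metric.closedBall 0 R = ∅ → μ h = e)
    {v : EuclideanSpace ℝ (Fin d)} (hv : v ≠ 0) {c : ℝ} (hc : R * ‖v‖ ≤ c) :
    μ {x | c < ⟪v, x⟫} = e := by
  refine hconc _ (isOpenHalfspace_setOf hv c) (Set.eq_empty_of_forall_notMem ?_)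
  rintro x ⟨hx, hxR⟩
  rw [mem_closedBall_zero_iff] at hxR
  have h1 := real_inner_le_norm v x
  have h2 := mul_le_mul_of_nonneg_left hxR (norm_nonneg v)
  have h3 : c < ⟪v, x⟫ := hx
  linarith

lemma opMul_neutral (he : ∀ x : M, op x e = x ∧ op e x = x) (N : ℕ) : opMul op e N = e := by
  induction N with
  | zero => rfl
  | succ N ih => simp [opMul, ih, (he e).1]

variable [LinearOrder M]

lemma opMul_mono (hl : ∀ a b c : M, a ≤ b → op a c ≤ op b c)
    (hr : ∀ a b c : M, a ≤ b → op c a ≤ op c b) {x y : M} (h : x ≤ y) (N : ℕ) :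
    opMul op x N ≤ opMul op y N := by
  induction N with
  | zero => exact h
  | succ N ih => exact (hl _ _ _ h).trans (hr _ _ _ ih)

lemma le_opMul (hl : ∀ a b c : M, a ≤ b → op a c ≤ op b c)
    (hr : ∀ a b c : M, a ≤ b → op c a ≤ op c b) (he : ∀ x : M, op x e = x ∧ op e x = x)
    {x : M} (hx : e ≤ x) (N : ℕ) : x ≤ opMul op x N := by
  cases N with
  | zero => exact le_rfl
  | succ N =>
    have h := hr _ _ x ((opMul_neutral he N).symm.le.trans (opMul_mono hl hr hx N))
    rwa [(he x).1] at h

lemma opFold_le_opMul (hl : ∀ a b c : M, a ≤ b → op a c ≤ op b c)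
    (hr : ∀ a b c : M, a ≤ b → op c a ≤ op c b) (he : ∀ x : M, op x e = x ∧ op e x = x)
    {y : M} (hy : e ≤ y) {l : List M} (hly : ∀ z ∈ l, z ≤ y) {x : M} (hx : x ≤ y) {N : ℕ}
    (hN : l.length ≤ N) : opFold op x l ≤ opMul op y N := by
  induction l generalizing x N with
  | nil => exact hx.trans (le_opMul hl hr he hy N)
  | cons z l ih =>
    cases N with
    | zero => simp at hN
    | succ N =>
      exact (hl _ _ _ hx).trans (hr _ _ _ (ih (fun w hw => hly w (List.mem_cons_of_mem _ hw))
        (hly z List.mem_cons_self) (by simpa using hN)))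

lemma neutral_le_halfspace (hmono : ∀ X Y, X ⊆ Y → μ X ≤ μ Y) {R : ℝ}
    (hconc : ∀ h, IsOpenHalfspace h → h ∩ Metric.closedBall 0 R = ∅ → μ h = e)
    {v : EuclideanSpace ℝ (Fin d)} (hv : v ≠ 0) (c : ℝ) : e ≤ μ {x | c < ⟪v, x⟫} := by
  rw [← eq_neutral_of_mul_norm_le hconc hv (le_max_right c (R * ‖v‖))]
  exact hmono _ _ fun x hx => (le_max_left c _).trans_lt hx

lemma le_of_subset_union_halfspace (he : ∀ x : M, op x e = x ∧ op e x = x)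
    (hmono : ∀ X Y, X ⊆ Y → μ X ≤ μ Y)
    (hsub : ∀ h hs, IsOpenHalfspace h → (∀ g ∈ hs, IsOpenHalfspace g) →
      μ (⋃ g ∈ h :: hs, g) ≤ opFold op (μ h) (hs.map μ))
    {R : ℝ} (hconc : ∀ h, IsOpenHalfspace h → h ∩ Metric.closedBall 0 R = ∅ → μ h = e)
    {X : Set (EuclideanSpace ℝ (Fin d))} {v u : EuclideanSpace ℝ (Fin d)} {a b : ℝ} (hv : v ≠ 0)
    (hu : u ≠ 0) (hb : R * ‖u‖ ≤ b) (hX : ∀ x ∈ X, a < ⟪v, x⟫ ∨ b < ⟪u, x⟫) :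
    μ X ≤ μ {x | a < ⟪v, x⟫} := by
  have h := hsub {x | a < ⟪v, x⟫} [{x | b < ⟪u, x⟫}] (isOpenHalfspace_setOf hv a)
    (by simpa using isOpenHalfspace_setOf hu b)
  simp only [List.map_cons, List.map_nil, opFold, eq_neutral_of_mul_norm_le hconc hu hb,
    (he _).1] at h
  refine (hmono _ _ fun x hx => ?_).trans h
  simpa using hX x hx

/-- The halfspaces `{x | c < ⟪w, x⟫}` whose `(n + 1)`-fold multiple is smaller than the whole
space lie beyond a continuous critical level, and no `n + 1` of the critical halfspaces cover. -/
theorem exists_critical_level (hl : ∀ a b c : M, a ≤ b → op a c ≤ op b c)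
    (hr : ∀ a b c : M, a ≤ b → op c a ≤ op c b) (he : ∀ x : M, op x e = x ∧ op e x = x)
    (hmono : ∀ X Y, X ⊆ Y → μ X ≤ μ Y)
    (hsub : ∀ h hs, IsOpenHalfspace h → (∀ g ∈ hs, IsOpenHalfspace g) →
      μ (⋃ g ∈ h :: hs, g) ≤ opFold op (μ h) (hs.map μ))
    (hconc : ∃ B : Set (EuclideanSpace ℝ (Fin d)), Bornology.IsBounded B ∧
      ∀ h, IsOpenHalfspace h → h ∩ B = ∅ → μ h = e) (n : ℕ) :
    ∃ (R : ℝ) (g : EuclideanSpace ℝ (Fin d) → ℝ), 0 ≤ R ∧ Continuous g ∧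
      (∀ w, ‖w‖ = 1 → |g w| ≤ R) ∧
      (∀ I : Finset (EuclideanSpace ℝ (Fin d)), (∀ w ∈ I, ‖w‖ = 1) → I.card ≤ n + 1 →
        ∀ η > 0, ∃ p, ∀ w ∈ I, ⟪w, p⟫ ≤ g w + η) ∧
      ∀ w c, ‖w‖ = 1 → opMul op (μ {x | c < ⟪w, x⟫}) n < μ Set.univ → g w ≤ c := by
  classical
  obtain ⟨B, hB, hBe⟩ := hconc
  obtain ⟨R, hR, hBR⟩ : ∃ R : ℝ, 0 ≤ R ∧ B ⊆ Metric.closedBall 0 R := by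
    obtain ⟨R, hBR⟩ := hB.subset_closedBall 0
    exact ⟨max R 0, le_max_right _ _, hBR.trans (Metric.closedBall_subset_closedBall
      (le_max_left _ _))⟩
  replace hconc : ∀ h, IsOpenHalfspace h → h ∩ Metric.closedBall 0 R = ∅ → μ h = e :=
    fun h hh hd => hBe h hh (Set.subset_empty_iff.1 (hd ▸ Set.inter_subset_inter_right h hBR))
  have hge : ∀ {w : EuclideanSpace ℝ (Fin d)} (_ : ‖w‖ = 1) (c : ℝ), e ≤ μ {x | c < ⟪w, x⟫} :=
    fun hw c => neutral_le_halfspace hmono hconc (ne_zero_of_norm_eq_one hw) c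
  rcases le_or_gt (μ Set.univ) e with hsmall | hlarge
  · refine ⟨0, fun _ => 0, le_rfl, continuous_const, by simp, fun I _ _ η hη =>
      ⟨0, fun w _ => by simpa using hη.le⟩, fun w c hw hlt => absurd hlt (not_lt.2 ?_)⟩
    exact hsmall.trans ((hge hw c).trans (le_opMul hl hr he (hge hw c) n))
  let S : EuclideanSpace ℝ (Fin d) → Set ℝ := fun w =>
    {c | opMul op (μ {x | c < ⟪w, x⟫}) n < μ Set.univ}
  have hSR : ∀ w, ‖w‖ = 1 → R ∈ S w := fun w hw => by
    have h := eq_neutral_of_mul_norm_le hconc (ne_zero_of_norm_eq_one hw) (c := R) (by simp [hw])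
    simpa only [S, Set.mem_ofPred_eq, h, opMul_neutral he] using hlarge
  have hSlow : ∀ w, ‖w‖ = 1 → ∀ c ∈ S w, -R ≤ c := fun w hw c hc => by
    by_contra! hlt
    refine absurd hc (not_lt.2 (le_trans ?_ (le_opMul hl hr he (hge hw c) n)))
    have hw' : ‖-w‖ = 1 := by rwa [norm_neg]
    refine le_of_subset_union_halfspace he hmono hsub hconc (ne_zero_of_norm_eq_one hw)
      (ne_zero_of_norm_eq_one hw') (b := R) (by simp [hw]) fun x _ => ?_
    rw [inner_neg_left, or_iff_not_imp_left]
    intro h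
    linarith [not_lt.1 h]
  have hSmove : ∀ w w', ‖w‖ = 1 → ‖w'‖ = 1 → ∀ c ∈ S w, c + R * ‖w' - w‖ ∈ S w' := by
    intro w w' hw hw' c hc
    rcases eq_or_ne w' w with rfl | hne
    · simpa using hc
    · refine lt_of_le_of_lt (opMul_mono hl hr ?_ n) hc
      refine le_of_subset_union_halfspace he hmono hsub hconc (ne_zero_of_norm_eq_one hw)
        (sub_ne_zero.2 hne) le_rfl fun x hx => ?_
      have hx' : c + R * ‖w' - w‖ < ⟪w', x⟫ := hx
      rw [inner_sub_left, or_iff_not_imp_left]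
      intro h
      linarith [not_lt.1 h]
  have hbdd : ∀ w, ‖w‖ = 1 → BddBelow (S w) := fun w hw => ⟨-R, fun c hc => hSlow w hw c hc⟩
  have hlip : LipschitzOnWith R.toNNReal (fun w => sInf (S w)) (Metric.sphere 0 1) := by
    refine LipschitzOnWith.of_le_add_mul _ fun w' hw' w hw => ?_
    rw [mem_sphere_zero_iff_norm] at hw hw'
    rw [Real.coe_toNNReal R hR, ← sub_le_iff_le_add]
    refine le_csInf ⟨R, hSR w hw⟩ fun c hc => ?_
    rw [sub_le_iff_le_add, dist_eq_norm]
    exact csInf_le (hbdd w' hw') (hSmove w w' hw hw' c hc)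
  obtain ⟨g, hg, hgS⟩ := hlip.extend_real
  have hgS' : ∀ w, ‖w‖ = 1 → g w = sInf (S w) := fun w hw =>
    (hgS (mem_sphere_zero_iff_norm.2 hw)).symm
  refine ⟨R, g, hR, hg.continuous, fun w hw => ?_, fun I hI hcard η hη => ?_, fun w c hw hc => ?_⟩
  · rw [hgS' w hw, abs_le]
    exact ⟨le_csInf ⟨R, hSR w hw⟩ (hSlow w hw), csInf_le (hbdd w hw) (hSR w hw)⟩
  · by_contra! hcover
    have hex : ∀ w, ∃ c, ‖w‖ = 1 → c ∈ S w ∧ c < g w + η := by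
      intro w
      by_cases hw : ‖w‖ = 1
      · obtain ⟨c, hc, hlt⟩ := exists_lt_of_csInf_lt ⟨R, hSR w hw⟩
          (by linarith [hgS' w hw] : sInf (S w) < g w + η)
        exact ⟨c, fun _ => ⟨hc, hlt⟩⟩
      · exact ⟨0, fun h => absurd h hw⟩
    choose c hc using hex
    have hIne : I.Nonempty := by
      obtain ⟨w, hw, -⟩ := hcover 0
      exact ⟨w, hw⟩
    obtain ⟨w₀, hw₀, hmax⟩ := I.exists_max_image (fun w => μ {x | c w < ⟪w, x⟫}) hIne
    refine absurd (hc w₀ (hI w₀ hw₀)).1 (not_lt.2 ?_)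
    obtain ⟨w₁, l, hl₁⟩ := List.exists_cons_of_ne_nil (Finset.toList_eq_nil.not.2 hIne.ne_empty)
    have hmem : ∀ w, w ∈ w₁ :: l ↔ w ∈ I := fun w => by rw [← hl₁, Finset.mem_toList]
    have hhalf : ∀ w ∈ I, IsOpenHalfspace {x | c w < ⟪w, x⟫} := fun w hw =>
      isOpenHalfspace_setOf (ne_zero_of_norm_eq_one (hI w hw)) _
    have h1 := hsub {x | c w₁ < ⟪w₁, x⟫} (l.map fun w => {x | c w < ⟪w, x⟫})
      (hhalf w₁ ((hmem w₁).1 List.mem_cons_self)) (by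
        intro h hh
        obtain ⟨w, hw, rfl⟩ := List.mem_map.1 hh
        exact hhalf w ((hmem w).1 (List.mem_cons_of_mem _ hw)))
    refine (hmono _ _ fun x _ => ?_).trans (h1.trans (opFold_le_opMul hl hr he
      (hge (hI w₀ hw₀) _) ?_ (hmax w₁ ((hmem w₁).1 List.mem_cons_self)) ?_))
    · obtain ⟨w, hw, hlt⟩ := hcover x
      rw [← List.map_cons (f := fun w => {x | c w < ⟪w, x⟫})]
      exact Set.mem_iUnion₂.2 ⟨_, List.mem_map_of_mem ((hmem w).2 hw),
        (hc w (hI w hw)).2.trans hlt⟩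
    · intro z hz
      rw [List.map_map] at hz
      obtain ⟨w, hw, rfl⟩ := List.mem_map.1 hz
      exact hmax w ((hmem w).1 (List.mem_cons_of_mem _ hw))
    · have h2 := congrArg List.length hl₁
      rw [Finset.length_toList, List.length_cons] at h2
      simp only [List.length_map]
      omega
  · rw [hgS' w hw]
    exact csInf_le (hbdd w hw) hc

end SetFunction

lemma mem_direction_orthogonal_of_subset_halfspace {F : Type*} [NormedAddCommGroup F]
    [InnerProductSpace ℝ F] {K : Submodule ℝ F} {p w : F} {c : ℝ}
    (h : (AffineSubspace.mk' p K : Set F) ⊆ {z | c < ⟪w, z⟫}) : w ∈ Kᗮ := by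
  refine (Submodule.mem_orthogonal' K w).2 fun u hu => ?_
  by_contra hne
  have hmem : ((c - ⟪w, p⟫) / ⟪w, u⟫) • u +ᵥ p ∈ AffineSubspace.mk' p K :=
    AffineSubspace.vadd_mem_mk' p (K.smul_mem _ hu)
  have hlt : c < ⟪w, ((c - ⟪w, p⟫) / ⟪w, u⟫) • u + p⟫ := h hmem
  rw [inner_add_right, inner_smul_right, div_mul_cancel₀ _ hne] at hlt
  linarith

/-- Generalized center transversal theorem for monotone, `H`-subadditive set
functions concentrated on bounded sets, with values in a totally ordered
unital magma `(M, op, ≤, e)`. -/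
theorem generalized_center_transversal (d k : ℕ) (hd : 1 ≤ d) (hk : 1 ≤ k) (hkd : k ≤ d)
    {M : Type*} [LinearOrder M] (op : M → M → M) (e : M)
    (hmono_left : ∀ a b c : M, a ≤ b → op a c ≤ op b c)
    (hmono_right : ∀ a b c : M, a ≤ b → op c a ≤ op c b)
    (hneutral : ∀ x : M, op x e = x ∧ op e x = x)
    (μ : Fin k → Set (EuclideanSpace ℝ (Fin d)) → M)
    (hμmono : ∀ i, ∀ X Y : Set (EuclideanSpace ℝ (Fin d)), X ⊆ Y → μ i X ≤ μ i Y)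
    (hμsub : ∀ i, ∀ (h : Set (EuclideanSpace ℝ (Fin d)))
      (hs : List (Set (EuclideanSpace ℝ (Fin d)))),
      IsOpenHalfspace h → (∀ g ∈ hs, IsOpenHalfspace g) →
      μ i (⋃ g ∈ h :: hs, g) ≤ opFold op (μ i h) (hs.map (μ i)))
    (hμconc : ∀ i, ∃ B : Set (EuclideanSpace ℝ (Fin d)), Bornology.IsBounded B ∧
      ∀ h : Set (EuclideanSpace ℝ (Fin d)), IsOpenHalfspace h → h ∩ B = ∅ → μ i h = e) :
    ∃ π : AffineSubspace ℝ (EuclideanSpace ℝ (Fin d)),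
      (π : Set (EuclideanSpace ℝ (Fin d))).Nonempty ∧
      Module.finrank ℝ π.direction = k - 1 ∧
      ∀ h : Set (EuclideanSpace ℝ (Fin d)), IsOpenHalfspace h →
        (π : Set (EuclideanSpace ℝ (Fin d))) ⊆ h →
        ∀ i, μ i Set.univ ≤ opMul op (μ i h) (d - k + 1) := by
  obtain ⟨m, rfl⟩ : ∃ m, k = m + 1 := ⟨k - 1, by omega⟩
  set n := d - (m + 1) + 1 with hn
  have hnm : n + m = d := by omega
  have : NeZero n := ⟨by omega⟩
  choose R g hR hg hgR hhelly hlevel using fun i =>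
    exists_critical_level hmono_left hmono_right hneutral (hμmono i) (hμsub i) (hμconc i) n
  obtain ⟨v, x, hv, hvx⟩ := exists_orthonormal_common_bound hnm.le g hg
    (Finset.sum_nonneg fun i _ => hR i) (fun i w hw => (hgR i w hw).trans
      (Finset.single_le_sum (fun i _ => hR i) (Finset.mem_univ i))) hhelly
  refine ⟨AffineSubspace.mk' (frameMap v x) (Submodule.span ℝ (Set.range v))ᗮ,
    AffineSubspace.mk'_nonempty _ _, ?_, ?_⟩
  · have h1 := Submodule.finrank_add_finrank_orthogonal (Submodule.span ℝ (Set.range v))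
    rw [finrank_span_eq_card hv.linearIndependent, Fintype.card_fin,
      finrank_euclideanSpace_fin] at h1
    rw [AffineSubspace.direction_mk']
    omega
  · rintro _ ⟨w, c, hw, rfl⟩ hsub i
    have hwK := mem_direction_orthogonal_of_subset_halfspace hsub
    rw [Submodule.orthogonal_orthogonal, Submodule.mem_span_range_iff_exists_fun] at hwK
    obtain ⟨y, hy⟩ := hwK
    replace hy : frameMap v (‖w‖⁻¹ • WithLp.toLp 2 y) = ‖w‖⁻¹ • w := by
      simp [frameMap, ← hy, Finset.smul_sum, smul_smul]
    have hw0 : 0 < ‖w‖ := norm_pos_iff.2 hw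
    have hw1 : ‖‖w‖⁻¹ • w‖ = 1 := norm_smul_inv_norm hw
    have hscale : {z | c < ⟪w, z⟫} = {z | ‖w‖⁻¹ * c < ⟪‖w‖⁻¹ • w, z⟫} := by
      ext z
      simp [inner_smul_left, hw0]
    by_contra! hlt
    rw [hscale] at hlt
    have h1 := hlevel i _ _ hw1 hlt
    have h2 := hvx i (‖w‖⁻¹ • WithLp.toLp 2 y)
      (by rw [← hv.norm_frameMap, hy, hw1])
    have h3 : ‖w‖⁻¹ * c < ⟪‖w‖⁻¹ • w, frameMap v x⟫ := by
      have := hsub (AffineSubspace.self_mem_mk' _ _)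
      rwa [hscale] at this
    have h4 : WithLp.toLp 2 (fun a => ⟪v a, frameMap v x⟫) = x := by
      ext a
      exact hv.inner_right_fintype x a
    rw [← hy, inner_frameMap, h4] at h3
    rw [← hy] at h1
    linarith
end

section
/- For all positive integers d, m, and r, there exists a growing function f : ℕ → ℕ (i.e., f(n) → ∞ as n → ∞) such that the following holds: for any finite sets A₁, …, A_m of hyperplanes in ℝ^d such that no point of ℝ^d is contained in more than r distinct hyperplanes of A₁ ∪ ⋯ ∪ A_m, there exist subsets A'_i ⊆ A_i with |A'_i| ≥ f(|A_i|) for each i, such that for every (d+1)-element set I ⊆ {1,…,m} of indices, no hyperplane of ℝ^d intersects all of the convex hulls conv(V(A'_i)), i ∈ I, simultaneously. -/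
open RealInnerProductSpace

/-- A hyperplane in ℝ^d: a set of the form `{x | ⟪v, x⟫ = c}` with `v ≠ 0`
(equivalently, a (d−1)-dimensional affine subspace). -/
def IsHyperplane {d : ℕ} (H : Set (EuclideanSpace ℝ (Fin d))) : Prop :=
  ∃ (v : EuclideanSpace ℝ (Fin d)) (c : ℝ), v ≠ 0 ∧ H = {x | ⟪v, x⟫ = c}

/-- The vertex set of a finite arrangement `A` of hyperplanes in ℝ^d:
points lying on at least `d` distinct hyperplanes of `A`. -/
def verts {d : ℕ} (A : Finset (Set (EuclideanSpace ℝ (Fin d)))) :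
    Set (EuclideanSpace ℝ (Fin d)) :=
  {x | ∃ B ⊆ A, d ≤ B.card ∧ ∀ H ∈ B, x ∈ H}


theorem exists_monochromatic_of_targets (k c : ℕ) : ∀ ℓ : Fin c → ℕ, ∃ N : ℕ,
    ∀ (α : Type) (s : Finset α) (col : Finset α → Fin c), N ≤ s.card →
      ∃ t ⊆ s, ∃ a, ℓ a ≤ t.card ∧ ∀ u ⊆ t, u.card = k → col u = a := by
  classical
  induction k with
  | zero =>
    intro ℓ
    refine ⟨∑ a, ℓ a, fun α s col hs => ⟨s, subset_rfl, col ∅, ?_, ?_⟩⟩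
    · exact (Finset.single_le_sum (fun _ _ => Nat.zero_le _) (Finset.mem_univ _)).trans hs
    · intro u _ hu
      rw [Finset.card_eq_zero.1 hu]
  | succ k ihk =>
    intro ℓ
    induction h : ∑ a, ℓ a using Nat.strong_induction_on generalizing ℓ with
    | _ w ih =>
      by_cases h0 : ∃ a, ℓ a = 0
      · obtain ⟨a, ha⟩ := h0
        refine ⟨0, fun α s col _ => ⟨∅, Finset.empty_subset _, a, by simp [ha], ?_⟩⟩
        intro u hu hc
        rw [Finset.subset_empty.1 hu] at hc
        simp at hc
      · push Not at h0
        have hlt : ∀ a, ∑ b, Function.update ℓ a (ℓ a - 1) b < w := by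
          intro a
          rw [← h]
          refine Finset.sum_lt_sum (fun b _ => ?_) ⟨a, Finset.mem_univ _, ?_⟩
          · by_cases hb : b = a
            · subst hb; simp
            · simp [hb]
          · have := h0 a
            simp; omega
        choose N hN using fun a => ih _ (hlt a) _ rfl
        obtain ⟨M, hM⟩ := ihk (fun _ => ∑ a, N a)
        refine ⟨M + 1, fun α s col hs => ?_⟩
        obtain ⟨x, hx⟩ : s.Nonempty := Finset.card_pos.1 (by omega)
        obtain ⟨t', ht', a, hca, hta⟩ := hM α (s.erase x) (fun u => col (insert x u))
          (by rw [Finset.card_erase_of_mem hx]; omega)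
        obtain ⟨t, ht, b, hcb, htb⟩ := hN a α t' col
          ((Finset.single_le_sum (fun _ _ => Nat.zero_le _) (Finset.mem_univ _)).trans hca)
        by_cases hb : b = a
        · subst hb
          have hxt : x ∉ t := fun hx' => by simpa using ht' (ht hx')
          refine ⟨insert x t, ?_, b, ?_, ?_⟩
          · exact Finset.insert_subset hx
              ((ht.trans ht').trans (Finset.erase_subset _ _))
          · rw [Finset.card_insert_of_notMem hxt]
            simp at hcb
            omega
          · intro u hu hc
            by_cases hxu : x ∈ u
            · rw [← Finset.insert_erase hxu]
              refine hta _ ?_ (by rw [Finset.card_erase_of_mem hxu]; omega)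
              exact (Finset.subset_insert_iff.1 hu).trans ht
            · exact htb u ((Finset.subset_insert_iff_of_notMem hxu).1 hu) hc
        · exact ⟨t, (ht.trans ht').trans (Finset.erase_subset _ _), b,
            by simpa [hb] using hcb, htb⟩

/-- The finite Ramsey theorem for `k`-uniform hypergraphs and at most `c` colours. -/
theorem exists_monochromatic_subset (k c n : ℕ) : ∃ N : ℕ,
    ∀ (α C : Type) [Fintype C], Fintype.card C ≤ c →
      ∀ (s : Finset α) (col : Finset α → C), N ≤ s.card →
        ∃ t ⊆ s, n ≤ t.card ∧ ∃ a, ∀ u ⊆ t, u.card = k → col u = a := by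
  obtain ⟨N, hN⟩ := exists_monochromatic_of_targets k c fun _ => n
  refine ⟨N, fun α C _ hC s col hs => ?_⟩
  let e : C ↪ Fin c := (Fintype.equivFin C).toEmbedding.trans (Fin.castLEEmb hC)
  obtain ⟨t, ht, a, hn, h⟩ := hN α s (fun u => e (col u)) hs
  by_cases hu : ∃ u ⊆ t, u.card = k
  · obtain ⟨u, hut, huk⟩ := hu
    refine ⟨t, ht, hn, col u, fun u' hu' hk' => e.injective ?_⟩
    rw [h u' hu' hk', h u hut huk]
  · exact ⟨t, ht, hn, col ∅, fun u hut huk => (hu ⟨u, hut, huk⟩).elim⟩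

/-- A sequence `G` growing as fast as prescribed in terms of its own partial sums. -/
theorem exists_seq_ge_of_partial_sums (R : ℕ → ℕ → ℕ) :
    ∃ G : ℕ → ℕ, ∀ t, G t = R t (∑ s ∈ Finset.range t, G s) := by
  let P : ℕ → ℕ := fun t => Nat.rec 0 (fun t p => p + R t p) t
  have hP : ∀ t, P t = ∑ s ∈ Finset.range t, R s (P s) := by
    intro t
    induction t with
    | zero => rfl
    | succ t ih => rw [Finset.sum_range_succ, ← ih]
  exact ⟨fun t => R t (P t), fun t => by rw [← hP t]⟩

/-- A product Ramsey theorem for sets of very different sizes: the size extracted from each set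
depends only on the size of that set. -/
theorem exists_product_ramsey (m k : ℕ) (C : Type) [Fintype C] : ∃ G : ℕ → ℕ,
    ∀ (α : Type) (t : Fin m → ℕ), Function.Injective t → ∀ (A : Fin m → Finset α)
      (J : Finset (Fin m)), (∀ i ∈ J, (A i).card = G (t i)) →
      ∀ col : (Fin m → Finset α) → C, ∃ A' : Fin m → Finset α,
        (∀ i ∈ J, A' i ⊆ A i ∧ t i ≤ (A' i).card) ∧
        ∀ S S' : Fin m → Finset α,
          (∀ i ∈ J, S i ⊆ A' i ∧ (S i).card = k) → (∀ i ∉ J, S i = ∅) →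
          (∀ i ∈ J, S' i ⊆ A' i ∧ (S' i).card = k) → (∀ i ∉ J, S' i = ∅) →
          col S = col S' := by
  classical
  choose R hR using fun t p : ℕ =>
    exists_monochromatic_subset k (Fintype.card C ^ ((2 ^ p) ^ m) + 1) t
  obtain ⟨G, hG⟩ := exists_seq_ge_of_partial_sums R
  refine ⟨G, fun α t ht A J => ?_⟩
  induction hJ : J.card generalizing J with
  | zero =>
    intro _ col
    rw [Finset.card_eq_zero] at hJ
    subst hJ
    refine ⟨fun _ => ∅, by simp, fun S S' _ hS _ hS' => congrArg col ?_⟩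
    funext i
    rw [hS i (by simp), hS' i (by simp)]
  | succ p ih =>
    intro hA col
    obtain ⟨i, hi, hmax⟩ := J.exists_max_image t (Finset.card_pos.1 (by omega))
    let Q : Finset (Fin m → Finset α) :=
      Fintype.piFinset fun j => if j ∈ J.erase i then (A j).powerset else {∅}
    have hQ : Q.card ≤ (2 ^ (∑ s ∈ Finset.range (t i), G s)) ^ m := by
      rw [Fintype.card_piFinset]
      refine (Finset.prod_le_pow_card _ _ (2 ^ (∑ s ∈ Finset.range (t i), G s)) ?_).trans
        (by simp)
      intro j _
      split_ifs with hj
      · rw [Finset.card_powerset, hA j (Finset.mem_of_mem_erase hj)]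
        refine Nat.pow_le_pow_right (by norm_num) ?_
        refine Finset.single_le_sum (f := G) (fun _ _ => Nat.zero_le _) ?_
        rw [Finset.mem_range]
        exact lt_of_le_of_ne (hmax j (Finset.mem_of_mem_erase hj))
          fun h => Finset.ne_of_mem_erase hj (ht h)
      · simpa using Nat.one_le_two_pow
    have hcard : Fintype.card (Q → C) ≤
        Fintype.card C ^ ((2 ^ (∑ s ∈ Finset.range (t i), G s)) ^ m) + 1 := by
      rw [Fintype.card_fun, Fintype.card_coe]
      rcases Nat.eq_zero_or_pos (Fintype.card C) with h0 | h0
      · rw [h0]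
        exact (pow_le_one₀ le_rfl zero_le_one).trans (Nat.le_add_left _ _)
      · exact (Nat.pow_le_pow_right h0 hQ).trans (Nat.le_succ _)
    obtain ⟨T, hTA, hTc, a, hT⟩ := hR (t i) _ α (Q → C) hcard (A i)
      (fun u S => col (Function.update S.1 i u)) (by rw [hA i hi, ← hG])
    obtain ⟨A', hA', hmono⟩ := ih (J.erase i) (by rw [Finset.card_erase_of_mem hi]; omega)
      (fun j hj => hA j (Finset.mem_of_mem_erase hj))
      (fun S => if hS : S ∈ Q then a ⟨S, hS⟩ else col S)
    refine ⟨Function.update A' i T, ?_, ?_⟩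
    · intro j hj
      by_cases hji : j = i
      · subst hji; simpa using ⟨hTA, hTc⟩
      · simpa [hji] using hA' j (Finset.mem_erase.2 ⟨hji, hj⟩)
    · have key : ∀ S : Fin m → Finset α,
          (∀ j ∈ J, S j ⊆ Function.update A' i T j ∧ (S j).card = k) → (∀ j ∉ J, S j = ∅) →
          (∀ j ∈ J.erase i, Function.update S i ∅ j ⊆ A' j ∧
            (Function.update S i ∅ j).card = k) ∧
          (∀ j ∉ J.erase i, Function.update S i ∅ j = ∅) ∧
          ∃ h : Function.update S i ∅ ∈ Q, col S = a ⟨_, h⟩ := by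
        intro S hS hS0
        have h1 : ∀ j ∈ J.erase i, Function.update S i ∅ j ⊆ A' j ∧
            (Function.update S i ∅ j).card = k := by
          intro j hj
          have := hS j (Finset.mem_of_mem_erase hj)
          simpa [Finset.ne_of_mem_erase hj] using this
        have h2 : ∀ j ∉ J.erase i, Function.update S i ∅ j = ∅ := by
          intro j hj
          by_cases hji : j = i
          · subst hji; simp
          · rw [Function.update_of_ne hji]
            exact hS0 j fun hj' => hj (Finset.mem_erase.2 ⟨hji, hj'⟩)
        have h3 : Function.update S i ∅ ∈ Q := by
          rw [Fintype.mem_piFinset]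
          intro j
          split_ifs with hj
          · exact Finset.mem_powerset.2 ((h1 j hj).1.trans (hA' j hj).1)
          · rw [h2 j hj]; simp
        refine ⟨h1, h2, h3, ?_⟩
        have hSi := hS i hi
        rw [Function.update_self] at hSi
        have := congrFun (hT (S i) hSi.1 hSi.2) ⟨_, h3⟩
        simpa using this
      intro S S' hS hS0 hS' hS0'
      obtain ⟨h1, h2, h3, h4⟩ := key S hS hS0
      obtain ⟨h1', h2', h3', h4'⟩ := key S' hS' hS0'
      have := hmono _ _ h1 h2 h1' h2'
      rw [dif_pos h3, dif_pos h3'] at this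
      rw [h4, h4', this]

/-- The common points of a finite family of sets. -/
def meet {E : Type*} (B : Finset (Set E)) : Set E := {x | ∀ H ∈ B, x ∈ H}

theorem meet_anti {E : Type*} {B B' : Finset (Set E)} (h : B ⊆ B') : meet B' ⊆ meet B :=
  fun _ hx H hH => hx H (h hH)

/-- If any `d` hyperplanes of a family meet in a flat of positive dimension, then all of them
have a common point. -/
theorem meet_nonempty_of_forall_not_subsingleton {d : ℕ}
    {A : Finset (Set (EuclideanSpace ℝ (Fin d)))} (hA : ∀ H ∈ A, IsHyperplane H)
    (hd : d ≤ A.card)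
    (h : ∀ B ⊆ A, B.card = d → (meet B).Nonempty ∧ ¬ (meet B).Subsingleton) :
    (meet A).Nonempty := by
  classical
  choose! n c _ hH using hA
  replace hH : ∀ H ∈ A, ∀ x, x ∈ H ↔ ⟪n H, x⟫ = c H := fun H hHA x => Set.ext_iff.1 (hH H hHA) x
  obtain ⟨b, hbA, -, hspan, hli⟩ := exists_linearIndepOn_extension
    (linearIndepOn_empty ℝ n) (Set.empty_subset (A : Set (Set (EuclideanSpace ℝ (Fin d)))))
  lift b to Finset (Set (EuclideanSpace ℝ (Fin d))) using A.finite_toSet.subset hbA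
  rw [Finset.coe_subset] at hbA
  have hcard : b.card ≤ d := by
    have := LinearIndependent.fintype_card_le_finrank (R := ℝ) hli
    simpa using this
  obtain ⟨B, hbB, hBA, hB⟩ := Finset.exists_subsuperset_card_eq hbA hcard hd
  have hne : b.card ≠ d := by
    intro hbd
    obtain rfl : b = B := Finset.eq_of_subset_of_card_le hbB (by omega)
    refine (h b hBA hB).2 fun x hx y hy => ?_
    have htop : Submodule.span ℝ (Set.range fun K : b => n K) = ⊤ :=
      LinearIndependent.span_eq_top_of_card_eq_finrank' hli (by simp [hbd])
    have h0 : innerₛₗ ℝ (x - y) = 0 := by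
      refine LinearMap.ext_on_range htop fun K => ?_
      have h1 := (hH K (hBA K.2) x).1 (hx K K.2)
      have h2 := (hH K (hBA K.2) y).1 (hy K K.2)
      rw [innerₛₗ_apply_apply, real_inner_comm, inner_sub_right, h1, h2, sub_self,
        LinearMap.zero_apply]
    exact sub_eq_zero.1 (inner_self_eq_zero.1 (LinearMap.congr_fun h0 (x - y)))
  obtain ⟨y, hy⟩ := (h B hBA hB).1
  refine ⟨y, fun H hHA => ?_⟩
  obtain ⟨B', hbB', hBA', hB'⟩ := Finset.exists_subsuperset_card_eq (s := insert H b) (n := d)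
    (Finset.insert_subset hHA hbA) ((Finset.card_insert_le _ _).trans (by omega)) hd
  obtain ⟨x, hx⟩ := (h B' hBA' hB').1
  have hxH := hx H (hbB' (Finset.mem_insert_self _ _))
  have hle : Submodule.span ℝ (n '' (b : Set (Set (EuclideanSpace ℝ (Fin d))))) ≤
      LinearMap.ker (innerₛₗ ℝ (y - x)) := by
    rw [Submodule.span_le]
    rintro _ ⟨K, hK, rfl⟩
    have h1 := (hH K (hbA hK) x).1 (hx K (hbB' (Finset.mem_insert_of_mem hK)))
    have h2 := (hH K (hbA hK) y).1 (hy K (hbB hK))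
    rw [SetLike.mem_coe, LinearMap.mem_ker, innerₛₗ_apply_apply, real_inner_comm,
      inner_sub_right, h1, h2, sub_self]
  have h0 := hle (hspan ⟨H, hHA, rfl⟩)
  rw [LinearMap.mem_ker, innerₛₗ_apply_apply, real_inner_comm, inner_sub_right,
    sub_eq_zero] at h0
  rw [hH H hHA] at hxH ⊢
  rw [h0, hxH]

/-- The vertices of a family of hyperplanes in general linear position, without a point common to
all, affinely span the whole space. -/
theorem linearMap_eq_zero_of_verts {d : ℕ}
    {A : Finset (Set (EuclideanSpace ℝ (Fin d)))} (hA : ∀ H ∈ A, IsHyperplane H)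
    (hd : d ≤ A.card)
    (h : ∀ B ⊆ A, B.card = d → (meet B).Nonempty ∧ (meet B).Subsingleton)
    (hne : ¬ (meet A).Nonempty) (φ : ℝ × EuclideanSpace ℝ (Fin d) →ₗ[ℝ] ℝ)
    (hφ : ∀ x ∈ verts A, φ (1, x) = 0) : φ = 0 := by
  classical
  choose! n c _ hH using hA
  replace hH : ∀ H ∈ A, ∀ x, x ∈ H ↔ ⟪n H, x⟫ = c H := fun H hHA x => Set.ext_iff.1 (hH H hHA) x
  obtain ⟨B, hBA, hB⟩ := Finset.exists_subset_card_eq hd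
  obtain ⟨⟨v, hv⟩, hsub⟩ := h B hBA hB
  have hv0 := hφ v ⟨B, hBA, hB.ge, hv⟩
  obtain ⟨H', hHA', hvH'⟩ : ∃ H ∈ A, v ∉ H := by
    by_contra! hc
    exact hne ⟨v, hc⟩
  have hHB' : H' ∉ B := fun hc => hvH' (hv H' hc)
  have hu : ∀ K : B, ∃ u, φ (0, u) = 0 ∧ ⟪n K, u⟫ ≠ 0 ∧
      ∀ L : B, L ≠ K → ⟪n L, u⟫ = 0 := by
    intro K
    have hsubA : insert H' (B.erase K) ⊆ A :=
      Finset.insert_subset hHA' ((Finset.erase_subset _ _).trans hBA)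
    have hc : (insert H' (B.erase K)).card = d := by
      have := Finset.card_pos.2 ⟨_, K.2⟩
      rw [Finset.card_insert_of_notMem fun hc => hHB' (Finset.mem_of_mem_erase hc),
        Finset.card_erase_of_mem K.2]
      omega
    obtain ⟨w, hw⟩ := (h _ hsubA hc).1
    have hL : ∀ L : B, L ≠ K → w ∈ (L : Set (EuclideanSpace ℝ (Fin d))) := fun L hLK =>
      hw L (Finset.mem_insert_of_mem (Finset.mem_erase.2 ⟨fun hc => hLK (Subtype.ext hc), L.2⟩))
    have hmem : ∀ L : B, w ∈ (L : Set (EuclideanSpace ℝ (Fin d))) ↔ ⟪n L, w - v⟫ = 0 := by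
      intro L
      rw [hH L (hBA L.2), inner_sub_right, (hH L (hBA L.2) v).1 (hv L L.2), sub_eq_zero]
    refine ⟨w - v, ?_, fun hc => ?_, fun L hLK => (hmem L).1 (hL L hLK)⟩
    · have := hφ w ⟨_, hsubA, hc.ge, hw⟩
      have h2 : ((0 : ℝ), w - v) = (1, w) - (1, v) := by simp
      rw [h2, map_sub, this, hv0, sub_zero]
    · have hwK := (hmem K).2 hc
      have hwv : w = v := by
        refine hsub (fun L hLB => ?_) hv
        by_cases hLK : L = K
        · exact hLK ▸ hwK
        · exact hL ⟨L, hLB⟩ fun hc => hLK (congrArg Subtype.val hc)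
      exact hvH' (hwv ▸ hw H' (Finset.mem_insert_self _ _))
  choose u hu0 hu1 hu2 using hu
  have hli : LinearIndependent ℝ u := by
    rw [Fintype.linearIndependent_iff]
    intro g hg K
    have h1 : ⟪n K, ∑ L, g L • u L⟫ = g K * ⟪n K, u K⟫ := by
      rw [inner_sum, Finset.sum_eq_single K]
      · rw [real_inner_smul_right]
      · intro L _ hLK
        rw [real_inner_smul_right, hu2 L K hLK.symm, mul_zero]
      · simp
    rw [hg, inner_zero_right] at h1
    exact (mul_eq_zero.1 h1.symm).resolve_right (hu1 K)
  have hψ : φ.comp (LinearMap.inr ℝ ℝ _) = 0 := by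
    refine LinearMap.ext_on_range (hli.span_eq_top_of_card_eq_finrank' (by simp [hB])) fun K => ?_
    simpa using hu0 K
  have hψ' : ∀ x, φ (0, x) = 0 := fun x => by simpa using LinearMap.congr_fun hψ x
  have h1 : φ (1, 0) = 0 := by
    have h2 : ((1 : ℝ), (0 : EuclideanSpace ℝ (Fin d))) = (1, v) - (0, v) := by simp
    rw [h2, map_sub, hv0, hψ', sub_zero]
  refine LinearMap.ext fun p => ?_
  have hp : p = p.1 • ((1 : ℝ), (0 : EuclideanSpace ℝ (Fin d))) + (0, p.2) := by
    ext <;> simp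
  rw [hp, map_add, map_smul, h1, hψ']
  simp

section Multilinear

variable {ι E : Type*} [Finite ι] [AddCommGroup E] [Module ℝ E]

/-- A multilinear map vanishes if it vanishes on all transversals of spanning sets. -/
theorem MultilinearMap.eq_zero_of_transversals (f : MultilinearMap ℝ (fun _ : ι => ℝ × E) ℝ)
    (K : ι → Set E)
    (hK : ∀ j, ∀ φ : ℝ × E →ₗ[ℝ] ℝ, (∀ x ∈ K j, φ (1, x) = 0) → φ = 0)
    (hf : ∀ x : ι → E, (∀ j, x j ∈ K j) → f (fun j => (1, x j)) = 0) : f = 0 := by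
  classical
  have := Fintype.ofFinite ι
  have key : ∀ T : Finset ι, ∀ w : ι → ℝ × E, (∀ j ∉ T, ∃ x ∈ K j, w j = (1, x)) → f w = 0 := by
    intro T
    induction T using Finset.induction_on with
    | empty =>
      intro w hw
      choose x hx hwx using fun j => hw j (by simp)
      rw [show w = fun j => (1, x j) from funext hwx]
      exact hf x hx
    | insert j T hj ih =>
      intro w hw
      have h0 : f.toLinearMap w j = 0 := by
        refine hK j _ fun x hx => ih _ fun i hi => ?_
        by_cases hij : i = j
        · subst hij
          exact ⟨x, hx, by simp⟩
        · rw [Function.update_of_ne hij]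
          exact hw i (by simp [hij, hi])
      simpa using LinearMap.congr_fun h0 (w j)
  ext w
  exact key Finset.univ w (by simp)

/-- A multilinear map that is positive on all transversals of a family of sets is positive on all
transversals of their convex hulls. -/
theorem MultilinearMap.pos_of_mem_convexHull (f : MultilinearMap ℝ (fun _ : ι => ℝ × E) ℝ)
    (K : ι → Set E)
    (hf : ∀ x : ι → E, (∀ j, x j ∈ K j) → 0 < f (fun j => (1, x j)))
    (y : ι → E) (hy : ∀ j, y j ∈ convexHull ℝ (K j)) : 0 < f (fun j => (1, y j)) := by
  classical
  have := Fintype.ofFinite ι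
  have key : ∀ T : Finset ι, ∀ x : ι → E, (∀ j ∈ T, x j ∈ convexHull ℝ (K j)) →
      (∀ j ∉ T, x j ∈ K j) → 0 < f (fun j => (1, x j)) := by
    intro T
    induction T using Finset.induction_on with
    | empty => exact fun x _ hx => hf x fun j => hx j (by simp)
    | insert j T hj ih =>
      intro x hx hxK
      let g := f.toLinearMap (fun i => ((1 : ℝ), x i)) j
      have hg : ∀ z, g (1, z) = f (fun i => (1, Function.update x j z i)) := by
        intro z
        refine congrArg f (funext fun i => ?_)
        by_cases hij : i = j
        · subst hij; simp
        · simp [hij]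
      have hconv : Convex ℝ {z | 0 < g (1, z)} := by
        intro z hz z' hz' a b ha hb hab
        have h1 : ((1 : ℝ), a • z + b • z') = a • (1, z) + b • (1, z') := by
          simp [hab]
        simp only [Set.mem_ofPred_eq] at hz hz' ⊢
        rw [h1, map_add, map_smul, map_smul, smul_eq_mul, smul_eq_mul]
        rcases ha.eq_or_lt with rfl | ha
        · have : b = 1 := by linarith
          subst this
          linarith
        · have := mul_pos ha hz
          have := mul_nonneg hb hz'.le
          linarith
      have hsub : K j ⊆ {z | 0 < g (1, z)} := by
        intro z hz
        simp only [Set.mem_ofPred_eq]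
        rw [hg]
        refine ih _ (fun i hi => ?_) fun i hi => ?_
        · rw [Function.update_of_ne (ne_of_mem_of_not_mem hi hj)]
          exact hx i (Finset.mem_insert_of_mem hi)
        · by_cases hij : i = j
          · subst hij; simpa using hz
          · rw [Function.update_of_ne hij]
            exact hxK i (by simp [hij, hi])
      have := convexHull_min hsub hconv (hx j (Finset.mem_insert_self _ _))
      simp only [Set.mem_ofPred_eq] at this
      rwa [hg, Function.update_eq_self] at this
  exact key Finset.univ y (fun j _ => hy j) (by simp)

/-- If the orientation of transversals of spanning sets is constant, then no nonzero linear
functional vanishes on a transversal of their convex hulls. -/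
theorem linearMap_eq_zero_of_sign_det_eq {k : ℕ} [FiniteDimensional ℝ E]
    (b : Module.Basis (Fin k) ℝ (ℝ × E)) (K : Fin k → Set E)
    (hK : ∀ j, ∀ φ : ℝ × E →ₗ[ℝ] ℝ, (∀ x ∈ K j, φ (1, x) = 0) → φ = 0)
    (s : SignType)
    (hs : ∀ x : Fin k → E, (∀ j, x j ∈ K j) → SignType.sign (b.det fun j => (1, x j)) = s)
    (y : Fin k → E) (hy : ∀ j, y j ∈ convexHull ℝ (K j))
    (φ : ℝ × E →ₗ[ℝ] ℝ) (hφ : ∀ j, φ (1, y j) = 0) : φ = 0 := by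
  have hdet : b.det (fun j => (1, y j)) ≠ 0 := by
    rcases s with _ | _ | _
    · have h0 := MultilinearMap.eq_zero_of_transversals b.det.toMultilinearMap K hK
        fun x hx => sign_eq_zero_iff.1 (hs x hx)
      have h1 := b.det_self
      have h2 : b.det b = 0 := congrArg (fun f => f b) h0
      simp [h2] at h1
    · have := MultilinearMap.pos_of_mem_convexHull (-b.det.toMultilinearMap) K
        (fun x hx => by simpa using sign_eq_neg_one_iff.1 (hs x hx)) y hy
      intro h0
      simp [h0] at this
    · exact (MultilinearMap.pos_of_mem_convexHull b.det.toMultilinearMap K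
        (fun x hx => sign_eq_one_iff.1 (hs x hx)) y hy).ne'
  have hspan := (b.is_basis_iff_det.2 hdet.isUnit).2
  exact LinearMap.ext_on_range hspan fun j => by simpa using hφ j

end Multilinear

theorem verts_eq_empty_of_forall_meet_eq_empty {d : ℕ}
    {A : Finset (Set (EuclideanSpace ℝ (Fin d)))}
    (h : ∀ B ⊆ A, B.card = d → meet B = ∅) : verts A = ∅ := by
  refine Set.eq_empty_iff_forall_notMem.2 ?_
  rintro x ⟨B, hB, hd, hx⟩
  obtain ⟨B', hB', hd'⟩ := Finset.exists_subset_card_eq hd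
  have : x ∈ meet B' := meet_anti hB' hx
  rw [h B' (hB'.trans hB) hd'] at this
  exact this

/-- A growing function read off from a sequence `G` of thresholds, `m` of them at a time. -/
theorem exists_growing_of_thresholds (m K : ℕ) (G : ℕ → ℕ) : ∃ f : ℕ → ℕ,
    Filter.Tendsto f Filter.atTop Filter.atTop ∧
      ∀ n, f n ≠ 0 → K < f n ∧ ∀ i < m, G (m * f n + i) ≤ n := by
  classical
  refine ⟨fun n => Nat.findGreatest (fun k => K < k ∧ ∀ i < m, G (m * k + i) ≤ n) n, ?_, ?_⟩
  · rw [Filter.tendsto_atTop]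
    intro b
    filter_upwards [Filter.eventually_ge_atTop
      (b + K + 1 + ∑ i ∈ Finset.range m, G (m * (b + K + 1) + i))] with n hn
    refine (show b ≤ b + K + 1 by omega).trans (Nat.le_findGreatest (by omega) ⟨by omega, ?_⟩)
    intro i hi
    have := Finset.single_le_sum (f := fun i => G (m * (b + K + 1) + i))
      (fun _ _ => Nat.zero_le _) (Finset.mem_range.2 hi)
    omega
  · exact fun n hn => Nat.findGreatest_of_ne_zero rfl hn

/-- Same-type lemma for hyperplane arrangements: for all positive `d, m, r` there
is a growing function `f` such that from any `m` arrangements (no point on more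
than `r` of the hyperplanes) one can select subsets of size `f(|A_i|)` whose
convex hulls of vertex sets are well separated: no hyperplane meets `d + 1` of
them simultaneously. -/
theorem same_type_lemma (d m r : ℕ) (hd : 0 < d) (hm : 0 < m) (hr : 0 < r) :
    ∃ f : ℕ → ℕ, Filter.Tendsto f Filter.atTop Filter.atTop ∧
      ∀ A : Fin m → Finset (Set (EuclideanSpace ℝ (Fin d))),
        (∀ i, ∀ H ∈ A i, IsHyperplane H) →
        (∀ (x : EuclideanSpace ℝ (Fin d)) (B : Finset (Set (EuclideanSpace ℝ (Fin d)))),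
          (∀ H ∈ B, ∃ i, H ∈ A i) → (∀ H ∈ B, x ∈ H) → B.card ≤ r) →
        ∃ A' : Fin m → Finset (Set (EuclideanSpace ℝ (Fin d))),
          (∀ i, A' i ⊆ A i) ∧ (∀ i, f (A i).card ≤ (A' i).card) ∧
          ∀ I : Finset (Fin m), I.card = d + 1 →
            ¬ ∃ H : Set (EuclideanSpace ℝ (Fin d)), IsHyperplane H ∧
              ∀ i ∈ I, (H ∩ convexHull ℝ (verts (A' i))).Nonempty := by
  classical
  let E := EuclideanSpace ℝ (Fin d)
  obtain ⟨G, hG⟩ := exists_product_ramsey m d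
    ((Fin m → Prop × Prop) × ((Fin (d + 1) → Fin m) → SignType))
  obtain ⟨f, hf, hfG⟩ := exists_growing_of_thresholds m (r + d) G
  refine ⟨f, hf, fun A hA hAr => ?_⟩
  let J : Finset (Fin m) := Finset.univ.filter fun i => f (A i).card ≠ 0
  have hJ : ∀ i ∈ J, r + d < f (A i).card ∧ G (m * f (A i).card + i) ≤ (A i).card := by
    intro i hi
    have := hfG _ (Finset.mem_filter.1 hi).2
    exact ⟨this.1, this.2 i i.2⟩
  have hA₀ : ∀ i, ∃ A₀ ⊆ A i, i ∈ J → A₀.card = G (m * f (A i).card + i) := by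
    intro i
    by_cases hi : i ∈ J
    · obtain ⟨A₀, h, h'⟩ := Finset.exists_subset_card_eq (hJ i hi).2
      exact ⟨A₀, h, fun _ => h'⟩
    · exact ⟨∅, Finset.empty_subset _, fun h => (hi h).elim⟩
  choose A₀ hA₀A hA₀c using hA₀
  have ht : Function.Injective fun i : Fin m => m * f (A i).card + i := by
    intro i j hij
    have := congrArg (· % m) hij
    simpa [Nat.mod_eq_of_lt, Fin.ext_iff] using this
  let v : Finset (Set E) → E := fun B => if h : (meet B).Nonempty then h.some else 0
  have hv : ∀ B x, x ∈ meet B → (meet B).Subsingleton → v B = x := by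
    intro B x hx hB
    have h : (meet B).Nonempty := ⟨x, hx⟩
    simp only [v, dif_pos h]
    exact hB h.some_mem hx
  let b : Module.Basis (Fin (d + 1)) ℝ (ℝ × E) :=
    Module.finBasisOfFinrankEq ℝ _ (by simp [E, add_comm])
  obtain ⟨A', hA', hmono⟩ := hG _ _ ht A₀ J hA₀c fun S =>
    (fun i => ((meet (S i)).Nonempty, (meet (S i)).Subsingleton),
      fun σ => SignType.sign (b.det fun j => (1, v (S (σ j)))))
  have hcard : ∀ i ∈ J, f (A i).card ≤ (A' i).card := fun i hi =>
    ((Nat.le_mul_of_pos_left _ hm).trans (Nat.le_add_right _ _)).trans (hA' i hi).2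
  have hlarge : ∀ i ∈ J, r + d < (A' i).card := fun i hi => (hJ i hi).1.trans_le (hcard i hi)
  have hsub : ∀ i ∈ J, A' i ⊆ A i := fun i hi => (hA' i hi).1.trans (hA₀A i)
  refine ⟨fun i => if i ∈ J then A' i else ∅, fun i => ?_, fun i => ?_, ?_⟩
  · beta_reduce
    split_ifs with hi
    · exact hsub i hi
    · exact Finset.empty_subset _
  · beta_reduce
    split_ifs with hi
    · exact hcard i hi
    · simpa [J] using hi
  rintro I hI ⟨H, ⟨n, c, hn, rfl⟩, hH⟩
  have hverts : ∀ i ∈ I, (verts (if i ∈ J then A' i else ∅)).Nonempty := fun i hi =>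
    convexHull_nonempty_iff.1 ((hH i hi).mono Set.inter_subset_right)
  have hIJ : ∀ i ∈ I, i ∈ J := by
    intro i hi
    by_contra hiJ
    obtain ⟨x, B, hB, hdB, -⟩ := hverts i hi
    rw [if_neg hiJ, Finset.subset_empty] at hB
    subst hB
    simp at hdB
    omega
  have hS₀ : ∀ i, ∃ S₀ : Finset (Set E), (i ∈ J → S₀ ⊆ A' i ∧ S₀.card = d) ∧ (i ∉ J → S₀ = ∅) := by
    intro i
    by_cases hi : i ∈ J
    · obtain ⟨B, h⟩ := Finset.exists_subset_card_eq (s := A' i) (n := d)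
        (by have := hlarge i hi; omega)
      exact ⟨B, fun _ => h, fun h => (h hi).elim⟩
    · exact ⟨∅, fun h => (hi h).elim, fun _ => rfl⟩
  choose S₀ hS₀ hS₀' using hS₀
  have hpoint : ∀ i ∈ J, ¬ (meet (A' i)).Nonempty := by
    rintro i hi ⟨x, hx⟩
    have := hAr x (A' i) (fun H hH => ⟨i, hsub i hi hH⟩) hx
    have := hlarge i hi
    omega
  have htype : ∀ i ∈ J, ∀ B ⊆ A' i, B.card = d →
      ((meet B).Nonempty ↔ (meet (S₀ i)).Nonempty) ∧
      ((meet B).Subsingleton ↔ (meet (S₀ i)).Subsingleton) := by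
    intro i hi B hB hBd
    have := hmono (Function.update S₀ i B) S₀ (fun j hj => ?_) (fun j hj => ?_) hS₀ hS₀'
    · have := congrFun (congrArg Prod.fst this) i
      simpa using this
    · by_cases hji : j = i
      · subst hji; simpa using ⟨hB, hBd⟩
      · simpa [hji] using hS₀ j hj
    · rw [Function.update_of_ne (ne_of_mem_of_not_mem hi hj).symm]
      exact hS₀' j hj
  have hgen : ∀ i ∈ I, ∀ B ⊆ A' i, B.card = d →
      (meet B).Nonempty ∧ (meet B).Subsingleton := by
    intro i hi
    have hiJ := hIJ i hi
    have hne : (meet (S₀ i)).Nonempty := by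
      by_contra hne
      have hi' := hverts i hi
      rw [if_pos hiJ, verts_eq_empty_of_forall_meet_eq_empty] at hi'
      · exact Set.not_nonempty_empty hi'
      · intro B hB hBd
        rw [← Set.not_nonempty_iff_eq_empty, (htype i hiJ B hB hBd).1]
        exact hne
    have hss : (meet (S₀ i)).Subsingleton := by
      by_contra hss
      refine hpoint i hiJ (meet_nonempty_of_forall_not_subsingleton
        (fun H hH => hA i H (hsub i hiJ hH)) (by have := hlarge i hiJ; omega)
        fun B hB hBd => ?_)
      rw [(htype i hiJ B hB hBd).1, (htype i hiJ B hB hBd).2]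
      exact ⟨hne, hss⟩
    intro B hB hBd
    rw [(htype i hiJ B hB hBd).1, (htype i hiJ B hB hBd).2]
    exact ⟨hne, hss⟩
  let e : Fin (d + 1) ≃ I := (finCongr hI.symm).trans I.equivFin.symm
  have he : ∀ j, (e j : Fin m) ∈ J := fun j => hIJ _ (e j).2
  choose y hyH hy using fun j => hH (e j) (e j).2
  let φ : ℝ × E →ₗ[ℝ] ℝ :=
    (innerₛₗ ℝ n).comp (LinearMap.snd ℝ ℝ E) - c • LinearMap.fst ℝ ℝ E
  have hφ : φ = 0 := by
    refine linearMap_eq_zero_of_sign_det_eq b (fun j => verts (A' (e j))) (fun j => ?_)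
      (SignType.sign (b.det fun j => (1, v (S₀ (e j))))) (fun x hx => ?_) y (fun j => ?_) φ
      fun j => ?_
    · exact linearMap_eq_zero_of_verts (fun H hH => hA _ H (hsub _ (he j) hH))
        (by have := hlarge _ (he j); omega) (hgen _ (e j).2) (hpoint _ (he j))
    · have hB : ∀ j, ∃ B ⊆ A' (e j), B.card = d ∧ v B = x j := by
        intro j
        obtain ⟨B, hB, hBd, hxB⟩ := hx j
        obtain ⟨B', hB', hBd'⟩ := Finset.exists_subset_card_eq hBd
        exact ⟨B', hB'.trans hB, hBd', hv _ _ (meet_anti hB' hxB)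
          (hgen _ (e j).2 _ (hB'.trans hB) hBd').2⟩
      choose B hB hBd hBv using hB
      let S : Fin m → Finset (Set E) := fun i => if h : i ∈ I then B (e.symm ⟨i, h⟩) else S₀ i
      have hSe : ∀ j, S (e j) = B j := fun j => by simp [S]
      have hmS := hmono S S₀ (fun i hi => ?_) (fun i hi => ?_) hS₀ hS₀'
      · have := congrFun (congrArg Prod.snd hmS) fun j => (e j : Fin m)
        simpa only [hSe, hBv] using this
      · by_cases hiI : i ∈ I
        · obtain ⟨j, hj⟩ := e.surjective ⟨i, hiI⟩
          obtain rfl : (e j : Fin m) = i := by rw [hj]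
          rw [hSe]
          exact ⟨hB j, hBd j⟩
        · simpa [S, hiI] using hS₀ i hi
      · have hiI : i ∉ I := fun h => hi (hIJ i h)
        simpa [S, hiI] using hS₀' i hi
    · have := hy j
      beta_reduce at this
      rwa [if_pos (he j)] at this
    · have : ⟪n, y j⟫ = c := hyH j
      simp [φ, this]
  have := LinearMap.congr_fun hφ (0, n)
  simp [φ, hn] at this
end
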